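/- arXiv:1107.4715 — 2 statements merged into one kernel-verified Lean document; each statement's English description precedes it below -/
import Mathlib

section
/- Let ℓ ∈ {2, 3, 5} and let k > 2ℓ be an odd integer. Then the ratio ex(n, 𝓒_{2ℓ} ∪ {C_k}) / z(n, 𝓒_{2ℓ}) tends to 1 as n → ∞. -/
open SimpleGraph

/-- `G` contains a cycle of length `m` (as a subgraph), i.e. there is a closed
walk that is a cycle and has length `m`. -/
def HasCycleLength {V : Type*} (G : SimpleGraph V) (m : ℕ) : Prop :=
  ∃ (v : V) (w : G.Walk v v), w.IsCycle ∧ w.length = m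

/-- `G` is `𝓒_{2ℓ}`-free: it contains no cycle of length `2m` for any `2 ≤ m ≤ ℓ`. -/
def EvenCycleFree {V : Type*} (G : SimpleGraph V) (ℓ : ℕ) : Prop :=
  ∀ m, 2 ≤ m → m ≤ ℓ → ¬ HasCycleLength G (2 * m)

/-- `ex(n, 𝓒_{2ℓ} ∪ {C_k})`: the maximum number of edges of a graph on `n`
vertices with no cycle of length `2m` for `2 ≤ m ≤ ℓ` and no cycle of length `k`. -/
noncomputable def exTuran (n ℓ k : ℕ) : ℕ :=
  sSup {e | ∃ G : SimpleGraph (Fin n),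
    EvenCycleFree G ℓ ∧ ¬ HasCycleLength G k ∧ G.edgeSet.ncard = e}

/-- `z(n, 𝓒_{2ℓ})`: the maximum number of edges of a bipartite (i.e. 2-colorable)
graph on `n` vertices with no cycle of length `2m` for `2 ≤ m ≤ ℓ`. -/
noncomputable def zZar (n ℓ : ℕ) : ℕ :=
  sSup {e | ∃ G : SimpleGraph (Fin n),
    EvenCycleFree G ℓ ∧ G.Colorable 2 ∧ G.edgeSet.ncard = e}


namespace ESEC

theorem hasCycle_of_seq {V : Type*} {G : SimpleGraph V} (m : ℕ) (hm : 3 ≤ m) (c : ℕ → V)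
    (hinj : ∀ i j, i < m → j < m → c i = c j → i = j)
    (hadj : ∀ i, i + 1 < m → G.Adj (c i) (c (i + 1))) (hlast : G.Adj (c (m - 1)) (c 0)) :
    HasCycleLength G m := by
  obtain ⟨n, rfl⟩ : ∃ n, m = n + 3 := ⟨m - 3, by omega⟩
  have key : ∀ a b : Fin (n + 3), b - a = 1 → G.Adj (c a) (c b) := by
    intro a b h
    have hb : b = a + 1 := by rw [← h]; abel
    subst hb
    by_cases ha : a = Fin.last (n + 2)
    · subst ha
      simpa using hlast
    · have : ((a + 1 : Fin (n + 3)) : ℕ) = a + 1 := by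
        rw [Fin.val_add_one]; simp [ha]
      rw [this]
      apply hadj
      have := a.2
      have h3 : (a : ℕ) ≠ n + 2 := fun h => ha (Fin.ext h)
      omega
  let f : SimpleGraph.cycleGraph (n + 3) →g G :=
    ⟨fun i => c i, by
      intro a b hab
      rw [SimpleGraph.cycleGraph_adj'] at hab
      rcases hab with h | h
      · exact (key b a (Fin.ext (by simpa using h))).symm
      · exact key a b (Fin.ext (by simpa using h))⟩
  have hf : Function.Injective f := fun a b h => Fin.ext (hinj a b a.2 b.2 h)
  refine ⟨_, (SimpleGraph.cycleGraph.cycle n).map f, ?_, ?_⟩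
  · exact (SimpleGraph.cycleGraph.isCycle_cycle).map hf
  · simp

theorem hasCycle_of_two {V : Type*} {G : SimpleGraph V} (r s : ℕ) (hr : 1 ≤ r) (hs : 1 ≤ s)
    (hrs : 3 ≤ r + s) (a b : ℕ → V) (h0 : a 0 = b 0) (h1 : a r = b s)
    (ha : ∀ i, i < r → G.Adj (a i) (a (i + 1))) (hb : ∀ i, i < s → G.Adj (b i) (b (i + 1)))
    (hai : ∀ i j, i ≤ r → j ≤ r → a i = a j → i = j)
    (hbi : ∀ i j, i ≤ s → j ≤ s → b i = b j → i = j)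
    (hab : ∀ i j, i ≤ r → j ≤ s → a i = b j → (i = 0 ∧ j = 0) ∨ (i = r ∧ j = s)) :
    HasCycleLength G (r + s) := by
  refine hasCycle_of_seq (r + s) hrs (fun t => if t ≤ r then a t else b (r + s - t)) ?_ ?_ ?_
  · intro i j hi hj h
    split_ifs at h with h2 h3 h3
    · exact hai i j h2 h3 h
    · rcases hab _ _ h2 (by omega) h with h | h <;> omega
    · rcases hab _ _ h3 (by omega) h.symm with h | h <;> omega
    · have := hbi _ _ (by omega) (by omega) h
      omega
  · intro i hi
    split_ifs with h2 h3 h3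
    · exact ha i (by omega)
    · have : i = r := by omega
      subst this
      rw [h1]
      have := (hb (s - 1) (by omega)).symm
      rw [show s - 1 + 1 = s by omega] at this
      rwa [show i + s - (i + 1) = s - 1 by omega]
    · omega
    · have := (hb (r + s - (i + 1)) (by omega)).symm
      rwa [show r + s - (i + 1) + 1 = r + s - i by omega] at this
  · skip
    rw [if_pos (Nat.zero_le _), h0]
    split_ifs with h2
    · have : s = 1 := by omega
      subst this
      rw [show r + 1 - 1 = r by omega, h1]
      exact (hb 0 (by omega)).symm
    · rw [show r + s - (r + s - 1) = 1 by omega]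
      exact (hb 0 (by omega)).symm

/-- distances along a shortest walk -/
theorem dist_getVert {V : Type*} {G : SimpleGraph V} {u z : V} (p : G.Walk u z)
    (hp : p.length = G.dist u z) (t : ℕ) (ht : t ≤ p.length) : G.dist u (p.getVert t) = t := by
  have h1 : G.dist u (p.getVert t) ≤ t := by
    have := SimpleGraph.dist_le (p.take t)
    rw [SimpleGraph.Walk.take_length] at this
    omega
  have h2 : G.dist (p.getVert t) z ≤ p.length - t := by
    have := SimpleGraph.dist_le (p.drop t)
    rwa [SimpleGraph.Walk.drop_length] at this
  have h3 : G.dist u z ≤ G.dist u (p.getVert t) + G.dist (p.getVert t) z :=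
    (p.take t).reachable.dist_triangle_left _
  omega

/-- Core lemma: in a graph without short even cycles, `y` has at most one neighbour at distance
`i` from `u`, unless `y` is at distance `i - 1`. -/
theorem core {V : Type*} {G : SimpleGraph V} {ℓ : ℕ} (hG : EvenCycleFree G ℓ) (u y z z' : V)
    (i : ℕ) (hi : 1 ≤ i) (hiℓ : i + 1 ≤ ℓ) (hy : G.dist u y + 1 ≠ i)
    (hz : G.dist u z = i) (hz' : G.dist u z' = i) (hyz : G.Adj y z) (hyz' : G.Adj y z') :
    z = z' := by
  classical
  by_contra hne
  obtain ⟨p, hp⟩ := SimpleGraph.exists_walk_of_dist_ne_zero (G := G) (u := u) (v := z) (by omega)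
  obtain ⟨q, hq⟩ := SimpleGraph.exists_walk_of_dist_ne_zero (G := G) (u := u) (v := z') (by omega)
  have hpd := dist_getVert p hp
  have hqd := dist_getVert q hq
  have hpl : p.length = i := by omega
  have hql : q.length = i := by omega
  have hpz : p.getVert i = z := by rw [← hpl]; exact p.getVert_length
  have hqz : q.getVert i = z' := by rw [← hql]; exact q.getVert_length
  -- largest common index
  have hex : ∃ j, p.getVert j = q.getVert j ∧ j < i := ⟨0, by simp, by omega⟩
  obtain ⟨j, ⟨hj, hji⟩, hmax⟩ : ∃ j, (p.getVert j = q.getVert j ∧ j < i) ∧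
      ∀ t, j < t → t ≤ i → p.getVert t ≠ q.getVert t := by
    let S := (Finset.range i).filter (fun j => p.getVert j = q.getVert j)
    have hS : S.Nonempty := by
      obtain ⟨j, h1, h2⟩ := hex
      exact ⟨j, by simp [S, h1, h2]⟩
    have hm := S.max'_mem hS
    refine ⟨S.max' hS, by simpa [S, and_comm] using hm, ?_⟩
    intro t ht hti heq
    rcases hti.lt_or_eq with h | h
    · have := S.le_max' t (by simp [S, h, heq])
      omega
    · subst h
      exact hne (hpz.symm.trans (heq.trans hqz))
  have hyu : ∀ {w : V} (r : G.Walk u w), r.length = i → G.dist u w = i → G.Adj y w →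
      (∀ t, t ≤ i → G.dist u (r.getVert t) = t) → ∀ t, t ≤ i → r.getVert t ≠ y := by
    intro w r hr hw hyw hrd t ht hty
    have h1 := hrd t ht
    rw [hty] at h1
    have hti : t ≠ i := by
      rintro rfl
      have : r.getVert t = w := by rw [← hr]; exact r.getVert_length
      exact hyw.ne (hty.symm.trans this)
    have h2 : G.dist u w ≤ G.dist u y + G.dist y w := by
      have : G.Reachable u y := hty ▸ (r.take t).reachable
      exact this.dist_triangle_left _
    rw [SimpleGraph.dist_eq_one_iff_adj.2 hyw] at h2
    omega
  have hpy := hyu p hpl hz hyz (by intro t ht; exact hpd t (by omega))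
  have hqy := hyu q hql hz' hyz' (by intro t ht; exact hqd t (by omega))
  have hcyc := hasCycle_of_two (G := G) (i - j + 1) (i - j + 1) (by omega) (by omega) (by omega)
    (fun t => if t ≤ i - j then p.getVert (j + t) else y)
    (fun t => if t ≤ i - j then q.getVert (j + t) else y) (by simp [hj]) (by simp)
    (by
      intro t ht
      split_ifs with h1 h2 h2
      · exact p.adj_getVert_succ (by omega)
      · have : j + t = i := by omega
        rw [this, hpz]; exact hyz.symm
      · omega
      · omega)
    (by
      intro t ht
      split_ifs with h1 h2 h2
      · exact q.adj_getVert_succ (by omega)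
      · have : j + t = i := by omega
        rw [this, hqz]; exact hyz'.symm
      · omega
      · omega)
    (by
      intro s t hs ht h
      split_ifs at h with h1 h2 h2
      · have e1 := hpd (j + s) (by omega)
        have e2 := hpd (j + t) (by omega)
        rw [h] at e1
        omega
      · exact absurd h (hpy _ (by omega))
      · exact absurd h.symm (hpy _ (by omega))
      · omega)
    (by
      intro s t hs ht h
      split_ifs at h with h1 h2 h2
      · have e1 := hqd (j + s) (by omega)
        have e2 := hqd (j + t) (by omega)
        rw [h] at e1
        omega
      · exact absurd h (hqy _ (by omega))
      · exact absurd h.symm (hqy _ (by omega))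
      · omega)
    (by
      intro s t hs ht h
      split_ifs at h with h1 h2 h2
      · have e1 := hpd (j + s) (by omega)
        have e2 := hqd (j + t) (by omega)
        rw [h] at e1
        have : s = t := by omega
        subst this
        by_cases hs0 : s = 0
        · left; omega
        · exact absurd h (hmax _ (by omega) (by omega))
      · exact absurd h (hpy _ (by omega))
      · exact absurd h.symm (hqy _ (by omega))
      · right; omega)
  apply hG (i - j + 1) (by omega) (by omega)
  rwa [two_mul]

end ESEC

namespace ESEC

section Walks

set_option linter.unusedSectionVars false

variable {V : Type*} [Fintype V] [DecidableEq V]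

/-- expected sum of log-degrees along a simple random walk of `j` steps -/
noncomputable def Lg (H : SimpleGraph V) [DecidableRel H.Adj] : ℕ → V → ℝ
  | 0, _ => 0
  | j + 1, x => Real.log (H.degree x) + (∑ y ∈ H.neighborFinset x, Lg H j y) / H.degree x

/-- averaging operator -/
noncomputable def avg (H : SimpleGraph V) [DecidableRel H.Adj] (f : V → ℝ) (x : V) : ℝ :=
  (∑ y ∈ H.neighborFinset x, f y) / H.degree x

/-- descendants -/
def Desc (H : SimpleGraph V) [DecidableRel H.Adj] (A : ℕ → V → Prop)
    [∀ i, DecidablePred (A i)] : ℕ → ℕ → V → Finset V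
  | 0, _, x => {x}
  | j + 1, i, x => ((H.neighborFinset x).filter (A (i + 1))).biUnion (Desc H A j (i + 1))

variable (H : SimpleGraph V) [DecidableRel H.Adj]

theorem avg_bounds (f : V → ℝ) (B : ℝ) (hB : 0 ≤ B) (hf : ∀ x, 0 ≤ f x ∧ f x ≤ B) (x : V) :
    0 ≤ avg H f x ∧ avg H f x ≤ B := by
  unfold avg
  refine ⟨div_nonneg (Finset.sum_nonneg fun y _ => (hf y).1) (by positivity), ?_⟩
  rcases Nat.eq_zero_or_pos (H.degree x) with h | h
  · simp [h, hB]
  · rw [div_le_iff₀ (by exact_mod_cast h)]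
    calc _ ≤ ∑ y ∈ H.neighborFinset x, B := Finset.sum_le_sum fun y _ => (hf y).2
      _ = B * H.degree x := by simp [mul_comm]

theorem Lg_bounds (hn : 1 ≤ Fintype.card V) (j : ℕ) (x : V) :
    0 ≤ Lg H j x ∧ Lg H j x ≤ j * Real.log (Fintype.card V) := by
  have hlog : 0 ≤ Real.log (Fintype.card V) := Real.log_nonneg (by exact_mod_cast hn)
  induction j generalizing x with
  | zero => simp [Lg]
  | succ j ih =>
    have h := avg_bounds H (Lg H j) (j * Real.log (Fintype.card V)) (by positivity) ih x
    unfold avg at h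
    have hd : 0 ≤ Real.log (H.degree x) := Real.log_natCast_nonneg _
    have hd2 : Real.log (H.degree x) ≤ Real.log (Fintype.card V) := by
      rcases Nat.eq_zero_or_pos (H.degree x) with h0 | h0
      · simp [h0, hlog]
      · exact Real.log_le_log (by exact_mod_cast h0) (by exact_mod_cast (H.degree_lt_card_verts x).le)
    simp only [Lg]
    push_cast
    constructor <;> linarith

theorem sum_avg (f : V → ℝ) :
    ∑ x, (H.degree x : ℝ) * avg H f x = ∑ x, (H.degree x : ℝ) * f x := by
  have h1 : ∀ x, (H.degree x : ℝ) * avg H f x = ∑ y, if H.Adj x y then f y else 0 := by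
    intro x
    rw [← Finset.sum_filter, ← H.neighborFinset_eq_filter]
    unfold avg
    rcases Nat.eq_zero_or_pos (H.degree x) with h | h
    · have : H.neighborFinset x = ∅ := by
        rw [← Finset.card_eq_zero]; simpa using h
      simp [this]
    · field_simp
  simp_rw [h1]
  rw [Finset.sum_comm]
  refine Finset.sum_congr rfl fun y _ => ?_
  rw [← Finset.sum_filter, Finset.sum_const, nsmul_eq_mul]
  congr 2
  rw [← H.card_neighborFinset_eq_degree, H.neighborFinset_eq_filter]
  congr 1
  ext x
  simp [H.adj_comm]

theorem sum_Lg (j : ℕ) :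
    ∑ x, (H.degree x : ℝ) * Lg H j x =
      j * ∑ x, (H.degree x : ℝ) * Real.log (H.degree x) := by
  induction j with
  | zero => simp [Lg]
  | succ j ih =>
    have : ∀ x, (H.degree x : ℝ) * Lg H (j + 1) x =
        (H.degree x : ℝ) * Real.log (H.degree x) + (H.degree x : ℝ) * avg H (Lg H j) x := by
      intro x; simp only [Lg, avg]; ring
    simp_rw [this]
    rw [Finset.sum_add_distrib, sum_avg, ih]
    push_cast; ring

theorem sum_avg_iter (f : V → ℝ) (m : ℕ) :
    ∑ x, (H.degree x : ℝ) * ((avg H)^[m] f) x = ∑ x, (H.degree x : ℝ) * f x := by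
  induction m generalizing f with
  | zero => simp
  | succ m ih => rw [Function.iterate_succ_apply, ih, sum_avg]

theorem avg_iter_bounds (f : V → ℝ) (B : ℝ) (hB : 0 ≤ B) (hf : ∀ x, 0 ≤ f x ∧ f x ≤ B) (m : ℕ) :
    ∀ x, 0 ≤ ((avg H)^[m] f) x ∧ ((avg H)^[m] f) x ≤ B := by
  induction m with
  | zero => simpa using hf
  | succ m ih =>
    intro x
    rw [Function.iterate_succ_apply']
    exact avg_bounds H _ B hB ih x

/-- restricted average loses little -/
theorem sum_restrict (f : V → ℝ) (B : ℝ) (hf : ∀ x, 0 ≤ f x ∧ f x ≤ B) (C : ℕ)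
    (s N : Finset V) (hs : (N \ s).card ≤ C) (hB : 0 ≤ B) :
    ∑ y ∈ N, f y - C * B ≤ ∑ y ∈ N ∩ s, f y := by
  have h1 := Finset.sum_inter_add_sum_sdiff N s f
  have h2 : ∑ y ∈ N \ s, f y ≤ C * B := by
    calc _ ≤ ∑ y ∈ N \ s, B := Finset.sum_le_sum fun y _ => (hf y).2
      _ = (N \ s).card * B := by simp
      _ ≤ C * B := by gcongr
  linarith

/-- greedy choice of a path -/
theorem exists_path (f : V → ℝ) (B : ℝ) (hB : 0 ≤ B) (hf : ∀ x, 0 ≤ f x ∧ f x ≤ B) (C δ : ℕ)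
    (hδ : C < δ) (hdeg : ∀ x, H.degree x = 0 ∨ δ ≤ H.degree x) (j : ℕ) (x : V)
    (hx : 0 < H.degree x) (S : Finset V) (hS : S.card + j ≤ C) (hxS : x ∉ S) :
    ∃ c : ℕ → V, c 0 = x ∧ (∀ t, t < j → H.Adj (c t) (c (t + 1))) ∧
      (∀ s t, s ≤ j → t ≤ j → c s = c t → s = t) ∧ (∀ t, t ≤ j → c t ∉ S) ∧
      ((avg H)^[j] f) x - j * (C * B / δ) ≤ f (c j) := by
  induction j generalizing x S with
  | zero => exact ⟨fun _ => x, rfl, by simp, by omega, by simpa using hxS, by simp⟩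
  | succ j ih =>
    have hdx : δ ≤ H.degree x := by rcases hdeg x with h | h <;> omega
    set g := (avg H)^[j] f with hg
    have hgb := avg_iter_bounds H f B hB hf j
    set S' := insert x S with hS'
    have hS'c : S'.card ≤ C := by
      have : S'.card ≤ S.card + 1 := Finset.card_insert_le x S
      omega
    set N := H.neighborFinset x
    have hN : N.card = H.degree x := H.card_neighborFinset_eq_degree x
    have hsd : N \ (N \ S') ⊆ S' := by
      intro y; simp
    have h1 := sum_restrict g B hgb C (N \ S') N ((Finset.card_le_card hsd).trans hS'c) hB
    rw [Finset.inter_eq_right.2 Finset.sdiff_subset] at h1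
    have hne : (N \ S').Nonempty := by
      rw [← Finset.card_pos]
      have := Finset.le_card_sdiff S' N
      omega
    have hdpos : (0 : ℝ) < H.degree x := by exact_mod_cast hx
    have hδpos : (0 : ℝ) < δ := by exact_mod_cast (by omega : 0 < δ)
    obtain ⟨y, hy, hyg⟩ : ∃ y ∈ N \ S', (avg H g) x - C * B / δ ≤ g y := by
      by_contra! hcon
      set a := (avg H g) x - C * B / δ with ha
      have hlt := Finset.sum_lt_sum_of_nonempty hne hcon
      rw [Finset.sum_const, nsmul_eq_mul] at hlt
      have hc1 : ((N \ S').card : ℝ) ≤ H.degree x := by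
        rw [← hN]; exact_mod_cast Finset.card_le_card Finset.sdiff_subset
      have hsum : ∑ y ∈ N, g y = H.degree x * avg H g x := by
        unfold avg; field_simp; rfl
      have ha0 : 0 ≤ a := by
        obtain ⟨y, hy⟩ := hne
        exact (hgb y).1.trans (hcon y hy).le
      have h3 : C * B ≤ H.degree x * (C * B / δ) := by
        rw [mul_div_assoc', le_div_iff₀ hδpos, mul_comm]
        have : (δ : ℝ) ≤ H.degree x := by exact_mod_cast hdx
        gcongr
      have h4 : ((N \ S').card : ℝ) * a ≤ H.degree x * a := by gcongr
      rw [hsum] at h1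
      have : H.degree x * a = H.degree x * avg H g x - H.degree x * (C * B / δ) := by
        rw [ha]; ring
      linarith
    rw [Finset.mem_sdiff] at hy
    have hadj : H.Adj x y := (H.mem_neighborFinset x y).1 hy.1
    have hy0 : 0 < H.degree y := by
      rw [H.degree_pos_iff_exists_adj]; exact ⟨x, hadj.symm⟩
    obtain ⟨c, hc0, hca, hci, hcS, hcf⟩ := ih y hy0 S' (by
      have : S'.card ≤ S.card + 1 := Finset.card_insert_le x S
      omega) hy.2
    refine ⟨fun t => if t = 0 then x else c (t - 1), by simp, ?_, ?_, ?_, ?_⟩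
    · intro t ht
      rcases t with _ | t
      · simpa [hc0] using hadj
      · simpa using hca t (by omega)
    · intro s t hs ht h
      rcases s with _ | s <;> rcases t with _ | t
      · rfl
      · simp at h
        exact absurd (Finset.mem_insert.2 (Or.inl h.symm)) (hcS t (by omega))
      · simp at h
        exact absurd (Finset.mem_insert.2 (Or.inl h)) (hcS s (by omega))
      · simp at h
        rw [hci s t (by omega) (by omega) h]
    · intro t ht
      rcases t with _ | t
      · simpa using hxS
      · have := hcS t (by omega)
        rw [hS', Finset.mem_insert] at this
        simp; tauto
    · rw [Function.iterate_succ_apply']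
      simp only [Nat.add_sub_cancel, if_neg (Nat.succ_ne_zero j)]
      push_cast
      linarith

theorem desc_walk (A : ℕ → V → Prop) [∀ i, DecidablePred (A i)] (j i : ℕ) (x w : V)
    (hx : A i x) (hw : w ∈ Desc H A j i x) :
    ∃ c : ℕ → V, c 0 = x ∧ c j = w ∧ (∀ t, t < j → H.Adj (c t) (c (t + 1))) ∧
      (∀ t, t ≤ j → A (i + t) (c t)) := by
  induction j generalizing i x with
  | zero =>
    simp only [Desc, Finset.mem_singleton] at hw
    exact ⟨fun _ => x, rfl, hw.symm, by omega, fun t ht => by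
      obtain rfl : t = 0 := by omega
      simpa using hx⟩
  | succ j ih =>
    simp only [Desc, Finset.mem_biUnion, Finset.mem_filter, SimpleGraph.mem_neighborFinset] at hw
    obtain ⟨y, ⟨hxy, hAy⟩, hwy⟩ := hw
    obtain ⟨c, hc0, hcj, hca, hcA⟩ := ih (i + 1) y hAy hwy
    refine ⟨fun t => if t = 0 then x else c (t - 1), by simp, by simpa using hcj, ?_, ?_⟩
    · intro t ht
      rcases t with _ | t
      · simpa [hc0] using hxy
      · simpa using hca t (by omega)
    · intro t ht
      rcases t with _ | t
      · simpa using hx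
      · have := hcA t (by omega)
        simp only [Nat.add_sub_cancel, if_neg (Nat.succ_ne_zero t)]
        rwa [show i + (t + 1) = i + 1 + t by ring]

theorem desc_disj (A : ℕ → V → Prop) [∀ i, DecidablePred (A i)] (ℓ : ℕ)
    (hpar : ∀ i, i < ℓ → ∀ z z' w, A i z → A i z' → A (i + 1) w → H.Adj z w → H.Adj z' w → z = z')
    (j i : ℕ) (hij : i + j ≤ ℓ) (x x' w : V) (hx : A i x) (hx' : A i x')
    (hw : w ∈ Desc H A j i x) (hw' : w ∈ Desc H A j i x') : x = x' := by
  obtain ⟨c, hc0, hcj, hca, hcA⟩ := desc_walk H A j i x w hx hw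
  obtain ⟨c', hc0', hcj', hca', hcA'⟩ := desc_walk H A j i x' w hx' hw'
  have key : ∀ t, t ≤ j → c (j - t) = c' (j - t) := by
    intro t
    induction t with
    | zero => intro _; simp [hcj, hcj']
    | succ t ih =>
      intro ht
      have e := ih (by omega)
      have h1 := hca (j - (t + 1)) (by omega)
      have h2 := hca' (j - (t + 1)) (by omega)
      have h3 := hcA (j - (t + 1) + 1) (by omega)
      have es : j - (t + 1) + 1 = j - t := by omega
      rw [es] at h1 h2 h3
      refine hpar (i + (j - (t + 1))) (by omega) _ _ (c (j - t)) (hcA _ (by omega))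
        (hcA' _ (by omega)) ?_ h1 (by rw [e]; exact h2)
      rwa [show i + (j - (t + 1)) + 1 = i + (j - t) by omega]
  have := key j le_rfl
  simpa [hc0, hc0'] using this

theorem log_desc (A : ℕ → V → Prop) [∀ i, DecidablePred (A i)] (ℓ C δ : ℕ)
    (hn : 1 ≤ Fintype.card V)
    (hpar : ∀ i, i < ℓ → ∀ z z' w, A i z → A i z' → A (i + 1) w → H.Adj z w → H.Adj z' w → z = z')
    (hfew : ∀ i, i < ℓ → ∀ x, A i x → ((H.neighborFinset x).filter (fun y => ¬ A (i + 1) y)).card ≤ C)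
    (hδ : 2 * C < δ) (hdeg : ∀ x, H.degree x = 0 ∨ δ ≤ H.degree x)
    (j i : ℕ) (hij : i + j ≤ ℓ) (x : V) (hAx : A i x) (hx : 0 < H.degree x) :
    0 < (Desc H A j i x).card ∧
    Lg H j x - j * (C * (2 + ℓ * Real.log (Fintype.card V)) / δ) ≤
      Real.log (Desc H A j i x).card := by
  have hlog : 0 ≤ Real.log (Fintype.card V) := Real.log_nonneg (by exact_mod_cast hn)
  induction j generalizing i x with
  | zero => simp [Desc, Lg]
  | succ j ih =>
    have hdx : δ ≤ H.degree x := by rcases hdeg x with h | h <;> omega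
    set η := (C * (2 + ℓ * Real.log (Fintype.card V)) / δ : ℝ) with hη
    set N := H.neighborFinset x with hNdef
    have hN : N.card = H.degree x := H.card_neighborFinset_eq_degree x
    set s := N.filter (A (i + 1)) with hs
    have hNs : (N \ s).card ≤ C := by
      have : N \ s = N.filter (fun y => ¬ A (i + 1) y) := by
        ext y; simp [hs]; tauto
      rw [this]; exact hfew i (by omega) x hAx
    have hsN : s ⊆ N := Finset.filter_subset _ _
    have hsc : H.degree x ≤ s.card + C := by
      have := Finset.card_sdiff_add_card_eq_card hsN
      omega
    have hchild : ∀ y ∈ s, 0 < (Desc H A j (i + 1) y).card ∧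
        Lg H j y - j * η ≤ Real.log (Desc H A j (i + 1) y).card := by
      intro y hy
      rw [hs, Finset.mem_filter, SimpleGraph.mem_neighborFinset] at hy
      exact ih (i + 1) (by omega) y hy.2 (by
        rw [H.degree_pos_iff_exists_adj]; exact ⟨x, hy.1.symm⟩)
    have hcard : (Desc H A (j + 1) i x).card = ∑ y ∈ s, (Desc H A j (i + 1) y).card := by
      simp only [Desc]
      apply Finset.card_biUnion
      intro y hy y' hy' hne
      rw [Finset.mem_coe, Finset.mem_filter] at hy hy'
      rw [Function.onFun, Finset.disjoint_left]
      intro w hw hw'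
      exact hne (desc_disj H A ℓ hpar j (i + 1) (by omega) y y' w hy.2 hy'.2 hw hw')
    have hspos : 0 < s.card := by omega
    have hsne : s.Nonempty := Finset.card_pos.1 hspos
    have hpos : 0 < (Desc H A (j + 1) i x).card := by
      rw [hcard]; exact Finset.sum_pos (fun y hy => (hchild y hy).1) hsne
    refine ⟨hpos, ?_⟩
    have ha : (0 : ℝ) < s.card := by exact_mod_cast hspos
    -- Jensen
    have hJ : Real.log s.card + (∑ y ∈ s, Real.log (Desc H A j (i + 1) y).card) / s.card ≤
        Real.log (Desc H A (j + 1) i x).card := by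
      have := strictConcaveOn_log_Ioi.concaveOn.le_map_sum (t := s) (w := fun _ => (1 / s.card : ℝ))
        (p := fun y => ((Desc H A j (i + 1) y).card : ℝ)) (fun _ _ => by positivity)
        (by simp; field_simp) (fun y hy => by
          have := (hchild y hy).1
          simpa using this)
      simp only [smul_eq_mul, ← Finset.mul_sum] at this
      rw [hcard]
      have hS : (0 : ℝ) < ∑ y ∈ s, ((Desc H A j (i + 1) y).card : ℝ) := by
        have := hpos
        rw [hcard] at this
        exact_mod_cast this
      rw [Real.log_mul (by positivity) hS.ne', one_div, Real.log_inv] at this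
      push_cast
      have e : (∑ y ∈ s, Real.log (Desc H A j (i + 1) y).card) / s.card =
        (s.card : ℝ)⁻¹ * ∑ y ∈ s, Real.log (Desc H A j (i + 1) y).card := by
          rw [div_eq_inv_mul]
      rw [e]; linarith
    have hsum1 : ∑ y ∈ s, (Lg H j y) - s.card * (j * η) ≤
        ∑ y ∈ s, Real.log (Desc H A j (i + 1) y).card := by
      have := Finset.sum_le_sum fun y hy => (hchild y hy).2
      rw [Finset.sum_sub_distrib, Finset.sum_const, nsmul_eq_mul] at this
      exact this
    have hd0 : (0 : ℝ) < H.degree x := by exact_mod_cast hx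
    have hδ0 : (0 : ℝ) < δ := by exact_mod_cast (by omega : 0 < δ)
    have hdδ : (δ : ℝ) ≤ H.degree x := by exact_mod_cast hdx
    have hsd : (s.card : ℝ) ≤ H.degree x := by
      rw [← hN]; exact_mod_cast Finset.card_le_card hsN
    have hLb := Lg_bounds H hn j
    have hrest := sum_restrict (Lg H j) (j * Real.log (Fintype.card V)) hLb C s N hNs (by positivity)
    rw [Finset.inter_eq_right.2 hsN] at hrest
    have hs0 : 0 ≤ ∑ y ∈ s, Lg H j y := Finset.sum_nonneg fun y _ => (hLb y).1
    have h1 : (∑ y ∈ N, Lg H j y) / H.degree x - C * (ℓ * Real.log (Fintype.card V)) / δ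
        ≤ (∑ y ∈ s, Lg H j y) / s.card := by
      have e1 : (∑ y ∈ s, Lg H j y) / H.degree x ≤ (∑ y ∈ s, Lg H j y) / s.card := by gcongr
      have e2 : (∑ y ∈ N, Lg H j y - C * (j * Real.log (Fintype.card V))) / H.degree x ≤
        (∑ y ∈ s, Lg H j y) / H.degree x := by gcongr
      have e3 : C * (j * Real.log (Fintype.card V)) / H.degree x ≤
        C * (ℓ * Real.log (Fintype.card V)) / δ := by
        have : (j : ℝ) ≤ ℓ := by exact_mod_cast (by omega : j ≤ ℓ)
        gcongr
      rw [sub_div] at e2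
      linarith
    have h2 : Real.log (H.degree x) - C * 2 / δ ≤ Real.log s.card := by
      have e1 : (1 : ℝ) - (s.card / H.degree x : ℝ)⁻¹ ≤ Real.log (s.card / H.degree x) :=
        Real.one_sub_inv_le_log_of_pos (by positivity)
      rw [Real.log_div ha.ne' hd0.ne', inv_div] at e1
      have e2 : (H.degree x : ℝ) / s.card ≤ 1 + C * 2 / δ := by
        rw [div_le_iff₀ ha]
        have c1 : (H.degree x : ℝ) ≤ s.card + C := by exact_mod_cast hsc
        have c2 : (C : ℝ) ≤ C * 2 / δ * s.card := by
          have c3 : (δ : ℝ) ≤ 2 * s.card := by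
            exact_mod_cast (by omega : δ ≤ 2 * s.card)
          rw [div_mul_eq_mul_div, le_div_iff₀ hδ0]
          have : (0 : ℝ) ≤ C := by positivity
          nlinarith
        linarith
      linarith
    have h3 : (∑ y ∈ s, Lg H j y) / s.card - j * η ≤
        (∑ y ∈ s, Real.log (Desc H A j (i + 1) y).card) / s.card := by
      rw [le_div_iff₀ ha, sub_mul, div_mul_cancel₀ _ ha.ne']
      linarith
    have h4 : η = C * 2 / δ + C * (ℓ * Real.log (Fintype.card V)) / δ := by
      rw [hη]; ring
    have h5 : Lg H (j + 1) x = Real.log (H.degree x) + (∑ y ∈ N, Lg H j y) / H.degree x := rfl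
    rw [h5]
    push_cast
    linarith

end Walks

end ESEC

namespace ESEC

section Upper

theorem seq_walk {V : Type*} {H : SimpleGraph V} (c : ℕ → V) (a s : ℕ)
    (h : ∀ t, a ≤ t → t < a + s → H.Adj (c t) (c (t + 1))) :
    ∃ p : H.Walk (c a) (c (a + s)), p.length = s := by
  induction s with
  | zero => exact ⟨SimpleGraph.Walk.nil, rfl⟩
  | succ s ih =>
    obtain ⟨p, hp⟩ := ih (fun t h1 h2 => h t h1 (by omega))
    exact ⟨p.concat (h (a + s) (by omega) (by omega)), by simp [hp]⟩

variable {V : Type*} [Fintype V] [DecidableEq V]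

/-- allowed vertices on level `i` -/
def Al (H : SimpleGraph V) (ℓ : ℕ) (v u : V) (P : Finset V) (i : ℕ) (y : V) : Prop :=
  (i = 0 ∧ y = v) ∨ (1 ≤ i ∧ H.dist v y = i ∧ y ∉ P ∧ (i < ℓ → H.dist u y ≠ i))

theorem Al_dist {H : SimpleGraph V} {ℓ : ℕ} {v u : V} {P : Finset V} {i : ℕ} {y : V}
    (h : Al H ℓ v u P i y) : H.dist v y = i := by
  rcases h with ⟨rfl, rfl⟩ | h
  · simp
  · exact h.2.1

theorem Al_reach {H : SimpleGraph V} {ℓ : ℕ} {v u : V} {P : Finset V} {i : ℕ} {y : V}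
    (h : Al H ℓ v u P i y) : H.Reachable v y := by
  rcases h with ⟨rfl, rfl⟩ | h
  · exact SimpleGraph.Reachable.refl _
  · exact SimpleGraph.Reachable.of_dist_ne_zero (by omega)

theorem Al_par {H : SimpleGraph V} {ℓ : ℕ} (hH : EvenCycleFree H ℓ) (v u : V) (P : Finset V) :
    ∀ i, i < ℓ → ∀ z z' w, Al H ℓ v u P i z → Al H ℓ v u P i z' → Al H ℓ v u P (i + 1) w →
      H.Adj z w → H.Adj z' w → z = z' := by
  intro i hi z z' w hz hz' hw h1 h2
  rcases Nat.eq_zero_or_pos i with rfl | hi0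
  · rcases hz with hz | hz <;> rcases hz' with hz' | hz'
    · rw [hz.2, hz'.2]
    all_goals omega
  · exact core hH v w z z' i hi0 (by omega) (by rw [Al_dist hw]; omega) (Al_dist hz) (Al_dist hz')
      h1.symm h2.symm

theorem Al_few {H : SimpleGraph V} [DecidableRel H.Adj] {ℓ : ℕ} (hH : EvenCycleFree H ℓ) (v u : V)
    (P : Finset V) (huv : H.Reachable u v) (hne : u ≠ v)
    [∀ i, DecidablePred (Al H ℓ v u P i)] :
    ∀ i, i < ℓ → ∀ x, Al H ℓ v u P i x →
      ((H.neighborFinset x).filter (fun y => ¬ Al H ℓ v u P (i + 1) y)).card ≤ P.card + 3 := by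
  intro i hi x hx
  have hxd := Al_dist hx
  have hxr := Al_reach hx
  set N := H.neighborFinset x with hN
  set T1 := N.filter (fun y => H.dist v y + 1 = i) with hT1
  set T2 := N.filter (fun y => H.dist v y = i) with hT2
  set T3 := N.filter (fun y => H.dist u y = i + 1 ∧ i + 1 < ℓ) with hT3
  have hyr : ∀ y ∈ N, H.Reachable v y := fun y hy =>
    hxr.trans ((H.mem_neighborFinset x y).1 hy).reachable
  have c1 : T1.card ≤ 1 := by
    rw [Finset.card_le_one]
    intro y hy y' hy'
    rw [hT1, Finset.mem_filter] at hy hy'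
    by_cases h1 : i = 1
    · have e1 : H.dist v y = 0 := by omega
      have e2 : H.dist v y' = 0 := by omega
      rw [(hyr y hy.1).dist_eq_zero_iff] at e1
      rw [(hyr y' hy'.1).dist_eq_zero_iff] at e2
      rw [← e1, ← e2]
    · exact core hH v x y y' (i - 1) (by omega) (by omega) (by omega) (by omega) (by omega)
        ((H.mem_neighborFinset x y).1 hy.1) ((H.mem_neighborFinset x y').1 hy'.1)
  have c2 : T2.card ≤ 1 := by
    rw [Finset.card_le_one]
    intro y hy y' hy'
    rw [hT2, Finset.mem_filter] at hy hy'
    by_cases h1 : i = 0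
    · exfalso
      have e1 : H.dist v y = 0 := by omega
      rw [(hyr y hy.1).dist_eq_zero_iff] at e1
      have e2 : H.dist v x = 0 := by omega
      rw [hxr.dist_eq_zero_iff] at e2
      have := (H.mem_neighborFinset x y).1 hy.1
      rw [← e1, ← e2] at this
      exact H.irrefl this
    · exact core hH v x y y' i (by omega) (by omega) (by omega) (by omega) (by omega)
        ((H.mem_neighborFinset x y).1 hy.1) ((H.mem_neighborFinset x y').1 hy'.1)
  have c3 : T3.card ≤ 1 := by
    rw [Finset.card_le_one]
    intro y hy y' hy'
    rw [hT3, Finset.mem_filter] at hy hy'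
    have hux : H.dist u x ≠ i := by
      rcases hx with ⟨rfl, rfl⟩ | hx
      · have := huv.pos_dist_of_ne hne
        omega
      · exact hx.2.2.2 hi
    exact core hH u x y y' (i + 1) (by omega) (by omega) (by omega) (by omega) (by omega)
        ((H.mem_neighborFinset x y).1 hy.1) ((H.mem_neighborFinset x y').1 hy'.1)
  have hsub : (N.filter (fun y => ¬ Al H ℓ v u P (i + 1) y)) ⊆ P ∪ (T1 ∪ (T2 ∪ T3)) := by
    intro y hy
    rw [Finset.mem_filter] at hy
    obtain ⟨hy, hyA⟩ := hy
    have hadj := (H.mem_neighborFinset x y).1 hy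
    have e1 : H.dist v y ≤ i + 1 := by
      have := hxr.dist_triangle_left y
      rw [SimpleGraph.dist_eq_one_iff_adj.2 hadj] at this
      omega
    have e2 : i ≤ H.dist v y + 1 := by
      have := (hyr y hy).dist_triangle_left x
      rw [SimpleGraph.dist_eq_one_iff_adj.2 hadj.symm] at this
      omega
    simp only [Finset.mem_union, hT1, hT2, hT3, Finset.mem_filter]
    by_contra hcon
    push Not at hcon
    apply hyA
    refine Or.inr ⟨by omega, ?_, hcon.1, fun h h' => ?_⟩
    · have := hcon.2.1 hy
      have := hcon.2.2.1 hy
      omega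
    · exact absurd h (by have := hcon.2.2.2 hy h'; omega)
  have := Finset.card_le_card hsub
  have h1 := Finset.card_union_le P (T1 ∪ (T2 ∪ T3))
  have h2 := Finset.card_union_le T1 (T2 ∪ T3)
  have h3 := Finset.card_union_le T2 T3
  omega

theorem Al_cycle {H : SimpleGraph V} {ℓ m : ℕ} (hℓ : 2 ≤ ℓ) (hm : 1 ≤ m) (c : ℕ → V)
    (hca : ∀ t, t < m → H.Adj (c t) (c (t + 1)))
    (hci : ∀ s t, s ≤ m → t ≤ m → c s = c t → s = t) (P : Finset V)
    (hP : ∀ t, t ≤ m → c t ∈ P) (w : V) (R L : ℕ → V)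
    (hR0 : R 0 = c m) (hRw : R ℓ = w) (hRa : ∀ t, t < ℓ → H.Adj (R t) (R (t + 1)))
    (hRA : ∀ t, t ≤ ℓ → Al H ℓ (c m) (c 0) P t (R t))
    (hL0 : L 0 = c 0) (hLw : L ℓ = w) (hLa : ∀ t, t < ℓ → H.Adj (L t) (L (t + 1)))
    (hLA : ∀ t, t ≤ ℓ → Al H ℓ (c 0) (c m) P t (L t)) :
    HasCycleLength H (ℓ + (m + ℓ)) := by
  have hRP : ∀ t, 1 ≤ t → t ≤ ℓ → R t ∉ P := by
    intro t h1 h2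
    rcases hRA t h2 with h | h
    · omega
    · exact h.2.2.1
  have hLP : ∀ t, 1 ≤ t → t ≤ ℓ → L t ∉ P := by
    intro t h1 h2
    rcases hLA t h2 with h | h
    · omega
    · exact h.2.2.1
  have hend : ∀ (Q : ℕ → V) (q : V), Q ℓ = w → (∀ t, t < ℓ → H.Adj (Q t) (Q (t + 1))) →
      (∀ t, t ≤ ℓ → H.dist q (Q t) = t) → (∀ t, t ≤ ℓ → H.Reachable q (Q t)) →
      ∀ t, t ≤ ℓ → H.dist (Q t) w = ℓ - t := by
    intro Q q hQ ha hd hr t ht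
    obtain ⟨p, hp⟩ := seq_walk Q t (ℓ - t) (fun s _ _ => ha s (by omega))
    have h1 := SimpleGraph.dist_le p
    rw [hp, show t + (ℓ - t) = ℓ by omega, hQ] at h1
    have h2 := (hr t ht).dist_triangle_left w
    rw [hd t ht, ← hQ, hd ℓ le_rfl, hQ] at h2
    omega
  have hRe := hend R (c m) hRw hRa (fun t ht => Al_dist (hRA t ht)) (fun t ht => Al_reach (hRA t ht))
  have hLe := hend L (c 0) hLw hLa (fun t ht => Al_dist (hLA t ht)) (fun t ht => Al_reach (hLA t ht))
  refine hasCycle_of_two ℓ (m + ℓ) (by omega) (by omega) (by omega) L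
    (fun t => if t ≤ m then c t else R (t - m)) (by simp [hL0]) ?_ hLa ?_ ?_ ?_ ?_
  · rw [if_neg (by omega), Nat.add_sub_cancel_left, hRw, hLw]
  · intro t ht
    split_ifs with h1 h2 h2
    · exact hca t (by omega)
    · have e : t = m := by omega
      rw [e, ← hR0, Nat.add_sub_cancel_left]
      exact hRa 0 (by omega)
    · omega
    · have := hRa (t - m) (by omega)
      rwa [show t - m + 1 = t + 1 - m by omega] at this
  · intro s t hs ht h
    have h1 := Al_dist (hLA s hs)
    have h2 := Al_dist (hLA t ht)
    rw [h] at h1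
    omega
  · intro s t hs ht h
    split_ifs at h with h1 h2 h2
    · exact hci s t h1 h2 h
    · exact absurd (h ▸ hP s h1) (hRP (t - m) (by omega) (by omega))
    · exact absurd (h ▸ hP t h2) (hRP (s - m) (by omega) (by omega))
    · have e1 := Al_dist (hRA (s - m) (by omega))
      have e2 := Al_dist (hRA (t - m) (by omega))
      rw [h] at e1
      omega
  · intro i j hi hj h
    split_ifs at h with h1
    · rcases Nat.eq_zero_or_pos i with rfl | hi0
      · rw [hL0] at h
        exact Or.inl ⟨rfl, (hci 0 j (by omega) h1 h).symm⟩
      · exact absurd (h ▸ hP j h1) (hLP i hi0 hi)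
    · rcases Nat.eq_zero_or_pos i with rfl | hi0
      · rw [hL0] at h
        exact absurd (h ▸ hP 0 (by omega)) (hRP (j - m) (by omega) (by omega))
      · have e1 := hLe i hi
        have e2 := hRe (j - m) (by omega)
        rw [h] at e1
        have e3 : i = j - m := by omega
        rcases hi.lt_or_eq with h3 | h3
        · exfalso
          rcases hRA (j - m) (by omega) with h4 | h4
          · omega
          · apply h4.2.2.2 (by omega)
            rw [← h, Al_dist (hLA i hi)]
            exact e3
        · right; omega

theorem main_upper (H : SimpleGraph V) [DecidableRel H.Adj] (ℓ m δ : ℕ) (hℓ : 2 ≤ ℓ) (hm : 1 ≤ m)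
    (hH : EvenCycleFree H ℓ) (hk : ¬ HasCycleLength H (2 * ℓ + m))
    (hδ : 2 * (m + 4) < δ) (hdeg : ∀ x, H.degree x = 0 ∨ δ ≤ H.degree x)
    (hE : 0 < ∑ x, H.degree x) :
    (ℓ : ℝ) * Real.log ((∑ x, (H.degree x : ℝ)) / Fintype.card V) ≤
      Real.log ((Fintype.card V : ℝ) / 2) +
        ((ℓ + m) * ((m + 4 : ℕ) * (2 + ℓ * Real.log (Fintype.card V)) / δ)) := by
  classical
  set n := Fintype.card V with hn
  set D := ∑ x, (H.degree x : ℝ) with hD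
  have hD0 : 0 < D := by rw [hD]; exact_mod_cast hE
  have hn1 : 1 ≤ n := by
    by_contra hcon
    have : IsEmpty V := Fintype.card_eq_zero_iff.1 (by omega)
    simp at hE
  have hn0 : (0 : ℝ) < n := by exact_mod_cast hn1
  have hlog : 0 ≤ Real.log n := Real.log_nonneg (by exact_mod_cast hn1)
  set C := m + 4 with hC
  set Φ := Lg H ℓ with hΦ
  set B := (ℓ : ℝ) * Real.log n with hB
  have hB0 : 0 ≤ B := by positivity
  have hΦb : ∀ x, 0 ≤ Φ x ∧ Φ x ≤ B := fun x => Lg_bounds H hn1 ℓ x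
  -- Jensen
  have hJ : D * Real.log (D / n) ≤ ∑ x, (H.degree x : ℝ) * Real.log (H.degree x) := by
    have := Real.convexOn_mul_log.map_sum_le (t := Finset.univ) (w := fun _ : V => (1 / n : ℝ))
      (p := fun x => (H.degree x : ℝ)) (fun _ _ => by positivity)
      (by simp [← hn]; field_simp) (fun x _ => by simp)
    simp only [smul_eq_mul, ← Finset.mul_sum, ← hD] at this
    rw [one_div, ← div_eq_inv_mul, ← div_eq_inv_mul, div_mul_eq_mul_div] at this
    exact (div_le_div_iff_of_pos_right hn0).1 this
  -- start vertex
  obtain ⟨x0, hx0, hx0b⟩ : ∃ x, 0 < H.degree x ∧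
      2 * (ℓ * Real.log (D / n)) ≤ Φ x + ((avg H)^[m] Φ) x := by
    by_contra! hcon
    have h1 : ∑ x, (H.degree x : ℝ) * (Φ x + ((avg H)^[m] Φ) x) <
        ∑ x, (H.degree x : ℝ) * (2 * (ℓ * Real.log (D / n))) := by
      obtain ⟨x, -, hx⟩ := Finset.exists_ne_zero_of_sum_ne_zero hE.ne'
      refine Finset.sum_lt_sum (fun y _ => ?_) ⟨x, Finset.mem_univ _, ?_⟩
      · rcases Nat.eq_zero_or_pos (H.degree y) with h | h
        · simp [h]
        · have := hcon y h
          gcongr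
      · have := hcon x (Nat.pos_of_ne_zero hx)
        have hx' : (0 : ℝ) < H.degree x := by exact_mod_cast Nat.pos_of_ne_zero hx
        gcongr
    simp_rw [mul_add] at h1
    rw [Finset.sum_add_distrib, sum_avg_iter, hΦ, sum_Lg, ← Finset.sum_mul] at h1
    have : (ℓ : ℝ) * (D * Real.log (D / n)) ≤
      ℓ * ∑ x, (H.degree x : ℝ) * Real.log (H.degree x) := by gcongr
    rw [← hD] at h1
    linarith
  obtain ⟨c, hc0, hca, hci, -, hcf⟩ := exists_path H Φ B hB0 hΦb C δ (by omega) hdeg m x0 hx0 ∅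
    (by simp; omega) (by simp)
  set P := (Finset.range (m + 1)).image c with hP
  have hPm : ∀ t, t ≤ m → c t ∈ P := fun t ht =>
    Finset.mem_image.2 ⟨t, by simp; omega, rfl⟩
  have hPc : P.card ≤ m + 1 := by
    have := Finset.card_image_le (s := Finset.range (m + 1)) (f := c)
    simpa using this
  obtain ⟨p, -⟩ := seq_walk c 0 m (fun t _ h => hca t (by omega))
  rw [zero_add] at p
  have huv : H.Reachable (c 0) (c m) := p.reachable
  have hne : c 0 ≠ c m := fun h => by
    have := hci 0 m (by omega) le_rfl h
    omega
  have hdm : 0 < H.degree (c m) := by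
    rw [H.degree_pos_iff_exists_adj]
    have := hca (m - 1) (by omega)
    rw [show m - 1 + 1 = m by omega] at this
    exact ⟨_, this.symm⟩
  have hd0 : 0 < H.degree (c 0) := by rwa [hc0]
  have hR := log_desc H (Al H ℓ (c m) (c 0) P) ℓ C δ hn1 (Al_par hH _ _ _)
    (fun i hi x hx => (Al_few hH (c m) (c 0) P huv hne i hi x hx).trans (by omega)) (by omega) hdeg ℓ 0 (by omega) (c m)
    (Or.inl ⟨rfl, rfl⟩) hdm
  have hL := log_desc H (Al H ℓ (c 0) (c m) P) ℓ C δ hn1 (Al_par hH _ _ _)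
    (fun i hi x hx => (Al_few hH (c 0) (c m) P huv.symm hne.symm i hi x hx).trans (by omega)) (by omega) hdeg ℓ 0 (by omega) (c 0)
    (Or.inl ⟨rfl, rfl⟩) hd0
  set RR := Desc H (Al H ℓ (c m) (c 0) P) ℓ 0 (c m) with hRR
  set LL := Desc H (Al H ℓ (c 0) (c m) P) ℓ 0 (c 0) with hLL
  have hdisj : Disjoint RR LL := by
    rw [Finset.disjoint_left]
    intro w hwR hwL
    obtain ⟨R, hR0, hRw, hRa, hRA⟩ := desc_walk H _ ℓ 0 (c m) w (Or.inl ⟨rfl, rfl⟩) hwR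
    obtain ⟨L, hL0, hLw, hLa, hLA⟩ := desc_walk H _ ℓ 0 (c 0) w (Or.inl ⟨rfl, rfl⟩) hwL
    simp only [zero_add] at hRA hLA
    have := Al_cycle hℓ hm c hca hci P hPm w R L hR0 hRw hRa hRA hL0 hLw hLa hLA
    rw [show ℓ + (m + ℓ) = 2 * ℓ + m by ring] at this
    exact hk this
  have hcard : RR.card + LL.card ≤ n := by
    rw [← Finset.card_union_of_disjoint hdisj]
    exact Finset.card_le_univ _
  have hr0 : (0 : ℝ) < RR.card := by exact_mod_cast hR.1
  have hl0 : (0 : ℝ) < LL.card := by exact_mod_cast hL.1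
  have hcard' : (RR.card : ℝ) + LL.card ≤ n := by exact_mod_cast hcard
  have hfin : Real.log RR.card + Real.log LL.card ≤ 2 * Real.log ((n : ℝ) / 2) := by
    rw [← Real.log_mul hr0.ne' hl0.ne']
    have : (2 : ℝ) * Real.log ((n : ℝ) / 2) = Real.log (((n : ℝ) / 2) ^ 2) := by
      rw [Real.log_pow]; norm_num
    rw [this]
    apply Real.log_le_log (by positivity)
    nlinarith [sq_nonneg ((RR.card : ℝ) - LL.card)]
  have hδ0 : (0 : ℝ) < δ := by exact_mod_cast (by omega : 0 < δ)
  have hR2 := hR.2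
  have hL2 := hL.2
  rw [← hΦ] at hR2 hL2
  set η := ((C : ℕ) * (2 + ℓ * Real.log n) / δ : ℝ) with hη
  have hCB : C * B / δ ≤ η := by
    rw [hη, hB]
    gcongr
    linarith
  have hη0 : 0 ≤ η := by rw [hη]; positivity
  rw [← hc0] at hcf hx0b
  have hmC : (m : ℝ) * (C * B / δ) ≤ m * η := by gcongr
  have hmη : 0 ≤ (m : ℝ) * η := by positivity
  rw [add_mul]
  linarith

end Upper

end ESEC
namespace ESEC
section Cleanup

lemma hasCycle_mono {V : Type*} {G H : SimpleGraph V} (h : H ≤ G) {m : ℕ}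
    (hc : HasCycleLength H m) : HasCycleLength G m := by
  obtain ⟨v, w, hw, hl⟩ := hc
  exact ⟨v, w.mapLe h, hw.mapLe h, by simpa using hl⟩

lemma evenFree_mono {V : Type*} {G H : SimpleGraph V} (h : H ≤ G) {l : ℕ}
    (hc : EvenCycleFree G l) : EvenCycleFree H l :=
  fun m h1 h2 h3 => hc m h1 h2 (hasCycle_mono h h3)

open Classical in
lemma cleanup {V : Type*} [Fintype V] (G : SimpleGraph V) (δ : ℕ) :
    ∃ H : SimpleGraph V, H ≤ G ∧ (∀ x, H.degree x = 0 ∨ δ ≤ H.degree x) ∧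
      G.edgeFinset.card ≤ H.edgeFinset.card + δ * Fintype.card V := by
  let f : SimpleGraph V → ℕ := fun H => H.edgeFinset.card +
    δ * (Finset.univ.filter fun x => H.degree x = 0).card
  obtain ⟨H, hH, hmax⟩ := Set.exists_max_image {H : SimpleGraph V | H ≤ G} f
    (Set.toFinite _) ⟨G, le_refl G⟩
  refine ⟨H, hH, ?_, ?_⟩
  · intro x
    by_contra hcon
    push Not at hcon
    obtain ⟨K, hK1, hK2, h2⟩ : ∃ K : SimpleGraph V, K ≤ H ∧ (∀ z, ¬ K.Adj x z) ∧
        K.edgeFinset.card = H.edgeFinset.card - H.degree x := by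
      refine ⟨H.deleteIncidenceSet x, H.deleteIncidenceSet_le x, ?_, ?_⟩
      · intro z hz
        rw [SimpleGraph.deleteIncidenceSet_adj] at hz
        exact hz.2.1 rfl
      · convert H.card_edgeFinset_deleteIncidenceSet x
    have h1 := hmax K (le_trans hK1 hH)
    have h3 : (Finset.univ.filter fun y => H.degree y = 0).card + 1 ≤
        (Finset.univ.filter fun y => K.degree y = 0).card := by
      rw [← Finset.card_insert_of_notMem (a := x) (by simpa using hcon.1)]
      apply Finset.card_le_card
      intro y hy
      simp only [Finset.mem_insert, Finset.mem_filter, Finset.mem_univ, true_and] at hy ⊢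
      rcases hy with rfl | hy
      · rw [← SimpleGraph.card_neighborFinset_eq_degree, Finset.card_eq_zero,
          Finset.eq_empty_iff_forall_notMem]
        intro z hz
        rw [SimpleGraph.mem_neighborFinset] at hz
        exact hK2 z hz
      · have := SimpleGraph.degree_le_of_le hK1 (v := y)
        omega
    have h4 : H.degree x ≤ H.edgeFinset.card := H.degree_le_card_edgeFinset x
    have h5 := Nat.mul_le_mul_left δ h3
    simp only [f] at h1
    rw [Nat.mul_add] at h5
    omega
  · have h1 := hmax G (le_refl G)
    simp only [f] at h1
    have h2 := Nat.mul_le_mul_left δ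
      (Finset.card_le_univ (Finset.univ.filter fun y => H.degree y = 0))
    omega

end Cleanup
end ESEC
namespace ESEC
section UpperEx

open Classical in
lemma edges_le {n : ℕ} (G : SimpleGraph (Fin n)) (ℓ m δ : ℕ) (hn : 0 < n) (hℓ : 2 ≤ ℓ) (hm : 1 ≤ m)
    (hG : EvenCycleFree G ℓ) (hk : ¬ HasCycleLength G (2*ℓ+m)) (hδ : 2*(m+4) < δ) :
    (G.edgeSet.ncard : ℝ) ≤ (n / 2 : ℝ) * ((n / 2 : ℝ) ^ (1 / ℓ : ℝ) *
      Real.exp (((ℓ + m) * ((m+4 : ℕ) * (2 + ℓ * Real.log n) / δ)) / ℓ)) + δ * n := by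
  obtain ⟨H, hHG, hdeg, hcard⟩ := cleanup G δ
  have hGc : G.edgeSet.ncard = G.edgeFinset.card := by
    rw [← SimpleGraph.coe_edgeFinset, Set.ncard_coe_finset]
  have hcard' : (G.edgeFinset.card : ℝ) ≤ H.edgeFinset.card + δ * n := by
    have := hcard
    rw [Fintype.card_fin] at this
    exact_mod_cast this
  rw [hGc]
  refine le_trans hcard' ?_
  gcongr
  have hn0 : (0 : ℝ) < n := by exact_mod_cast hn
  have hsum := H.sum_degrees_eq_twice_card_edges
  by_cases hE : 0 < ∑ x, H.degree x
  · have key := main_upper H ℓ m δ hℓ hm (evenFree_mono hHG hG)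
      (fun h => hk (hasCycle_mono hHG h)) hδ hdeg hE
    rw [Fintype.card_fin] at key
    have hs : (∑ x, (H.degree x : ℝ)) = 2 * H.edgeFinset.card := by
      exact_mod_cast hsum
    rw [hs] at key
    have he : (0 : ℝ) < H.edgeFinset.card := by
      have : 0 < H.edgeFinset.card := by omega
      exact_mod_cast this
    set err := ((ℓ + m) * ((m+4 : ℕ) * (2 + ℓ * Real.log n) / δ) : ℝ)
    have hl0 : (0 : ℝ) < ℓ := by positivity
    have h2 : Real.log (2 * H.edgeFinset.card / n) ≤ Real.log (n / 2) * (1 / ℓ) + err / ℓ := by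
      rw [← mul_div_assoc, mul_one, ← add_div, le_div_iff₀ hl0]
      linarith
    have h3 : 2 * (H.edgeFinset.card : ℝ) / n ≤ (n / 2 : ℝ) ^ (1 / ℓ : ℝ) * Real.exp (err / ℓ) := by
      rw [Real.rpow_def_of_pos (by positivity), ← Real.exp_add]
      rw [← Real.log_le_iff_le_exp (by positivity)]
      exact h2
    calc (H.edgeFinset.card : ℝ) = n / 2 * (2 * (H.edgeFinset.card : ℝ) / n) := by
          field_simp
      _ ≤ _ := by gcongr
  · have : H.edgeFinset.card = 0 := by omega
    rw [this, Nat.cast_zero]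
    positivity

lemma ex_upper (ℓ k : ℕ) (hℓ : 2 ≤ ℓ) (hk : 2 * ℓ < k) (ε : ℝ) (hε : 0 < ε) :
    ∀ᶠ n : ℕ in Filter.atTop, (exTuran n ℓ k : ℝ) ≤
      (1 + ε) * ((n / 2 : ℝ) * (n / 2 : ℝ) ^ (1 / ℓ : ℝ)) := by
  obtain ⟨m, rfl⟩ : ∃ m, k = 2 * ℓ + m := ⟨k - 2 * ℓ, by omega⟩
  have hm : 1 ≤ m := by omega
  set a : ℝ := 1 / (2 * ℓ) with ha
  have hl0 : (0 : ℝ) < ℓ := by positivity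
  have ha0 : 0 < a := by positivity
  let δ : ℕ → ℕ := fun n => ⌈(n : ℝ) ^ a⌉₊
  have hcast := tendsto_natCast_atTop_atTop (R := ℝ)
  have hna : Filter.Tendsto (fun n : ℕ => (n : ℝ) ^ a) Filter.atTop Filter.atTop :=
    (tendsto_rpow_atTop ha0).comp hcast
  have hδ : Filter.Tendsto δ Filter.atTop Filter.atTop :=
    tendsto_nat_ceil_atTop.comp hna
  have hδR : ∀ n : ℕ, (n : ℝ) ^ a ≤ δ n := fun n => Nat.le_ceil _
  -- error term tends to zero
  have hlog : Filter.Tendsto (fun n : ℕ => Real.log n / (n : ℝ) ^ a) Filter.atTop (nhds 0) :=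
    (isLittleO_log_rpow_atTop ha0).tendsto_div_nhds_zero.comp hcast
  have herr0 : Filter.Tendsto (fun n : ℕ => (2 + ℓ * Real.log n) / (δ n : ℝ))
      Filter.atTop (nhds 0) := by
    have hb : Filter.Tendsto (fun n : ℕ => 2 / (n : ℝ) ^ a + ℓ * (Real.log n / (n : ℝ) ^ a))
      Filter.atTop (nhds 0) := by
      simpa using (hna.const_div_atTop 2).add (hlog.const_mul (ℓ : ℝ))
    refine squeeze_zero' ?_ ?_ hb
    · filter_upwards [Filter.eventually_ge_atTop 1] with n hn
      have := Real.log_natCast_nonneg n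
      positivity
    · filter_upwards [Filter.eventually_ge_atTop 1] with n hn
      have := Real.log_natCast_nonneg n
      have hp : (0 : ℝ) < (n : ℝ) ^ a := by positivity
      rw [← mul_div_assoc, ← add_div]
      gcongr
      exact hδR n
  have herr : Filter.Tendsto (fun n : ℕ =>
      Real.exp (((ℓ + m) * ((m+4 : ℕ) * (2 + ℓ * Real.log n) / δ n)) / ℓ))
      Filter.atTop (nhds 1) := by
    have h1 : Filter.Tendsto (fun n : ℕ =>
        ((ℓ + m) * ((m+4 : ℕ) * (2 + ℓ * Real.log n) / δ n)) / (ℓ:ℝ)) Filter.atTop (nhds 0) := by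
      have := herr0.const_mul (((ℓ + m) * (m+4 : ℕ)) / (ℓ : ℝ))
      rw [mul_zero] at this
      refine this.congr fun n => ?_
      ring
    have := (Real.continuous_exp.tendsto 0).comp h1
    rwa [Real.exp_zero] at this
  have hdel : Filter.Tendsto (fun n : ℕ => 2 * (δ n : ℝ) / (n / 2 : ℝ) ^ (1 / ℓ : ℝ))
      Filter.atTop (nhds 0) := by
    have hb : Filter.Tendsto (fun n : ℕ => (4 * (2:ℝ) ^ (1 / ℓ : ℝ)) / (n : ℝ) ^ a)
        Filter.atTop (nhds 0) := hna.const_div_atTop _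
    refine squeeze_zero' ?_ ?_ hb
    · exact Filter.Eventually.of_forall fun n => by positivity
    · filter_upwards [Filter.eventually_ge_atTop 1] with n hn
      have hn1 : (1 : ℝ) ≤ n := by exact_mod_cast hn
      have h1 : (1 : ℝ) ≤ (n : ℝ) ^ a := Real.one_le_rpow hn1 ha0.le
      have h2 : (δ n : ℝ) ≤ 2 * (n : ℝ) ^ a := by
        have := (Nat.ceil_lt_add_one (a := (n : ℝ) ^ a) (by positivity)).le
        simp only [δ]
        linarith
      have h3 : (n / 2 : ℝ) ^ (1 / ℓ : ℝ) = (n : ℝ) ^ a * (n : ℝ) ^ a / (2:ℝ) ^ (1 / ℓ : ℝ) := by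
        rw [Real.div_rpow (by positivity) (by positivity), ← Real.rpow_add (by positivity)]
        congr 2
        rw [ha]; field_simp; norm_num
      rw [h3]
      have h4 : (0 : ℝ) < (2:ℝ) ^ (1 / ℓ : ℝ) := by positivity
      rw [div_div_eq_mul_div, div_le_div_iff₀ (by positivity) (by positivity)]
      have h5 : 0 < (n : ℝ) ^ a := by positivity
      nlinarith [mul_le_mul_of_nonneg_right h2 (mul_pos h4 h5).le]
  have htot := herr.add hdel
  rw [add_zero] at htot
  filter_upwards [htot.eventually_lt_const (show (1 : ℝ) < 1 + ε by linarith),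
    Filter.eventually_ge_atTop 1, hδ.eventually_gt_atTop (2 * (m + 4))] with n hn hn1 hnδ
  have hn0 : (0 : ℝ) < n := by exact_mod_cast hn1
  set X := (n / 2 : ℝ) ^ (1 / ℓ : ℝ) with hX
  have hX0 : 0 < X := by positivity
  have hb : 0 ≤ (1 + ε) * ((n / 2 : ℝ) * X) := by positivity
  have : exTuran n ℓ (2 * ℓ + m) ≤ ⌊(1 + ε) * ((n / 2 : ℝ) * X)⌋₊ := by
    apply csSup_le'
    rintro e ⟨G, h1, h2, rfl⟩
    apply Nat.le_floor
    refine (edges_le G ℓ m (δ n) (by omega) hℓ hm h1 h2 hnδ).trans ?_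
    rw [← hX]
    set E := Real.exp (((ℓ + m) * ((m+4 : ℕ) * (2 + ℓ * Real.log n) / δ n)) / ℓ)
    calc (n / 2 : ℝ) * (X * E) + δ n * n = (E + 2 * δ n / X) * (n / 2 * X) := by
          field_simp
      _ ≤ _ := by gcongr
  calc (exTuran n ℓ (2 * ℓ + m) : ℝ) ≤ (⌊(1 + ε) * ((n / 2 : ℝ) * X)⌋₊ : ℝ) := by exact_mod_cast this
    _ ≤ _ := Nat.floor_le hb

end UpperEx
end ESEC
namespace ESEC
section Alg
variable {F : Type*} [Field F]

lemma alg2 (t0 t1 x0 x1 : F) (h : t0 ≠ 0) (h01 : x0 ≠ x1)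
    (m0 : t0 + t1 = 0) (m1 : t0 * x0 + t1 * x1 = 0) : False := by
  have : t0 * (x0 - x1) = 0 := by linear_combination m1 - x1 * m0
  simp [h, sub_eq_zero, h01] at this

lemma alg3 (t0 t1 t2 x0 x1 x2 : F) (h : t0 ≠ 0) (h01 : x0 ≠ x1) (h02 : x2 ≠ x0)
    (m0 : t0 + t1 + t2 = 0) (m1 : t0 * x0 + t1 * x1 + t2 * x2 = 0)
    (m2 : t0 * x0 ^ 2 + t1 * x1 ^ 2 + t2 * x2 ^ 2 = 0) : False := by
  have : t0 * (x0 - x1) * (x2 - x0) = 0 := by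
    linear_combination - m2 + (x1 + x2) * m1 - x1 * x2 * m0
  simp [h, sub_eq_zero, h01, h02] at this

lemma alg4 (h2 : (2 : F) ≠ 0) (t0 t1 t2 t3 x0 x1 x2 x3 : F) (ht0 : t0 ≠ 0) (ht1 : t1 ≠ 0)
    (h01 : x0 ≠ x1) (h12 : x1 ≠ x2) (h23 : x2 ≠ x3) (h30 : x3 ≠ x0)
    (m0 : t0 + t1 + t2 + t3 = 0) (m1 : t0 * x0 + t1 * x1 + t2 * x2 + t3 * x3 = 0)
    (m2 : t0 * x0 ^ 2 + t1 * x1 ^ 2 + t2 * x2 ^ 2 + t3 * x3 ^ 2 = 0)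
    (m3 : t0 * x0 ^ 3 + t1 * x1 ^ 3 + t2 * x2 ^ 3 + t3 * x3 ^ 3 = 0)
    (S : t0 * t1 * (x0 - x1) ^ 3 + t0 * t2 * (x0 - x2) ^ 3 + t0 * t3 * (x0 - x3) ^ 3
      + t1 * t2 * (x1 - x2) ^ 3 + t1 * t3 * (x1 - x3) ^ 3 + t2 * t3 * (x2 - x3) ^ 3 = 0) :
    False := by
  have e0 : t0 * (x0 - x1) * (x3 - x0) * (x0 - x2) = 0 := by
    linear_combination -m3 + (x1 + x2 + x3) * m2 - (x1 * x2 + x1 * x3 + x2 * x3) * m1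
      + x1 * x2 * x3 * m0
  have e1 : t1 * (x0 - x1) * (x1 - x2) * (x1 - x3) = 0 := by
    linear_combination -m3 + (x0 + x2 + x3) * m2 - (x0 * x2 + x0 * x3 + x2 * x3) * m1
      + x0 * x2 * x3 * m0
  simp only [mul_eq_zero, sub_eq_zero, ht0, ht1, h01, h12, h30, false_or] at e0 e1
  subst e0 e1
  have e2 : (t0 + t2) * (x0 - x1) = 0 := by linear_combination m1 - x1 * m0
  simp only [mul_eq_zero, sub_eq_zero, h01, or_false] at e2
  have e3 : t2 = - t0 := by linear_combination e2
  have e4 : t3 = - t1 := by linear_combination m0 - e2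
  subst e3 e4
  have : 2 * t0 * t1 * (x0 - x1) ^ 3 = 0 := by linear_combination S
  simp [h2, ht0, ht1, sub_eq_zero, h01] at this

lemma alg5a (t0 t1 t2 t3 t4 x0 x1 x2 x3 x4 : F)
    (ht3 : t3 ≠ 0) (ht4 : t4 ≠ 0)
    (h12 : x1 ≠ x2) (h23 : x2 ≠ x3) (h34 : x3 ≠ x4) (h40 : x4 ≠ x0)
    (m0 : t0 + t1 + t2 + t3 + t4 = 0) (m1 : t0 * x0 + t1 * x1 + t2 * x2 + t3 * x3 + t4 * x4 = 0)
    (m2 : t0 * x0 ^ 2 + t1 * x1 ^ 2 + t2 * x2 ^ 2 + t3 * x3 ^ 2 + t4 * x4 ^ 2 = 0)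
    (m3 : t0 * x0 ^ 3 + t1 * x1 ^ 3 + t2 * x2 ^ 3 + t3 * x3 ^ 3 + t4 * x4 ^ 3 = 0) :
    x0 ≠ x2 := by
  intro e
  subst e
  have e0 : t4 * (x4 - x0) * (x4 - x1) * (x3 - x4) = 0 := by
    linear_combination -m3 + (x0 + x1 + x3) * m2 - (x0 * x1 + x1 * x3 + x0 * x3) * m1
      + x0 * x1 * x3 * m0
  simp only [mul_eq_zero, sub_eq_zero, ht4, h40, h34, false_or, or_false] at e0
  subst e0
  have e1 : t3 * (x0 - x3) * (x3 - x4) = 0 := by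
    linear_combination - m2 + (x0 + x4) * m1 - x0 * x4 * m0
  simp [ht3, sub_eq_zero, h23, h34] at e1

lemma alg5 (h2 : (2 : F) ≠ 0) (t0 t1 t2 t3 t4 x0 x1 x2 x3 x4 : F)
    (ht0 : t0 ≠ 0) (ht1 : t1 ≠ 0) (ht2 : t2 ≠ 0) (ht3 : t3 ≠ 0) (ht4 : t4 ≠ 0)
    (h01 : x0 ≠ x1) (h12 : x1 ≠ x2) (h23 : x2 ≠ x3) (h34 : x3 ≠ x4) (h40 : x4 ≠ x0)
    (m0 : t0 + t1 + t2 + t3 + t4 = 0) (m1 : t0 * x0 + t1 * x1 + t2 * x2 + t3 * x3 + t4 * x4 = 0)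
    (m2 : t0 * x0 ^ 2 + t1 * x1 ^ 2 + t2 * x2 ^ 2 + t3 * x3 ^ 2 + t4 * x4 ^ 2 = 0)
    (m3 : t0 * x0 ^ 3 + t1 * x1 ^ 3 + t2 * x2 ^ 3 + t3 * x3 ^ 3 + t4 * x4 ^ 3 = 0)
    (S : t0 * t1 * (x0 - x1) ^ 3 + t0 * t2 * (x0 - x2) ^ 3 + t0 * t3 * (x0 - x3) ^ 3
      + t0 * t4 * (x0 - x4) ^ 3
      + t1 * t2 * (x1 - x2) ^ 3 + t1 * t3 * (x1 - x3) ^ 3 + t1 * t4 * (x1 - x4) ^ 3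
      + t2 * t3 * (x2 - x3) ^ 3 + t2 * t4 * (x2 - x4) ^ 3 + t3 * t4 * (x3 - x4) ^ 3 = 0) :
    False := by
  have h02 : x0 ≠ x2 := alg5a t0 t1 t2 t3 t4 x0 x1 x2 x3 x4 ht3 ht4 h12 h23 h34 h40 m0 m1 m2 m3
  have h13 : x1 ≠ x3 := alg5a t1 t2 t3 t4 t0 x1 x2 x3 x4 x0 ht4 ht0 h23 h34 h40 h01
    (by linear_combination m0) (by linear_combination m1)
    (by linear_combination m2) (by linear_combination m3)
  have h24 : x2 ≠ x4 := alg5a t2 t3 t4 t0 t1 x2 x3 x4 x0 x1 ht0 ht1 h34 h40 h01 h12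
    (by linear_combination m0) (by linear_combination m1)
    (by linear_combination m2) (by linear_combination m3)
  have h30 : x3 ≠ x0 := alg5a t3 t4 t0 t1 t2 x3 x4 x0 x1 x2 ht1 ht2 h40 h01 h12 h23
    (by linear_combination m0) (by linear_combination m1)
    (by linear_combination m2) (by linear_combination m3)
  have h41 : x4 ≠ x1 := alg5a t4 t0 t1 t2 t3 x4 x0 x1 x2 x3 ht2 ht3 h01 h12 h23 h34
    (by linear_combination m0) (by linear_combination m1)
    (by linear_combination m2) (by linear_combination m3)
  have q1 : t1 * ((x1 - x2) * (x1 - x3) * (x1 - x4)) = -(t0 * ((x0 - x2) * (x0 - x3) * (x0 - x4))) := by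
    linear_combination m3 - (x2 + x3 + x4) * m2 + (x2 * x3 + x2 * x4 + x3 * x4) * m1
      - x2 * x3 * x4 * m0
  have q2 : t2 * ((x2 - x1) * (x2 - x3) * (x2 - x4)) = -(t0 * ((x0 - x1) * (x0 - x3) * (x0 - x4))) := by
    linear_combination m3 - (x1 + x3 + x4) * m2 + (x1 * x3 + x1 * x4 + x3 * x4) * m1
      - x1 * x3 * x4 * m0
  have q3 : t3 * ((x3 - x1) * (x3 - x2) * (x3 - x4)) = -(t0 * ((x0 - x1) * (x0 - x2) * (x0 - x4))) := by
    linear_combination m3 - (x2 + x1 + x4) * m2 + (x2 * x1 + x2 * x4 + x1 * x4) * m1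
      - x2 * x1 * x4 * m0
  have q4 : t4 * ((x4 - x1) * (x4 - x2) * (x4 - x3)) = -(t0 * ((x0 - x1) * (x0 - x2) * (x0 - x3))) := by
    linear_combination m3 - (x2 + x3 + x1) * m2 + (x2 * x3 + x2 * x1 + x3 * x1) * m1
      - x2 * x3 * x1 * m0
  -- cyclic invariance kills the terms with `t0`
  have S' : t1 * t2 * (x1 - x2) ^ 3 + t1 * t3 * (x1 - x3) ^ 3 + t1 * t4 * (x1 - x4) ^ 3
      + t2 * t3 * (x2 - x3) ^ 3 + t2 * t4 * (x2 - x4) ^ 3 + t3 * t4 * (x3 - x4) ^ 3 = 0 := by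
    linear_combination S - t0 * (x0 ^ 3 * m0 - 3 * x0 ^ 2 * m1 + 3 * x0 * m2 - m3)
  obtain ⟨a, ha⟩ : ∃ a, a = x0 - x1 := ⟨_, rfl⟩
  obtain ⟨b, hb⟩ : ∃ a, a = x0 - x2 := ⟨_, rfl⟩
  obtain ⟨c, hc⟩ : ∃ a, a = x0 - x3 := ⟨_, rfl⟩
  obtain ⟨d, hd⟩ : ∃ a, a = x0 - x4 := ⟨_, rfl⟩
  obtain rfl : x1 = x0 - a := by rw [ha]; ring
  obtain rfl : x2 = x0 - b := by rw [hb]; ring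
  obtain rfl : x3 = x0 - c := by rw [hc]; ring
  obtain rfl : x4 = x0 - d := by rw [hd]; ring
  clear ha hb hc hd S m0 m1 m2 m3
  have ha : a ≠ 0 := by rintro rfl; simp at h01
  have hb : b ≠ 0 := by rintro rfl; simp at h02
  have hc : c ≠ 0 := by rintro rfl; simp at h30
  have hd : d ≠ 0 := by rintro rfl; simp at h40
  have hab : a - b ≠ 0 := by intro h; apply h12; linear_combination - h
  have hac : a - c ≠ 0 := by intro h; apply h13; linear_combination - h
  have had : a - d ≠ 0 := by intro h; apply h41; linear_combination h
  have hbc : b - c ≠ 0 := by intro h; apply h23; linear_combination - h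
  have hbd : b - d ≠ 0 := by intro h; apply h24; linear_combination - h
  have hcd : c - d ≠ 0 := by intro h; apply h34; linear_combination - h
  have r1 : t1 = t0 * (b * c * d) / ((a - b) * (a - c) * (a - d)) := by
    rw [eq_div_iff (by positivity)]; linear_combination -q1
  have r2 : t2 = -(t0 * (a * c * d) / ((a - b) * (b - c) * (b - d))) := by
    rw [← neg_div, eq_div_iff (by positivity)]; linear_combination q2
  have r3 : t3 = t0 * (a * b * d) / ((a - c) * (b - c) * (c - d)) := by
    rw [eq_div_iff (by positivity)]; linear_combination -q3
  have r4 : t4 = -(t0 * (a * b * c) / ((a - d) * (b - d) * (c - d))) := by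
    rw [← neg_div, eq_div_iff (by positivity)]; linear_combination q4
  have key : t1 * t2 * (x0 - a - (x0 - b)) ^ 3 + t1 * t3 * (x0 - a - (x0 - c)) ^ 3 + t1 * t4 * (x0 - a - (x0 - d)) ^ 3
      + t2 * t3 * (x0 - b - (x0 - c)) ^ 3 + t2 * t4 * (x0 - b - (x0 - d)) ^ 3 + t3 * t4 * (x0 - c - (x0 - d)) ^ 3
      = -2 * t0 ^ 2 * a ^ 2 * b * c * d ^ 2 / ((a - c) * (a - d) * (b - d)) := by
    rw [r1, r2, r3, r4]
    field_simp
    ring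
  rw [key] at S'
  simp [ha, hb, hc, hd, hac, had, hbd, ht0, h2] at S'

end Alg
end ESEC
namespace ESEC
section Constr

lemma cyc_seq {V : Type*} {G : SimpleGraph V} {m : ℕ} (h : HasCycleLength G m) :
    3 ≤ m ∧ ∃ c : ℕ → V, (∀ i, c (i + m) = c i) ∧ (∀ i, G.Adj (c i) (c (i + 1))) ∧
      (∀ i, c i ≠ c (i + 2)) ∧ (∀ i j, i < m → j < m → c i = c j → i = j) := by
  obtain ⟨v, w, hw, rfl⟩ := h
  have h3 := hw.three_le_length
  have hinj := hw.getVert_injOn'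
  have hlt : ∀ i, i % w.length < w.length := fun i => Nat.mod_lt _ (by omega)
  refine ⟨h3, fun i => w.getVert (i % w.length), ?_, ?_, ?_, ?_⟩
  · intro i
    simp
  · intro i
    by_cases hi : i % w.length + 1 < w.length
    · have : (i + 1) % w.length = i % w.length + 1 := by
        rw [Nat.add_mod, Nat.mod_eq_of_lt (show 1 < w.length by omega), Nat.mod_eq_of_lt hi]
      simp only [this]
      exact w.adj_getVert_succ (hlt i)
    · have hi' : i % w.length + 1 = w.length := by have := hlt i; omega
      have : (i + 1) % w.length = 0 := by
        rw [Nat.add_mod, Nat.mod_eq_of_lt (show 1 < w.length by omega), hi', Nat.mod_self]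
      simp only [this]
      have h4 := w.adj_getVert_succ (hlt i)
      rw [hi', SimpleGraph.Walk.getVert_length] at h4
      simpa using h4
  · intro i hi
    have h5 := hinj (by have := hlt i; simp only [Set.mem_ofPred_eq]; omega)
      (by have := hlt (i + 2); simp only [Set.mem_ofPred_eq]; omega) hi
    have h6 : i + 0 ≡ i + 2 [MOD w.length] := h5
    have h7 := Nat.ModEq.add_left_cancel' i h6
    have h8 := (Nat.modEq_zero_iff_dvd.mp h7.symm)
    have := Nat.le_of_dvd (by norm_num) h8
    omega
  · intro i j hi hj h
    simp only [Nat.mod_eq_of_lt hi, Nat.mod_eq_of_lt hj] at h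
    exact hinj (by simp only [Set.mem_ofPred_eq]; omega)
      (by simp only [Set.mem_ofPred_eq]; omega) h

lemma hasCycle_map {V W : Type*} {G : SimpleGraph V} (f : V ↪ W) {m : ℕ}
    (h : HasCycleLength (G.map f) m) : HasCycleLength G m := by
  obtain ⟨h3, c, hper, hadj, -, hinj⟩ := cyc_seq h
  have hex : ∀ i, ∃ u, f u = c i := by
    intro i
    obtain ⟨u, v, -, hu, -⟩ := (SimpleGraph.map_adj f G _ _).mp (hadj i)
    exact ⟨u, hu⟩
  choose u hu using hex
  have hG : ∀ i, G.Adj (u i) (u (i + 1)) := by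
    intro i
    have := hadj i
    rw [← hu, ← hu] at this
    exact SimpleGraph.map_adj_apply.mp this
  refine hasCycle_of_seq m h3 u ?_ (fun i _ => hG i) ?_
  · intro i j hi hj hij
    apply hinj i j hi hj
    rw [← hu, ← hu, hij]
  · have := hG (m - 1)
    rw [show m - 1 + 1 = m by omega] at this
    have h0 : u m = u 0 := by
      apply f.injective
      rw [hu, hu]
      simpa using hper 0
    rwa [h0] at this

lemma zSet_bdd (n ℓ : ℕ) : BddAbove {e | ∃ G : SimpleGraph (Fin n),
    EvenCycleFree G ℓ ∧ G.Colorable 2 ∧ G.edgeSet.ncard = e} := by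
  refine ⟨(Set.univ : Set (Sym2 (Fin n))).ncard, ?_⟩
  rintro e ⟨G, -, -, rfl⟩
  exact Set.ncard_le_ncard (Set.subset_univ _) (Set.toFinite _)

lemma le_zZar {V : Type*} [Fintype V] (G : SimpleGraph V) (n ℓ : ℕ)
    (hG : EvenCycleFree G ℓ) (hcol : G.Colorable 2) (hn : Fintype.card V ≤ n) :
    G.edgeSet.ncard ≤ zZar n ℓ := by
  obtain ⟨f⟩ : Nonempty (V ↪ Fin n) :=
    Function.Embedding.nonempty_of_card_le (by simpa using hn)
  apply le_csSup (zSet_bdd n ℓ)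
  refine ⟨G.map f, ?_, ?_, ?_⟩
  · intro m h1 h2 h3
    exact hG m h1 h2 (hasCycle_map f h3)
  · obtain ⟨C⟩ := hcol
    refine ⟨SimpleGraph.Coloring.mk (Function.extend f C (fun _ => 0)) ?_⟩
    intro a b hab
    obtain ⟨u, v, huv, rfl, rfl⟩ := (SimpleGraph.map_adj f G _ _).mp hab
    rw [f.injective.extend_apply, f.injective.extend_apply]
    exact C.valid huv
  · rw [SimpleGraph.edgeSet_map]
    exact Set.ncard_image_of_injective _ f.sym2Map.injective

variable {L F Q : Type*}

/-- incidence graph: `h` is joined to `(x, r h x)` for every `x`. -/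
def BG (r : L → F → Q) : SimpleGraph (L ⊕ (F × Q)) where
  Adj a b := match a, b with
    | Sum.inl h, Sum.inr q => r h q.1 = q.2
    | Sum.inr q, Sum.inl h => r h q.1 = q.2
    | _, _ => False
  symm := ⟨by rintro (a | a) (b | b) h <;> exact h⟩
  loopless := ⟨by rintro (a | a) h <;> exact h⟩

lemma BG_adj (r : L → F → Q) (h : L) (q : F × Q) :
    (BG r).Adj (Sum.inl h) (Sum.inr q) ↔ r h q.1 = q.2 := Iff.rfl

lemma BG_col (r : L → F → Q) : (BG r).Colorable 2 := by
  refine ⟨SimpleGraph.Coloring.mk (Sum.elim (fun _ => 0) (fun _ => 1)) ?_⟩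
  rintro (a | a) (b | b) h <;> first | exact h.elim | simp

lemma BG_edges [Fintype L] [Fintype F] [Fintype Q] (r : L → F → Q) :
    Fintype.card L * Fintype.card F ≤ (BG r).edgeSet.ncard := by
  classical
  let g : L × F → Sym2 (L ⊕ (F × Q)) := fun a => s(Sum.inl a.1, Sum.inr (a.2, r a.1 a.2))
  have hg : Function.Injective g := by
    rintro ⟨a, b⟩ ⟨c, d⟩ h
    simp only [g, Sym2.eq_iff, Sum.inl.injEq, Sum.inr.injEq, Prod.mk.injEq, reduceCtorEq,
      false_and, or_false] at h
    simp [h.1, h.2.1]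
  have h1 : (g '' Set.univ).ncard = Fintype.card L * Fintype.card F := by
    rw [Set.ncard_image_of_injective _ hg, Set.ncard_univ, Nat.card_eq_fintype_card,
      Fintype.card_prod]
  rw [← h1]
  apply Set.ncard_le_ncard _ (Set.toFinite _)
  rintro _ ⟨a, -, rfl⟩
  rw [SimpleGraph.mem_edgeSet, BG_adj]

lemma BG_cycle (r : L → F → Q) {m : ℕ} (h : HasCycleLength (BG r) (2 * m)) :
    ∃ (h : ℕ → L) (x : ℕ → F), (∀ i, h (i + m) = h i) ∧ (∀ i, x (i + m) = x i) ∧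
      (∀ i, r (h i) (x i) = r (h (i + 1)) (x i)) ∧ (∀ i, h i ≠ h (i + 1)) ∧
      (∀ i, x i ≠ x (i + 1)) := by
  obtain ⟨h3, c, hper, hadj, hne, -⟩ := cyc_seq h
  obtain ⟨c, hper, hadj, hne, h0, hc0⟩ : ∃ c : ℕ → L ⊕ (F × Q), (∀ i, c (i + 2 * m) = c i) ∧
      (∀ i, (BG r).Adj (c i) (c (i + 1))) ∧ (∀ i, c i ≠ c (i + 2)) ∧ ∃ h0, c 0 = Sum.inl h0 := by
    rcases hc : c 0 with h0 | q0
    · exact ⟨c, hper, hadj, hne, h0, hc⟩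
    · rcases hc1 : c 1 with h1 | q1
      · refine ⟨fun i => c (i + 1), ?_, fun i => hadj _, fun i => hne _, h1, hc1⟩
        intro i
        have := hper (i + 1)
        rwa [show i + 1 + 2 * m = i + 2 * m + 1 by ring] at this
      · have := hadj 0
        rw [zero_add, hc, hc1] at this
        exact this.elim
  have hstep : ∀ i, (∃ u, c (2 * i) = Sum.inl u) ∧ ∃ q, c (2 * i + 1) = Sum.inr q := by
    have hq : ∀ i, (∃ u, c i = Sum.inl u) → ∃ q, c (i + 1) = Sum.inr q := by
      rintro i ⟨u, hu⟩
      rcases hc : c (i + 1) with h0 | q0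
      · have := hadj i
        rw [hu, hc] at this
        exact this.elim
      · exact ⟨q0, rfl⟩
    have hu : ∀ i, (∃ u, c i = Sum.inr u) → ∃ q, c (i + 1) = Sum.inl q := by
      rintro i ⟨u, hu⟩
      rcases hc : c (i + 1) with h0 | q0
      · exact ⟨h0, rfl⟩
      · have := hadj i
        rw [hu, hc] at this
        exact this.elim
    intro i
    induction i with
    | zero => exact ⟨⟨h0, hc0⟩, hq _ ⟨h0, hc0⟩⟩
    | succ i ih =>
      have h1 := hu _ ih.2
      exact ⟨h1, hq _ h1⟩
  choose hh hhc using fun i => (hstep i).1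
  choose q hqc using fun i => (hstep i).2
  have e1 : ∀ i, r (hh i) (q i).1 = (q i).2 := by
    intro i
    have := hadj (2 * i)
    rw [hhc, hqc] at this
    exact this
  have e2 : ∀ i, r (hh (i + 1)) (q i).1 = (q i).2 := by
    intro i
    have := hadj (2 * i + 1)
    rw [hqc, show 2 * i + 1 + 1 = 2 * (i + 1) by ring, hhc] at this
    exact this
  refine ⟨hh, fun i => (q i).1, ?_, ?_, ?_, ?_, ?_⟩
  · intro i
    have := hper (2 * i)
    rw [show 2 * i + 2 * m = 2 * (i + m) by ring, hhc, hhc] at this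
    exact Sum.inl_injective this
  · intro i
    have := hper (2 * i + 1)
    rw [show 2 * i + 1 + 2 * m = 2 * (i + m) + 1 by ring, hqc, hqc] at this
    exact congrArg Prod.fst (Sum.inr_injective this)
  · intro i
    rw [e1, e2]
  · intro i hi
    apply hne (2 * i)
    rw [show 2 * i + 2 = 2 * (i + 1) by ring, hhc, hhc, hi]
  · intro i hi
    apply hne (2 * i + 1)
    rw [show 2 * i + 1 + 2 = 2 * (i + 1) + 1 by ring, hqc, hqc]
    congr 1
    refine Prod.ext hi ?_
    rw [← e2 i, ← e1 (i + 1)]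
    simp only at hi
    rw [hi]

end Constr
end ESEC
namespace ESEC
section Inst
variable {F : Type*} [Field F]

def r2 : F × F → F → F := fun h x => h.2 - h.1 * x

lemma free2 : EvenCycleFree (BG (r2 (F := F))) 2 := by
  intro m h1 h2 h3
  obtain rfl : m = 2 := by omega
  obtain ⟨h, x, hper, xper, hr, hne, xne⟩ := BG_cycle _ h3
  simp only [r2] at hr
  have t0 : (h 1).1 - (h 0).1 ≠ 0 := by
    intro e
    apply hne 0
    have e' : (h 0).1 = (h 1).1 := by linear_combination -e
    have := hr 0
    simp only [zero_add, e'] at this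
    exact Prod.ext e' (by linear_combination this)
  have p0 : h 2 = h 0 := hper 0
  have e0 := hr 0
  have e1 := hr 1
  simp only [zero_add, Nat.reduceAdd, p0] at e0 e1
  exact alg2 ((h 1).1 - (h 0).1) ((h 0).1 - (h 1).1) (x 0) (x 1) t0 (xne 0) (by ring)
    (by linear_combination e0 + e1)

def r3 : F × F × F → F → F × F := fun h x => (h.2.1 - h.1 * x, h.2.2 - h.1 * x ^ 2)

lemma free3 : EvenCycleFree (BG (r3 (F := F))) 3 := by
  intro m h1 h2 h3
  obtain ⟨h, x, hper, xper, hr, hne, xne⟩ := BG_cycle _ h3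
  simp only [r3, Prod.mk.injEq] at hr
  have t0 : (h 1).1 - (h 0).1 ≠ 0 := by
    intro e
    apply hne 0
    have e' : (h 0).1 = (h 1).1 := by linear_combination -e
    have := hr 0
    simp only [zero_add, e'] at this
    exact Prod.ext e' (Prod.ext (by linear_combination this.1) (by linear_combination this.2))
  have hm : m = 2 ∨ m = 3 := by omega
  rcases hm with rfl | rfl
  · have p0 : h 2 = h 0 := hper 0
    obtain ⟨e0, -⟩ := hr 0
    obtain ⟨e1, -⟩ := hr 1
    simp only [zero_add, Nat.reduceAdd, p0] at e0 e1
    exact alg2 ((h 1).1 - (h 0).1) ((h 0).1 - (h 1).1) (x 0) (x 1) t0 (xne 0) (by ring)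
      (by linear_combination e0 + e1)
  · have p0 : h 3 = h 0 := hper 0
    have px : x 3 = x 0 := xper 0
    obtain ⟨e0, f0⟩ := hr 0
    obtain ⟨e1, f1⟩ := hr 1
    obtain ⟨e2, f2⟩ := hr 2
    have x20 := xne 2
    simp only [zero_add, Nat.reduceAdd, p0, px] at e0 e1 e2 f0 f1 f2 x20
    exact alg3 ((h 1).1 - (h 0).1) ((h 2).1 - (h 1).1) ((h 0).1 - (h 2).1) (x 0) (x 1) (x 2)
      t0 (xne 0) x20 (by ring)
      (by linear_combination e0 + e1 + e2) (by linear_combination f0 + f1 + f2)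

def r5 : F × F × F × F × F → F → F × F × F × F := fun h x =>
  (h.2.1 - h.1 * x, h.2.2.1 - h.1 * x ^ 2, h.2.2.2.1 - h.1 * x ^ 3,
    h.2.2.2.2 - h.1 * (h.2.2.2.1 - 3 * h.2.2.1 * x + 3 * h.2.1 * x ^ 2 - h.1 * x ^ 3))

lemma free5 (hF : (2 : F) ≠ 0) : EvenCycleFree (BG (r5 (F := F))) 5 := by
  intro m h1 h2 h3
  obtain ⟨h, x, hper, xper, hr, hne, xne⟩ := BG_cycle _ h3
  simp only [r5, Prod.mk.injEq] at hr
  have tt : ∀ i, (h (i + 1)).1 - (h i).1 ≠ 0 := by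
    intro i e
    apply hne i
    have e' : (h i).1 = (h (i + 1)).1 := by linear_combination -e
    obtain ⟨g1, g2, g3, g4⟩ := hr i
    rw [e'] at g1 g2 g3 g4
    have k1 : (h i).2.1 = (h (i + 1)).2.1 := by linear_combination g1
    have k2 : (h i).2.2.1 = (h (i + 1)).2.2.1 := by linear_combination g2
    have k3 : (h i).2.2.2.1 = (h (i + 1)).2.2.2.1 := by linear_combination g3
    rw [k1, k2, k3] at g4
    exact Prod.ext e' (Prod.ext k1 (Prod.ext k2 (Prod.ext k3 (by linear_combination g4))))
  obtain ⟨a, ha⟩ : ∃ a : ℕ → F, ∀ i, a i = (h i).1 := ⟨_, fun _ => rfl⟩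
  obtain ⟨b, hb⟩ : ∃ a : ℕ → F, ∀ i, a i = (h i).2.1 := ⟨_, fun _ => rfl⟩
  obtain ⟨c, hc⟩ : ∃ a : ℕ → F, ∀ i, a i = (h i).2.2.1 := ⟨_, fun _ => rfl⟩
  obtain ⟨d, hd⟩ : ∃ a : ℕ → F, ∀ i, a i = (h i).2.2.2.1 := ⟨_, fun _ => rfl⟩
  obtain ⟨z, hz⟩ : ∃ a : ℕ → F, ∀ i, a i = (h i).2.2.2.2 := ⟨_, fun _ => rfl⟩
  have pa : a m = a 0 := by rw [ha, ha, ← hper 0, zero_add]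
  have pb : b m = b 0 := by rw [hb, hb, ← hper 0, zero_add]
  have pc : c m = c 0 := by rw [hc, hc, ← hper 0, zero_add]
  have pd : d m = d 0 := by rw [hd, hd, ← hper 0, zero_add]
  have pz : z m = z 0 := by rw [hz, hz, ← hper 0, zero_add]
  have px : x m = x 0 := by rw [← xper 0, zero_add]
  simp only [← ha, ← hb, ← hc, ← hd, ← hz] at hr tt
  clear ha hb hc hd hz hper xper h3 hne
  obtain ⟨t, ht⟩ : ∃ t : ℕ → F, ∀ i, t i = a (i + 1) - a i := ⟨_, fun _ => rfl⟩
  simp only [← ht] at tt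
  have ea : ∀ i, a (i + 1) = a i + t i := fun i => by rw [ht]; ring
  have eb : ∀ i, b (i + 1) = b i + t i * x i := fun i => by
    linear_combination -(hr i).1 - x i * ht i
  have ec : ∀ i, c (i + 1) = c i + t i * x i ^ 2 := fun i => by
    linear_combination -(hr i).2.1 - x i ^ 2 * ht i
  have ed : ∀ i, d (i + 1) = d i + t i * x i ^ 3 := fun i => by
    linear_combination -(hr i).2.2.1 - x i ^ 3 * ht i
  have ez : ∀ i, z (i + 1) = z i +
      t i * (d i - 3 * c i * x i + 3 * b i * x i ^ 2 - a i * x i ^ 3) := fun i => by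
    have h4 := (hr i).2.2.2
    rw [ea i, eb i, ec i, ed i] at h4
    linear_combination - h4
  clear hr ht
  have hm : m = 2 ∨ m = 3 ∨ m = 4 ∨ m = 5 := by omega
  have a1 := ea 0
  have a2 := ea 1
  have b1 := eb 0
  have b2 := eb 1
  have c1 := ec 0
  have c2 := ec 1
  have d1 := ed 0
  have d2 := ed 1
  have z1 := ez 0
  have z2 := ez 1
  simp only [zero_add, Nat.reduceAdd] at a1 b1 c1 d1 z1 a2 b2 c2 d2 z2
  rw [a1] at a2
  rw [b1] at b2
  rw [c1] at c2
  rw [d1] at d2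
  rw [a1, b1, c1, d1, z1] at z2
  rcases hm with rfl | rfl | rfl | rfl
  · exact alg2 (t 0) (t 1) (x 0) (x 1) (tt 0) (xne 0) (by linear_combination pa - a2)
      (by linear_combination pb - b2)
  · have a3 := ea 2
    have b3 := eb 2
    have c3 := ec 2
    simp only [Nat.reduceAdd] at a3 b3 c3
    have x2 := xne 2
    simp only [Nat.reduceAdd, px] at x2
    exact alg3 (t 0) (t 1) (t 2) (x 0) (x 1) (x 2) (tt 0) (xne 0) x2
      (by linear_combination pa - a3 - a2)
      (by linear_combination pb - b3 - b2) (by linear_combination pc - c3 - c2)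
  · have a3 := ea 2
    have b3 := eb 2
    have c3 := ec 2
    have d3 := ed 2
    have z3 := ez 2
    have a4 := ea 3
    have b4 := eb 3
    have c4 := ec 3
    have d4 := ed 3
    have z4 := ez 3
    simp only [Nat.reduceAdd] at a3 b3 c3 d3 z3 a4 b4 c4 d4 z4
    have x3 := xne 3
    simp only [Nat.reduceAdd, px] at x3
    rw [a2] at a3
    rw [b2] at b3
    rw [c2] at c3
    rw [d2] at d3
    rw [a2, b2, c2, d2, z2] at z3
    rw [a3] at a4
    rw [b3] at b4
    rw [c3] at c4
    rw [d3] at d4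
    rw [a3, b3, c3, d3, z3] at z4
    have m0 : t 0 + t 1 + t 2 + t 3 = 0 := by linear_combination pa - a4
    have m1 : t 0 * x 0 + t 1 * x 1 + t 2 * x 2 + t 3 * x 3 = 0 := by linear_combination pb - b4
    have m2 : t 0 * x 0 ^ 2 + t 1 * x 1 ^ 2 + t 2 * x 2 ^ 2 + t 3 * x 3 ^ 2 = 0 := by
      linear_combination pc - c4
    have m3 : t 0 * x 0 ^ 3 + t 1 * x 1 ^ 3 + t 2 * x 2 ^ 3 + t 3 * x 3 ^ 3 = 0 := by
      linear_combination pd - d4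
    refine alg4 hF (t 0) (t 1) (t 2) (t 3) (x 0) (x 1) (x 2) (x 3) (tt 0) (tt 1)
      (xne 0) (xne 1) (xne 2) x3 m0 m1 m2 m3 ?_
    linear_combination pz - z4 - d 0 * m0 + 3 * c 0 * m1 - 3 * b 0 * m2 + a 0 * m3
  · have a3 := ea 2
    have b3 := eb 2
    have c3 := ec 2
    have d3 := ed 2
    have z3 := ez 2
    have a4 := ea 3
    have b4 := eb 3
    have c4 := ec 3
    have d4 := ed 3
    have z4 := ez 3
    have a5 := ea 4
    have b5 := eb 4
    have c5 := ec 4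
    have d5 := ed 4
    have z5 := ez 4
    simp only [Nat.reduceAdd] at a3 b3 c3 d3 z3 a4 b4 c4 d4 z4 a5 b5 c5 d5 z5
    have x4 := xne 4
    simp only [Nat.reduceAdd, px] at x4
    rw [a2] at a3
    rw [b2] at b3
    rw [c2] at c3
    rw [d2] at d3
    rw [a2, b2, c2, d2, z2] at z3
    rw [a3] at a4
    rw [b3] at b4
    rw [c3] at c4
    rw [d3] at d4
    rw [a3, b3, c3, d3, z3] at z4
    rw [a4] at a5
    rw [b4] at b5
    rw [c4] at c5
    rw [d4] at d5
    rw [a4, b4, c4, d4, z4] at z5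
    have m0 : t 0 + t 1 + t 2 + t 3 + t 4 = 0 := by linear_combination pa - a5
    have m1 : t 0 * x 0 + t 1 * x 1 + t 2 * x 2 + t 3 * x 3 + t 4 * x 4 = 0 := by
      linear_combination pb - b5
    have m2 : t 0 * x 0 ^ 2 + t 1 * x 1 ^ 2 + t 2 * x 2 ^ 2 + t 3 * x 3 ^ 2
        + t 4 * x 4 ^ 2 = 0 := by
      linear_combination pc - c5
    have m3 : t 0 * x 0 ^ 3 + t 1 * x 1 ^ 3 + t 2 * x 2 ^ 3 + t 3 * x 3 ^ 3
        + t 4 * x 4 ^ 3 = 0 := by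
      linear_combination pd - d5
    refine alg5 hF (t 0) (t 1) (t 2) (t 3) (t 4) (x 0) (x 1) (x 2) (x 3) (x 4)
      (tt 0) (tt 1) (tt 2) (tt 3) (tt 4)
      (xne 0) (xne 1) (xne 2) (xne 3) x4 m0 m1 m2 m3 ?_
    linear_combination pz - z5 - d 0 * m0 + 3 * c 0 * m1 - 3 * b 0 * m2 + a 0 * m3

lemma z_lower (ℓ n p : ℕ) (hℓ : ℓ = 2 ∨ ℓ = 3 ∨ ℓ = 5) (hp : p.Prime) (hp2 : 2 < p)
    (hn : 2 * p ^ ℓ ≤ n) : p ^ (ℓ + 1) ≤ zZar n ℓ := by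
  have : Fact p.Prime := ⟨hp⟩
  have h2 : (2 : ZMod p) ≠ 0 := by
    intro h
    have : ((2 : ℕ) : ZMod p) = 0 := by exact_mod_cast h
    rw [ZMod.natCast_eq_zero_iff] at this
    have := Nat.le_of_dvd (by norm_num) this
    omega
  rcases hℓ with rfl | rfl | rfl
  · refine le_trans ?_ (le_zZar (BG (r2 (F := ZMod p))) n 2 free2 (BG_col _) ?_)
    · refine le_trans (le_of_eq ?_) (BG_edges _)
      simp only [Fintype.card_prod, ZMod.card]; ring
    · refine le_trans (le_of_eq ?_) hn
      simp only [Fintype.card_sum, Fintype.card_prod, ZMod.card]; ring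
  · refine le_trans ?_ (le_zZar (BG (r3 (F := ZMod p))) n 3 free3 (BG_col _) ?_)
    · refine le_trans (le_of_eq ?_) (BG_edges _)
      simp only [Fintype.card_prod, ZMod.card]; ring
    · refine le_trans (le_of_eq ?_) hn
      simp only [Fintype.card_sum, Fintype.card_prod, ZMod.card]; ring
  · refine le_trans ?_ (le_zZar (BG (r5 (F := ZMod p))) n 5 (free5 h2) (BG_col _) ?_)
    · refine le_trans (le_of_eq ?_) (BG_edges _)
      simp only [Fintype.card_prod, ZMod.card]; ring
    · refine le_trans (le_of_eq ?_) hn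
      simp only [Fintype.card_sum, Fintype.card_prod, ZMod.card]; ring

end Inst
end ESEC
namespace ESEC
section Primes
open ArithmeticFunction Filter Topology

lemma exPhi : ∃ Φ : ℂ → ℂ, ContinuousOn Φ {s | 1 ≤ s.re} ∧
    ∀ s : ℂ, 1 < s.re →
      HasSum (fun n : ℕ => LSeries.term (fun n => ((vonMangoldt n - 1 : ℝ) : ℂ)) s n) (Φ s) := by
  let Z : ℂ → ℂ := Function.update (fun s => riemannZeta s - 1 / (s - 1)) 1
    Real.eulerMascheroniConstant
  have hZ : Continuous Z := by
    rw [continuous_iff_continuousAt]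
    intro s
    by_cases hs : s = 1
    · subst hs
      exact continuousAt_update_same.mpr tendsto_riemannZeta_sub_one_div
    · refine (continuousAt_update_of_ne hs).mpr ?_
      exact (differentiableAt_riemannZeta hs).continuousAt.sub
        (continuousAt_const.div (by fun_prop) (sub_ne_zero.mpr hs))
  refine ⟨fun s => vonMangoldt.LFunctionResidueClassAux (1 : ZMod 1) s - Z s,
    (vonMangoldt.continuousOn_LFunctionResidueClassAux (1 : ZMod 1)).sub hZ.continuousOn, ?_⟩
  intro s hs
  have hs1 : s ≠ 1 := by rintro rfl; simp at hs
  have h1 := vonMangoldt.eqOn_LFunctionResidueClassAux (a := (1 : ZMod 1)) (by simp) hs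
  have h2 : (fun n : ℕ => ((vonMangoldt.residueClass (1 : ZMod 1) n : ℝ) : ℂ))
      = fun n : ℕ => ((vonMangoldt n : ℝ) : ℂ) := by
    funext n
    congr 1
    rw [vonMangoldt.residueClass, Set.indicator_of_mem]
    exact Subsingleton.elim _ _
  have h3 : Z s = LSeries 1 s - 1 / (s - 1) := by
    rw [LSeries_one_eq_riemannZeta hs]
    exact Function.update_of_ne hs1 _ _
  have h4 : vonMangoldt.LFunctionResidueClassAux (1 : ZMod 1) s - Z s =
      LSeries (fun n : ℕ => ((vonMangoldt n : ℝ) : ℂ)) s - LSeries 1 s := by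
    rw [h1, h3, h2]
    simp
  change HasSum _ (vonMangoldt.LFunctionResidueClassAux (1 : ZMod 1) s - Z s)
  rw [h4]
  have hv := LSeriesSummable_vonMangoldt hs
  have ho := LSeriesSummable_one_iff.mpr hs
  have := hv.LSeriesHasSum.sub ho.LSeriesHasSum
  have hf : (fun n : ℕ => ((vonMangoldt n - 1 : ℝ) : ℂ)) =
      (fun n : ℕ => ((vonMangoldt n : ℝ) : ℂ)) - 1 := by
    funext n; simp
  rw [hf]
  exact this

end Primes
end ESEC
namespace ESEC
section Kernel
open Filter Topology MeasureTheory

/-- the Fejer kernel on the half line -/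
noncomputable def Ker (T u : ℝ) : ℝ := ∫ t in (0:ℝ)..T, (1 - t / T) * Real.cos (t * u)

lemma Ker_eq (T u : ℝ) (hT : 0 < T) (hu : u ≠ 0) :
    Ker T u = (1 - Real.cos (T * u)) / (T * u ^ 2) := by
  have hd : ∀ t ∈ Set.uIcc 0 T, HasDerivAt
      (fun t => (1 - t / T) * (Real.sin (t * u) / u) - Real.cos (t * u) / (T * u ^ 2))
      ((1 - t / T) * Real.cos (t * u)) t := by
    intro t _
    have h1 : HasDerivAt (fun t : ℝ => t * u) u t := by
      simpa using (hasDerivAt_id t).mul_const u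
    have h2 := (h1.sin).div_const u
    have h3 := (h1.cos).div_const (T * u ^ 2)
    have h4 : HasDerivAt (fun t : ℝ => 1 - t / T) (-(1 / T)) t := by
      simpa using ((hasDerivAt_id t).div_const T).const_sub 1
    refine ((h4.mul h2).sub h3).congr_deriv ?_
    field_simp
    ring
  have hi : IntervalIntegrable (fun t => (1 - t / T) * Real.cos (t * u)) volume 0 T :=
    Continuous.intervalIntegrable (by fun_prop) _ _
  rw [Ker, intervalIntegral.integral_eq_sub_of_hasDerivAt hd hi]
  field_simp
  simp
  ring

lemma int_lin (T : ℝ) (hT : 0 < T) : ∫ t in (0:ℝ)..T, (1 - t / T) = T / 2 := by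
  rw [intervalIntegral.integral_sub (by simp) (Continuous.intervalIntegrable (by fun_prop) _ _)]
  rw [intervalIntegral.integral_div, integral_id]
  simp
  field_simp
  ring

lemma Ker_le (T u : ℝ) (hT : 0 < T) : Ker T u ≤ T / 2 := by
  rw [← int_lin T hT, Ker]
  apply intervalIntegral.integral_mono_on hT.le
    (Continuous.intervalIntegrable (by fun_prop) _ _)
    (Continuous.intervalIntegrable (by fun_prop) _ _)
  intro t ht
  have : 0 ≤ 1 - t / T := by
    rw [sub_nonneg, div_le_one hT]; exact ht.2
  exact mul_le_of_le_one_right this (Real.cos_le_one _)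

lemma Ker_ge (T u : ℝ) (hT : 0 < T) (hu : |u| ≤ 1 / T) : T / 4 ≤ Ker T u := by
  have : ∫ t in (0:ℝ)..T, (1 - t / T) * (1 / 2) = T / 4 := by
    rw [intervalIntegral.integral_mul_const, int_lin T hT]; ring
  rw [← this, Ker]
  apply intervalIntegral.integral_mono_on hT.le
    (Continuous.intervalIntegrable (by fun_prop) _ _)
    (Continuous.intervalIntegrable (by fun_prop) _ _)
  intro t ht
  have h1 : 0 ≤ 1 - t / T := by
    rw [sub_nonneg, div_le_one hT]; exact ht.2
  apply mul_le_mul_of_nonneg_left _ h1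
  have h2 := Real.one_sub_sq_div_two_le_cos (x := t * u)
  have h3 : |t * u| ≤ 1 := by
    rw [abs_mul, abs_of_nonneg ht.1]
    calc t * |u| ≤ T * (1 / T) := mul_le_mul ht.2 hu (abs_nonneg _) hT.le
      _ = 1 := by field_simp
  have h4 : (t * u) ^ 2 ≤ 1 := by
    rw [← sq_abs]; exact pow_le_one₀ (abs_nonneg _) h3
  linarith

lemma Ker_nonneg (T u : ℝ) (hT : 0 < T) : 0 ≤ Ker T u := by
  by_cases hu : u = 0
  · subst hu
    exact le_trans (by positivity) (Ker_ge T 0 hT (by simp; positivity))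
  · rw [Ker_eq T u hT hu]
    have := Real.cos_le_one (T * u)
    apply div_nonneg (by linarith) (by positivity)

lemma Ker_far (T u : ℝ) (hT : 0 < T) (hu : u ≠ 0) : Ker T u ≤ 2 / (T * u ^ 2) := by
  rw [Ker_eq T u hT hu]
  have := Real.neg_one_le_cos (T * u)
  gcongr
  linarith

end Kernel
end ESEC
namespace ESEC
section Tauber
open ArithmeticFunction Filter Topology MeasureTheory

lemma term_norm (a : ℕ → ℂ) (σ t : ℝ) (n : ℕ) :
    ‖LSeries.term a ((σ : ℂ) + t * Complex.I) n‖ = ‖LSeries.term a (σ : ℂ) n‖ := by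
  rw [LSeries.norm_term_eq, LSeries.norm_term_eq]
  simp

lemma term_re (σ t y w : ℝ) (hσ : 0 < σ) (n : ℕ) (a : ℕ → ℝ) :
    ((w : ℂ) * Complex.exp (t * y * Complex.I) *
      LSeries.term (fun n => ((a n : ℝ) : ℂ)) ((σ : ℂ) + t * Complex.I) n).re
      = a n * (n : ℝ) ^ (-σ) * (w * Real.cos (t * (y - Real.log n))) := by
  rcases Nat.eq_zero_or_pos n with rfl | hn
  · simp [Real.zero_rpow (neg_ne_zero.mpr hσ.ne')]
  have hn' : (0:ℝ) < n := by exact_mod_cast hn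
  have hnc : (n : ℂ) ≠ 0 := by exact_mod_cast hn.ne'
  rw [LSeries.term_of_ne_zero hn.ne', div_eq_mul_inv, ← Complex.cpow_neg,
    Complex.cpow_def_of_ne_zero hnc, ← Complex.natCast_log]
  have e1 : (w : ℂ) * Complex.exp (t * y * Complex.I) * ((a n : ℂ) *
      Complex.exp ((Real.log n : ℂ) * -((σ : ℂ) + t * Complex.I))) =
      ((a n * Real.exp (Real.log n * (-σ)) * w : ℝ) : ℂ) *
        Complex.exp (((t * (y - Real.log n) : ℝ) : ℂ) * Complex.I) := by
    have : Complex.exp (t * y * Complex.I) * Complex.exp ((Real.log n : ℂ) * -((σ : ℂ) + t * Complex.I))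
      = Complex.exp ((Real.log n * (-σ) : ℝ)) *
        Complex.exp (((t * (y - Real.log n) : ℝ) : ℂ) * Complex.I) := by
      rw [← Complex.exp_add, ← Complex.exp_add]
      congr 1
      push_cast
      ring
    push_cast at this ⊢
    linear_combination (w : ℂ) * (a n : ℂ) * this
  rw [e1, Complex.re_ofReal_mul, Complex.exp_ofReal_mul_I_re, Real.rpow_def_of_pos hn']
  ring

lemma term_cont (σ : ℝ) (n : ℕ) : Continuous fun t : ℝ =>
    LSeries.term (fun n => ((vonMangoldt n - 1 : ℝ) : ℂ)) ((σ : ℂ) + t * Complex.I) n := by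
  rcases Nat.eq_zero_or_pos n with rfl | hn
  · simpa using continuous_const
  have hnc : (n : ℂ) ≠ 0 := by exact_mod_cast hn.ne'
  simp only [LSeries.term_of_ne_zero hn.ne']
  refine Continuous.div continuous_const ?_ ?_
  · exact Continuous.const_cpow (by fun_prop) (Or.inl hnc)
  · intro t
    simp [Complex.cpow_eq_zero_iff, hn.ne']

lemma hasSum_Ker (Φ : ℂ → ℂ) (hc : ContinuousOn Φ {s | 1 ≤ s.re})
    (hΦ : ∀ s : ℂ, 1 < s.re →
      HasSum (fun n : ℕ => LSeries.term (fun n => ((vonMangoldt n - 1 : ℝ) : ℂ)) s n) (Φ s))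
    (σ T y : ℝ) (hσ : 1 < σ) (hT : 0 < T) :
    HasSum (fun n : ℕ => (vonMangoldt n - 1) * (n : ℝ) ^ (-σ) * Ker T (y - Real.log n))
      (∫ t in (0:ℝ)..T, (((1 - t / T : ℝ) : ℂ) * Complex.exp (t * y * Complex.I) *
        Φ ((σ : ℂ) + t * Complex.I))).re := by
  have hmain : HasSum (fun n : ℕ => ∫ t in (0:ℝ)..T,
      (((1 - t / T : ℝ) : ℂ) * Complex.exp (t * y * Complex.I) *
        LSeries.term (fun n => ((vonMangoldt n - 1 : ℝ) : ℂ)) ((σ : ℂ) + t * Complex.I) n))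
      (∫ t in (0:ℝ)..T, (((1 - t / T : ℝ) : ℂ) * Complex.exp (t * y * Complex.I) *
        Φ ((σ : ℂ) + t * Complex.I))) := by
    have hsum : Summable (fun n : ℕ =>
        ‖LSeries.term (fun n => ((vonMangoldt n - 1 : ℝ) : ℂ)) (σ : ℂ) n‖) :=
      (hΦ σ (by simpa using hσ)).summable.norm
    refine intervalIntegral.hasSum_integral_of_dominated_convergence
      (fun n _ => ‖LSeries.term (fun n => ((vonMangoldt n - 1 : ℝ) : ℂ)) (σ : ℂ) n‖)
      ?_ ?_ ?_ ?_ ?_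
    · intro n
      refine Continuous.aestronglyMeasurable ?_
      have := term_cont σ n
      fun_prop
    · intro n
      refine Eventually.of_forall fun t ht => ?_
      rw [Set.uIoc_of_le hT.le] at ht
      rw [norm_mul, norm_mul, term_norm]
      have h1 : ‖((1 - t / T : ℝ) : ℂ)‖ ≤ 1 := by
        rw [Complex.norm_real, Real.norm_eq_abs, abs_le]
        have := (div_le_one hT).mpr ht.2
        have := div_nonneg ht.1.le hT.le
        constructor <;> linarith
      have h2 : ‖Complex.exp (t * y * Complex.I)‖ = 1 := by
        have := Complex.norm_exp_ofReal_mul_I (t * y)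
        simpa using this
      rw [h2, mul_one]
      exact mul_le_of_le_one_left (norm_nonneg _) h1
    · exact Eventually.of_forall fun t _ => hsum
    · exact intervalIntegrable_const
    · refine Eventually.of_forall fun t _ => ?_
      exact (hΦ _ (by simpa using hσ)).mul_left _
  have h2 := Complex.hasSum_re hmain
  convert h2 using 1
  funext n
  have hcont : Continuous fun t : ℝ => (((1 - t / T : ℝ) : ℂ) * Complex.exp (t * y * Complex.I) *
        LSeries.term (fun n => ((vonMangoldt n - 1 : ℝ) : ℂ)) ((σ : ℂ) + t * Complex.I) n) := by
    have := term_cont σ n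
    fun_prop
  have h3 := Complex.reCLM.intervalIntegral_comp_comm
    (hcont.intervalIntegrable (μ := volume) (0:ℝ) T)
  simp only [Complex.reCLM_apply] at h3
  rw [← h3, Ker, ← intervalIntegral.integral_const_mul]
  congr 1
  funext t
  rw [term_re σ t y _ (by linarith) n]

lemma small_sum (T κ : ℝ) (hT : 0 < T) (hκ : 0 < κ) :
    ∀ᶠ y : ℝ in atTop, ∀ᶠ σ : ℝ in 𝓝[>] 1, ∃ s : ℝ,
      HasSum (fun n : ℕ => (vonMangoldt n - 1) * (n : ℝ) ^ (-σ) * Ker T (y - Real.log n)) s ∧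
      |s| < κ := by
  obtain ⟨Φ, hc, hΦ⟩ := exPhi
  let G : ℝ → ℝ → ℂ := fun σ t => Φ (((max σ 1 : ℝ) : ℂ) + t * Complex.I)
  have hG : Continuous (fun p : ℝ × ℝ => G p.1 p.2) := by
    have : Continuous (fun p : ℝ × ℝ => (((max p.1 1 : ℝ) : ℂ) + p.2 * Complex.I)) := by fun_prop
    exact hc.comp_continuous this (by intro p; simp)
  let J : ℝ → ℝ → ℂ := fun y σ => ∫ t in (0:ℝ)..T,
    (((1 - t / T : ℝ) : ℂ) * Complex.exp (t * y * Complex.I) * G σ t)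
  have hJ : ∀ y, Continuous (J y) := by
    intro y
    apply intervalIntegral.continuous_parametric_intervalIntegral_of_continuous'
    have : Continuous (fun p : ℝ × ℝ => ((1 - p.2 / T : ℝ) : ℂ) * Complex.exp (p.2 * y * Complex.I)) := by
      fun_prop
    exact this.mul hG
  have hRL : Tendsto (fun y => J y 1) atTop (𝓝 0) := by
    have h1 := Real.tendsto_integral_exp_smul_cocompact
      (Set.indicator (Set.Ioc 0 T) fun t : ℝ => ((1 - t / T : ℝ) : ℂ) * G 1 t)
    have h2 : Tendsto (fun y : ℝ => -y / (2 * Real.pi)) atTop (cocompact ℝ) := by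
      have : Tendsto (fun y : ℝ => -y / (2 * Real.pi)) atTop atBot :=
        (tendsto_neg_atTop_atBot).atBot_div_const (by positivity)
      exact this.mono_right atBot_le_cocompact
    refine (h1.comp h2).congr fun y => ?_
    simp only [Function.comp, J]
    rw [intervalIntegral.integral_of_le hT.le, ← integral_indicator measurableSet_Ioc]
    congr 1
    funext t
    by_cases ht : t ∈ Set.Ioc 0 T
    · rw [Set.indicator_of_mem ht, Set.indicator_of_mem ht, Circle.smul_def, Real.fourierChar_apply]
      have : ((2 * Real.pi * -(t * (-y / (2 * Real.pi))) : ℝ) : ℂ) * Complex.I =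
          t * y * Complex.I := by
        have : 2 * Real.pi * -(t * (-y / (2 * Real.pi))) = t * y := by
          field_simp
        rw [this]; push_cast; rfl
      rw [this, smul_eq_mul]
      ring
    · rw [Set.indicator_of_notMem ht, Set.indicator_of_notMem ht, smul_zero]
  filter_upwards [(hRL.norm).eventually_lt_const (by simpa using hκ)] with y hy
  have h3 : ∀ᶠ σ in 𝓝 (1:ℝ), ‖J y σ‖ < κ :=
    ((hJ y).norm.tendsto 1).eventually_lt_const hy
  filter_upwards [h3.filter_mono nhdsWithin_le_nhds, self_mem_nhdsWithin] with σ h4 hσ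
  refine ⟨(J y σ).re, ?_, lt_of_le_of_lt (Complex.abs_re_le_norm _) h4⟩
  have := hasSum_Ker Φ hc hΦ σ T y hσ hT
  simpa [J, G, max_eq_left (le_of_lt (show (1:ℝ) < σ from hσ))] using this

end Tauber
end ESEC
namespace ESEC
section Bounds
open ArithmeticFunction Filter Topology MeasureTheory

lemma lower_sum (T y σ : ℝ) (hT : 1 ≤ T) (hy : 4 * T ≤ Real.exp y) (hσ : 1 < σ)
    (hσy : y * (σ - 1) ≤ 1 / 2) :
    ∃ s : Finset ℕ, 1 / 32 ≤ ∑ n ∈ s, (n : ℝ) ^ (-σ) * Ker T (y - Real.log n) := by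
  have hT0 : 0 < T := by linarith
  refine ⟨Finset.Ioc ⌊Real.exp (y - 1 / T)⌋₊ ⌊Real.exp y⌋₊, ?_⟩
  have hterm : ∀ n ∈ Finset.Ioc ⌊Real.exp (y - 1 / T)⌋₊ ⌊Real.exp y⌋₊,
      Real.exp (-(y * σ)) * (T / 4) ≤ (n : ℝ) ^ (-σ) * Ker T (y - Real.log n) := by
    intro n hn
    rw [Finset.mem_Ioc] at hn
    have h1 : Real.exp (y - 1 / T) < n := (Nat.floor_lt (Real.exp_pos _).le).mp hn.1
    have h2 : (n : ℝ) ≤ Real.exp y := (Nat.le_floor_iff (Real.exp_pos _).le).mp hn.2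
    have hn0 : (0:ℝ) < n := lt_trans (Real.exp_pos _) h1
    have h3 : y - 1 / T < Real.log n := (Real.lt_log_iff_exp_lt hn0).mpr h1
    have h4 : Real.log n ≤ y := (Real.log_le_iff_le_exp hn0).mpr h2
    have h5 : Real.exp (-(y * σ)) ≤ (n : ℝ) ^ (-σ) := by
      rw [Real.rpow_def_of_pos hn0, Real.exp_le_exp]
      nlinarith
    refine mul_le_mul h5 (Ker_ge T _ hT0 ?_) (by positivity) (by positivity)
    rw [abs_le]; constructor <;> linarith
  have hcard := Finset.card_nsmul_le_sum _ _ _ hterm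
  rw [nsmul_eq_mul] at hcard
  refine le_trans ?_ hcard
  have hT1 : 0 < 1 / T := by positivity
  have hT2 : 1 / T ≤ 1 := by rw [div_le_one hT0]; exact hT
  have hle : ⌊Real.exp (y - 1 / T)⌋₊ ≤ ⌊Real.exp y⌋₊ := by
    apply Nat.floor_le_floor
    apply Real.exp_le_exp.mpr; linarith
  rw [Nat.card_Ioc, Nat.cast_sub hle]
  have f1 : Real.exp y - 1 < ⌊Real.exp y⌋₊ := Nat.sub_one_lt_floor _
  have f2 : (⌊Real.exp (y - 1 / T)⌋₊ : ℝ) ≤ Real.exp (y - 1 / T) :=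
    Nat.floor_le (Real.exp_pos _).le
  have f3 : Real.exp (y - 1 / T) ≤ Real.exp y * (1 - 1 / (2 * T)) := by
    rw [sub_eq_add_neg, Real.exp_add]
    apply mul_le_mul_of_nonneg_left _ (Real.exp_pos _).le
    have h1 : 1 + 1 / T ≤ Real.exp (1 / T) := by linarith [Real.add_one_le_exp (1 / T)]
    rw [Real.exp_neg]
    have h2 : (Real.exp (1 / T))⁻¹ ≤ (1 + 1 / T)⁻¹ := inv_anti₀ (by positivity) h1
    refine h2.trans ?_
    rw [inv_le_iff_one_le_mul₀ (by positivity)]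
    have : 1 / (2 * T) = (1 / T) / 2 := by field_simp
    rw [this]
    nlinarith
  have f4 : Real.exp y / (4 * T) ≤ (⌊Real.exp y⌋₊ : ℝ) - ⌊Real.exp (y - 1 / T)⌋₊ := by
    have h1 : 1 ≤ Real.exp y / (4 * T) := by
      rw [le_div_iff₀ (by positivity)]; linarith
    have h2 : Real.exp y * (1 - 1 / (2 * T)) = Real.exp y - 2 * (Real.exp y / (4 * T)) := by
      field_simp; ring
    linarith
  have f5 : 1 / 2 ≤ Real.exp y * Real.exp (-(y * σ)) := by
    rw [← Real.exp_add]
    have := Real.add_one_le_exp (y + -(y * σ))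
    nlinarith
  calc (1:ℝ) / 32 ≤ (Real.exp y * Real.exp (-(y * σ))) / 16 := by linarith
    _ = Real.exp y / (4 * T) * (Real.exp (-(y * σ)) * (T / 4)) := by field_simp; norm_num
    _ ≤ _ := mul_le_mul_of_nonneg_right f4 (by positivity)

lemma int_sum_bound : ∃ C : ℝ, 0 < C ∧ ∀ (y : ℝ) (s : Finset ℕ),
    ∑ j ∈ s, 1 / (1 + (y - j) ^ 2) ≤ C := by
  have hs : Summable (fun i : ℤ => 1 / (1 + (i : ℝ) ^ 2)) := by
    have h := Real.summable_one_div_int_pow (p := 2) |>.mpr (by norm_num)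
    refine Summable.of_norm_bounded_eventually h ?_
    have : {i : ℤ | ¬ ‖1 / (1 + (i : ℝ) ^ 2)‖ ≤ 1 / (i : ℝ) ^ 2} ⊆ {0} := by
      intro i hi
      by_contra hne
      apply hi
      have hi0 : (i : ℝ) ≠ 0 := by exact_mod_cast hne
      rw [Real.norm_of_nonneg (by positivity)]
      apply one_div_le_one_div_of_le (by positivity)
      linarith
    exact (Set.finite_singleton _).subset this
  refine ⟨3 * ∑' i : ℤ, 1 / (1 + (i : ℝ) ^ 2) + 1, ?_, ?_⟩
  · have : 0 ≤ ∑' i : ℤ, 1 / (1 + (i : ℝ) ^ 2) := tsum_nonneg (fun i => by positivity)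
    linarith
  intro y s
  have h1 : ∀ j ∈ s, 1 / (1 + (y - j) ^ 2) ≤ 3 * (1 / (1 + (((⌊y⌋ - j : ℤ)) : ℝ) ^ 2)) := by
    intro j _
    have a1 := Int.floor_le y
    have a2 := Int.lt_floor_add_one y
    push_cast
    rw [← div_eq_mul_one_div, div_le_div_iff₀ (by positivity) (by positivity)]
    have : ((⌊y⌋ : ℝ) - j) = (y - j) - (y - ⌊y⌋) := by ring
    rw [this]
    have b1 : 0 ≤ y - ⌊y⌋ := by linarith
    have b2 : y - ⌊y⌋ ≤ 1 := by linarith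
    nlinarith [sq_nonneg ((y - j) + (y - ⌊y⌋))]
  have h2 : ∑ j ∈ s, (1 / (1 + (((⌊y⌋ - j : ℤ)) : ℝ) ^ 2)) ≤ ∑' i : ℤ, 1 / (1 + (i : ℝ) ^ 2) := by
    have hinj : Function.Injective (fun j : ℕ => ⌊y⌋ - (j : ℤ)) := by
      intro a b hab
      simp at hab
      exact hab
    have := hs.sum_le_tsum (s.map ⟨_, hinj⟩) (fun i _ => by positivity)
    rw [Finset.sum_map] at this
    exact this
  calc _ ≤ _ := Finset.sum_le_sum h1
    _ ≤ _ := by rw [← Finset.mul_sum]; linarith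

lemma weighted_bound : ∃ C : ℝ, 0 < C ∧ ∀ (y : ℝ) (s : Finset ℕ),
    ∑ n ∈ s, vonMangoldt n / n * (1 / (1 + (y - Real.log n) ^ 2)) ≤ C := by
  obtain ⟨C1, hC1, hI⟩ := int_sum_bound
  obtain ⟨c, hc0, hc⟩ : ∃ c : ℝ, 0 < c ∧ ∀ x : ℝ, 0 ≤ x → Chebyshev.psi x ≤ c * x :=
    ⟨_, by positivity, fun x hx => Chebyshev.psi_le_const_mul_self hx⟩
  refine ⟨c * Real.exp 1 * 3 * C1, by positivity, ?_⟩
  intro y s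
  let g : ℕ → ℕ := fun n => ⌊Real.log n⌋₊
  have hfib := Finset.sum_fiberwise_of_maps_to (s := s) (t := s.image g) (g := g)
    (fun n hn => Finset.mem_image_of_mem g hn)
    (fun n => vonMangoldt n / n * (1 / (1 + (y - Real.log n) ^ 2)))
  rw [← hfib]
  have hblock : ∀ j ∈ s.image g, ∑ n ∈ s with g n = j,
      vonMangoldt n / n * (1 / (1 + (y - Real.log n) ^ 2)) ≤
      c * Real.exp 1 * 3 * (1 / (1 + (y - j) ^ 2)) := by
    intro j _
    have hpt : ∀ n ∈ s.filter (fun n => g n = j),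
        vonMangoldt n / n * (1 / (1 + (y - Real.log n) ^ 2)) ≤
        vonMangoldt n * (Real.exp (-j) * (3 * (1 / (1 + (y - j) ^ 2)))) := by
      intro n hn
      have hgn := (Finset.mem_filter.mp hn).2
      rcases Nat.eq_zero_or_pos n with rfl | hn0
      · simp
      have hnp : (0:ℝ) < n := by exact_mod_cast hn0
      have hlog : 0 ≤ Real.log n := Real.log_natCast_nonneg n
      have a1 : (j : ℝ) ≤ Real.log n := by rw [← hgn]; exact Nat.floor_le hlog
      have a2 : Real.log n < j + 1 := by rw [← hgn]; exact Nat.lt_floor_add_one _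
      rw [div_eq_mul_inv, mul_assoc]
      apply mul_le_mul_of_nonneg_left _ vonMangoldt_nonneg
      apply mul_le_mul _ _ (by positivity) (by positivity)
      · rw [Real.exp_neg]
        exact inv_anti₀ (Real.exp_pos _) ((Real.le_log_iff_exp_le hnp).mp a1)
      · rw [← div_eq_mul_one_div, div_le_div_iff₀ (by positivity) (by positivity)]
        have : y - j = (y - Real.log n) + (Real.log n - j) := by ring
        rw [this]
        have b1 : 0 ≤ Real.log n - j := by linarith
        have b2 : Real.log n - j ≤ 1 := by linarith
        nlinarith [sq_nonneg ((y - Real.log n) - (Real.log n - j))]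
    refine (Finset.sum_le_sum hpt).trans ?_
    rw [← Finset.sum_mul]
    have hpsi : ∑ n ∈ s with g n = j, vonMangoldt n ≤ c * Real.exp (j + 1) := by
      refine le_trans ?_ (hc _ (Real.exp_pos _).le)
      rw [Chebyshev.psi]
      have : ∑ n ∈ s with g n = j, vonMangoldt n = ∑ n ∈ (s.filter (fun n => g n = j)).filter (fun n => n ≠ 0), vonMangoldt n := by
        symm
        apply Finset.sum_filter_of_ne
        intro n _ hne h0
        subst h0
        simp at hne
      rw [this]
      apply Finset.sum_le_sum_of_subset_of_nonneg
      · intro n hn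
        simp only [Finset.mem_filter] at hn
        have hnp : (0:ℝ) < n := by exact_mod_cast Nat.pos_of_ne_zero hn.2
        rw [Finset.mem_Ioc]
        refine ⟨Nat.pos_of_ne_zero hn.2, Nat.le_floor ?_⟩
        rw [← Real.log_le_iff_le_exp hnp, ← hn.1.2]
        exact (Nat.lt_floor_add_one _).le
      · intro n _ _; exact vonMangoldt_nonneg
    refine (mul_le_mul_of_nonneg_right hpsi (by positivity)).trans (le_of_eq ?_)
    have : Real.exp (j + 1) * Real.exp (-j) = Real.exp 1 := by
      rw [← Real.exp_add]; congr 1; ring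
    linear_combination (c * (3 * (1 / (1 + (y - j) ^ 2)))) * this
  refine (Finset.sum_le_sum hblock).trans ?_
  rw [← Finset.mul_sum]
  exact mul_le_mul_of_nonneg_left (hI _ _) (by positivity)

end Bounds
end ESEC
namespace ESEC
section Gap
open ArithmeticFunction Filter Topology MeasureTheory

lemma near_bound (C ε x : ℝ) (hC : ∀ x : ℝ, Chebyshev.psi x - Chebyshev.theta x ≤ C * x.sqrt)
    (hε1 : ε < 1) (hx : 0 < x) (s : Finset ℕ)
    (hs : ∀ n ∈ s, (1 - ε) * x < n ∧ (n : ℝ) ≤ x ∧ ¬ n.Prime) :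
    ∑ n ∈ s, vonMangoldt n / n ≤ C / (1 - ε) / x.sqrt := by
  have hp : 0 < (1 - ε) * x := mul_pos (by linarith) hx
  have h1 : ∀ n ∈ s, vonMangoldt n / n ≤ vonMangoldt n * ((1 - ε) * x)⁻¹ := by
    intro n hn
    rw [div_eq_mul_inv]
    apply mul_le_mul_of_nonneg_left _ vonMangoldt_nonneg
    exact inv_anti₀ hp (hs n hn).1.le
  refine (Finset.sum_le_sum h1).trans ?_
  rw [← Finset.sum_mul]
  have h2 : ∑ n ∈ s, vonMangoldt n ≤ C * x.sqrt := by
    refine le_trans ?_ (hC x)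
    rw [Chebyshev.psi_sub_theta_eq_sum_not_prime]
    apply Finset.sum_le_sum_of_subset_of_nonneg
    · intro n hn
      obtain ⟨a, b, c⟩ := hs n hn
      rw [Finset.mem_filter, Finset.mem_Ioc]
      refine ⟨⟨?_, Nat.le_floor b⟩, c⟩
      exact_mod_cast hp.trans a
    · intro n _ _; exact vonMangoldt_nonneg
  refine (mul_le_mul_of_nonneg_right h2 (by positivity)).trans (le_of_eq ?_)
  have h3 : x.sqrt * x.sqrt = x := Real.mul_self_sqrt hx.le
  have h4 : 0 < x.sqrt := Real.sqrt_pos.mpr hx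
  have h5 : (1 - ε) ≠ 0 := by linarith
  nth_rewrite 2 [← h3]
  field_simp

lemma prime_gap (ε : ℝ) (hε : 0 < ε) (hε1 : ε < 1) : ∀ᶠ x : ℝ in Filter.atTop,
    ∃ p : ℕ, p.Prime ∧ (1 - ε) * x < p ∧ (p : ℝ) ≤ x := by
  obtain ⟨C0, hC0, hW⟩ := weighted_bound
  obtain ⟨C, hC⟩ := Chebyshev.psi_sub_theta_le_mul_sqrt
  have h1ε : 0 < 1 - ε := by linarith
  obtain ⟨η, hη, hηε⟩ : ∃ η : ℝ, 0 < η ∧ -(2 * η) = Real.log (1 - ε) :=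
    ⟨-Real.log (1 - ε) / 2, by linarith [Real.log_neg h1ε (by linarith)], by ring⟩
  obtain ⟨T, hT1, hT⟩ : ∃ T : ℝ, 1 ≤ T ∧ 2 / T * (1 + 1 / η ^ 2) * C0 ≤ 1 / 128 := by
    refine ⟨max 1 (256 * (1 + 1 / η ^ 2) * C0), le_max_left _ _, ?_⟩
    have h1 := le_max_right 1 (256 * (1 + 1 / η ^ 2) * C0)
    have h2 : (0:ℝ) < max 1 (256 * (1 + 1 / η ^ 2) * C0) := lt_of_lt_of_le one_pos (le_max_left _ _)
    rw [div_mul_eq_mul_div, div_mul_eq_mul_div, div_le_iff₀ h2]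
    linarith
  have hT0 : 0 < T := by linarith
  have hty : Tendsto (fun x : ℝ => Real.log x - η) atTop atTop :=
    tendsto_atTop_add_const_right _ _ Real.tendsto_log_atTop
  have e1 := hty.eventually (small_sum T (1 / 128) hT0 (by norm_num))
  have e2 := (Real.tendsto_exp_atTop.comp hty).eventually_ge_atTop (4 * T)
  have e3 : ∀ᶠ x : ℝ in atTop, T / 2 * (C / (1 - ε) / x.sqrt) < 1 / 128 := by
    have : Tendsto (fun x : ℝ => T / 2 * (C / (1 - ε) / x.sqrt)) atTop (𝓝 (T / 2 * 0)) :=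
      (Tendsto.const_div_atTop Real.tendsto_sqrt_atTop _).const_mul _
    exact this.eventually_lt_const (by norm_num)
  filter_upwards [e1, e2, e3, eventually_gt_atTop 0] with x e1 e2 e3 hx
  by_contra hno
  push Not at hno
  obtain ⟨y, hy⟩ : ∃ y, y = Real.log x - η := ⟨_, rfl⟩
  simp only [Function.comp] at e2
  rw [← hy] at e1 e2
  have e4 : ∀ᶠ σ : ℝ in 𝓝[>] 1, y * (σ - 1) < 1 / 2 := by
    have : Tendsto (fun σ : ℝ => y * (σ - 1)) (𝓝 1) (𝓝 (y * (1 - 1))) :=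
      Continuous.tendsto (by fun_prop) 1
    exact (this.eventually_lt_const (by norm_num)).filter_mono nhdsWithin_le_nhds
  obtain ⟨σ, ⟨S, hS, hSκ⟩, hσy, hσ⟩ := (e1.and (e4.and self_mem_nhdsWithin)).exists
  have hσ : 1 < σ := hσ
  have hsumB : Summable (fun n : ℕ => (n : ℝ) ^ (-σ) * Ker T (y - Real.log n)) := by
    have h := (Real.summable_nat_rpow (p := -σ)).mpr (by linarith)
    refine Summable.of_nonneg_of_le (fun n => mul_nonneg (by positivity) (Ker_nonneg T _ hT0))
      (fun n => mul_le_mul_of_nonneg_left (Ker_le T _ hT0) (by positivity)) (h.mul_right (T / 2))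
  obtain ⟨B, hB⟩ := hsumB
  have hBl : 1 / 32 ≤ B := by
    obtain ⟨s, hs⟩ := lower_sum T y σ hT1 e2 hσ hσy.le
    exact hs.trans (sum_le_hasSum s
      (fun n _ => mul_nonneg (by positivity) (Ker_nonneg T _ hT0)) hB)
  have hA := hS.add hB
  have hAl : S + B ≤ 1 / 128 + 1 / 128 := by
    refine hasSum_le_of_sum_le hA fun s => ?_
    have hpt : ∀ n ∈ s, (vonMangoldt n - 1) * (n : ℝ) ^ (-σ) * Ker T (y - Real.log n) +
        (n : ℝ) ^ (-σ) * Ker T (y - Real.log n) ≤ vonMangoldt n / n * Ker T (y - Real.log n) := by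
      intro n _
      have hk := Ker_nonneg T (y - Real.log n) hT0
      have : (vonMangoldt n - 1) * (n : ℝ) ^ (-σ) * Ker T (y - Real.log n) +
        (n : ℝ) ^ (-σ) * Ker T (y - Real.log n) =
        vonMangoldt n * (n : ℝ) ^ (-σ) * Ker T (y - Real.log n) := by ring
      rw [this, div_eq_mul_inv]
      apply mul_le_mul_of_nonneg_right _ hk
      apply mul_le_mul_of_nonneg_left _ vonMangoldt_nonneg
      rcases Nat.eq_zero_or_pos n with rfl | hn
      · simp [Real.zero_rpow (show -σ ≠ 0 by linarith)]
      · rw [← Real.rpow_neg_one]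
        exact Real.rpow_le_rpow_of_exponent_le (by exact_mod_cast hn) (by linarith)
    refine (Finset.sum_le_sum hpt).trans ?_
    rw [← Finset.sum_filter_add_sum_filter_not s (fun n : ℕ => n = 0 ∨ η ≤ |y - Real.log n|)]
    refine add_le_add ?_ ?_
    · refine le_trans ?_ hT
      have : ∀ n ∈ s.filter (fun n : ℕ => n = 0 ∨ η ≤ |y - Real.log n|),
          vonMangoldt n / n * Ker T (y - Real.log n) ≤
          2 / T * (1 + 1 / η ^ 2) * (vonMangoldt n / n * (1 / (1 + (y - Real.log n) ^ 2))) := by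
        intro n hn
        rcases (Finset.mem_filter.mp hn).2 with rfl | h
        · simp
        have hv : 0 ≤ vonMangoldt n / n := div_nonneg vonMangoldt_nonneg (by positivity)
        have hu : η ^ 2 ≤ (y - Real.log n) ^ 2 := by
          rw [← sq_abs (y - Real.log n)]
          exact pow_le_pow_left₀ hη.le h 2
        have hu0 : 0 < (y - Real.log n) ^ 2 := lt_of_lt_of_le (by positivity) hu
        have hne : y - Real.log n ≠ 0 := by
          intro h0; rw [h0] at hu0; simp at hu0
        have hK := Ker_far T _ hT0 hne
        rw [mul_left_comm]
        apply mul_le_mul_of_nonneg_left _ hv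
        refine hK.trans ?_
        have key : 1 / (y - Real.log n) ^ 2 ≤
            (1 + 1 / η ^ 2) * (1 / (1 + (y - Real.log n) ^ 2)) := by
          rw [← div_eq_mul_one_div, div_le_div_iff₀ hu0 (by positivity)]
          have : 1 ≤ 1 / η ^ 2 * (y - Real.log n) ^ 2 := by
            rw [div_mul_eq_mul_div, one_mul, le_div_iff₀ (by positivity)]; linarith
          linarith
        calc 2 / (T * (y - Real.log n) ^ 2) = 2 / T * (1 / (y - Real.log n) ^ 2) := by
              field_simp
          _ ≤ 2 / T * ((1 + 1 / η ^ 2) * (1 / (1 + (y - Real.log n) ^ 2))) :=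
              mul_le_mul_of_nonneg_left key (by positivity)
          _ = _ := by ring
      refine (Finset.sum_le_sum this).trans ?_
      rw [← Finset.mul_sum]
      exact mul_le_mul_of_nonneg_left (hW _ _) (by positivity)
    · refine le_trans ?_ e3.le
      have : ∀ n ∈ s.filter (fun n : ℕ => ¬ (n = 0 ∨ η ≤ |y - Real.log n|)),
          vonMangoldt n / n * Ker T (y - Real.log n) ≤ T / 2 * (vonMangoldt n / n) := by
        intro n _
        have hv : 0 ≤ vonMangoldt n / n := div_nonneg vonMangoldt_nonneg (by positivity)
        rw [mul_comm (T / 2)]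
        exact mul_le_mul_of_nonneg_left (Ker_le T _ hT0) hv
      refine (Finset.sum_le_sum this).trans ?_
      rw [← Finset.mul_sum]
      apply mul_le_mul_of_nonneg_left _ (by positivity)
      apply near_bound C ε x hC hε1 hx
      intro n hn
      have h := (Finset.mem_filter.mp hn).2
      push Not at h
      have hn0 : (0:ℝ) < n := by exact_mod_cast Nat.pos_of_ne_zero h.1
      have h2 := abs_lt.mp h.2
      have b1 : (1 - ε) * x < n := by
        rw [← Real.log_lt_log_iff (mul_pos h1ε hx) hn0, Real.log_mul h1ε.ne' hx.ne', ← hηε]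
        linarith
      have b2 : (n : ℝ) ≤ x := by
        rw [← Real.log_le_log_iff hn0 hx]
        linarith
      refine ⟨b1, b2, fun hp => ?_⟩
      exact absurd b2 (not_le.mpr (hno n hp b1))
  have := (abs_lt.mp hSκ).1
  linarith

end Gap
end ESEC
namespace ESEC

lemma col_no_odd {V : Type*} {G : SimpleGraph V} (hG : G.Colorable 2) {k : ℕ} (hk : Odd k) :
    ¬ HasCycleLength G k := by
  rintro ⟨v, w, -, rfl⟩
  have := SimpleGraph.two_colorable_iff_forall_loop_even.mp hG v w
  exact (Nat.not_even_iff_odd.mpr hk) this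

lemma z_le_ex (n ℓ k : ℕ) (hk : Odd k) : zZar n ℓ ≤ exTuran n ℓ k := by
  apply csSup_le'
  rintro e ⟨G, h1, h2, rfl⟩
  apply le_csSup
  · refine ⟨(Set.univ : Set (Sym2 (Fin n))).ncard, ?_⟩
    rintro e ⟨G, -, -, rfl⟩
    exact Set.ncard_le_ncard (Set.subset_univ _) (Set.toFinite _)
  · exact ⟨G, h1, col_no_odd h2 hk, rfl⟩

lemma ratio_upper (ℓ k : ℕ) (hℓ : ℓ = 2 ∨ ℓ = 3 ∨ ℓ = 5) (hk2 : 2 * ℓ < k)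
    (ε : ℝ) (hε : 0 < ε) (hε1 : ε < 1) : ∀ᶠ n : ℕ in Filter.atTop,
    0 < zZar n ℓ ∧ (exTuran n ℓ k : ℝ) / (zZar n ℓ : ℝ) ≤ (1 + ε) / (1 - ε) ^ (ℓ + 1) := by
  have hl2 : 2 ≤ ℓ := by omega
  have hl0 : (0 : ℝ) < ℓ := by positivity
  have hX : Filter.Tendsto (fun n : ℕ => ((n : ℝ) / 2) ^ (1 / ℓ : ℝ)) Filter.atTop Filter.atTop :=
    (tendsto_rpow_atTop (by positivity)).comp
      (tendsto_natCast_atTop_atTop.atTop_div_const (by norm_num))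
  filter_upwards [ex_upper ℓ k hl2 hk2 ε hε, hX.eventually (prime_gap ε hε hε1),
    hX.eventually_ge_atTop (3 / (1 - ε)), Filter.eventually_ge_atTop 1] with n h1 h2 h3 hn
  obtain ⟨p, hp, hp1, hp2⟩ := h2
  have hn0 : (0 : ℝ) < n := by exact_mod_cast hn
  set X := ((n : ℝ) / 2) ^ (1 / ℓ : ℝ) with hXd
  have hX0 : 0 < X := by positivity
  have hXl : X ^ ℓ = (n : ℝ) / 2 := by
    rw [hXd, ← Real.rpow_natCast, ← Real.rpow_mul (by positivity), one_div_mul_cancel hl0.ne',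
      Real.rpow_one]
  have h1e : 0 < 1 - ε := by linarith
  have hp3 : 2 < p := by
    have : (3 : ℝ) < p := by
      rw [div_le_iff₀ h1e] at h3
      linarith
    have : 3 < p := by exact_mod_cast this
    omega
  have hpn : 2 * p ^ ℓ ≤ n := by
    have : (p : ℝ) ^ ℓ ≤ X ^ ℓ := by gcongr
    rw [hXl] at this
    have : 2 * (p : ℝ) ^ ℓ ≤ n := by linarith
    exact_mod_cast this
  have hz := z_lower ℓ n p hℓ hp hp3 hpn
  have hppos : 0 < p ^ (ℓ + 1) := by positivity
  refine ⟨by omega, ?_⟩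
  have hzR : ((1 - ε) * X) ^ (ℓ + 1) ≤ (zZar n ℓ : ℝ) := by
    calc ((1 - ε) * X) ^ (ℓ + 1) ≤ (p : ℝ) ^ (ℓ + 1) := by gcongr
      _ ≤ _ := by exact_mod_cast hz
  have hq : 0 < ((1 - ε) * X) ^ (ℓ + 1) := by positivity
  calc (exTuran n ℓ k : ℝ) / (zZar n ℓ : ℝ)
      ≤ ((1 + ε) * ((n / 2 : ℝ) * X)) / ((1 - ε) * X) ^ (ℓ + 1) := by gcongr
    _ = (1 + ε) / (1 - ε) ^ (ℓ + 1) := by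
      rw [← hXl, mul_pow, pow_succ X]
      field_simp

end ESEC

theorem erdos_simonovits_even_cycles (ℓ k : ℕ) (hℓ : ℓ = 2 ∨ ℓ = 3 ∨ ℓ = 5)
    (hk : Odd k) (hk2 : 2 * ℓ < k) :
    Filter.Tendsto (fun n : ℕ => (exTuran n ℓ k : ℝ) / (zZar n ℓ : ℝ))
      Filter.atTop (nhds 1) := by
  rw [Metric.tendsto_nhds]
  intro η hη
  have hc : Filter.Tendsto (fun ε : ℝ => (1 + ε) / (1 - ε) ^ (ℓ + 1)) (nhds 0) (nhds 1) := by
    have : ContinuousAt (fun ε : ℝ => (1 + ε) / (1 - ε) ^ (ℓ + 1)) 0 := by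
      apply ContinuousAt.div (by fun_prop) (by fun_prop)
      simp
    simpa [ContinuousAt] using this
  have h1 : ∀ᶠ ε : ℝ in nhds 0, (1 + ε) / (1 - ε) ^ (ℓ + 1) < 1 + η :=
    hc.eventually_lt_const (by linarith)
  obtain ⟨ε, hε, hε0, hε1⟩ : ∃ ε : ℝ, (1 + ε) / (1 - ε) ^ (ℓ + 1) < 1 + η ∧ 0 < ε ∧ ε < 1 := by
    have h2 : ∀ᶠ ε : ℝ in nhdsWithin 0 (Set.Ioi 0), (1 + ε) / (1 - ε) ^ (ℓ + 1) < 1 + η :=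
      h1.filter_mono nhdsWithin_le_nhds
    have h3 : ∀ᶠ ε : ℝ in nhdsWithin 0 (Set.Ioi 0), ε ∈ Set.Ioo (0 : ℝ) 1 :=
      Ioo_mem_nhdsGT (by norm_num)
    obtain ⟨ε, h4, h5⟩ := (h2.and h3).exists
    exact ⟨ε, h4, h5.1, h5.2⟩
  filter_upwards [ESEC.ratio_upper ℓ k hℓ hk2 ε hε0 hε1] with n hn
  have hz : (0 : ℝ) < zZar n ℓ := by exact_mod_cast hn.1
  have hle : (1 : ℝ) ≤ (exTuran n ℓ k : ℝ) / (zZar n ℓ : ℝ) := by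
    rw [le_div_iff₀ hz, one_mul]
    exact_mod_cast ESEC.z_le_ex n ℓ k hk
  rw [Real.dist_eq, abs_of_nonneg (by linarith)]
  linarith [hn.2]
end

section
/- Let ℓ ∈ {2, 3, 5}, let k > 2ℓ be an odd integer, and let c₁, c₂, ε > 0 be real numbers. There exists N such that for every n ≥ N the following holds: if G is a graph on n vertices containing no cycle of length 2m for any 2 ≤ m ≤ ℓ and no cycle of length k, and the average degree d = 2e(G)/n satisfies c₁ n^{1/ℓ} ≤ d ≤ c₂ n^{1/ℓ}, then G has a bipartite subgraph H with e(H) ≥ d^{ℓ+1} − ε n^{1+1/ℓ}. -/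
open SimpleGraph

/-- `u` lies at distance exactly `j` from `v`. -/
def IsLv {V : Type*} (G : SimpleGraph V) (v : V) (j : ℕ) (u : V) : Prop :=
  G.Reachable v u ∧ G.dist v u = j

section levels
variable {V : Type*} {G : SimpleGraph V} {v : V}

lemma IsLv.unique {i j : ℕ} {u : V} (h : IsLv G v i u) (h' : IsLv G v j u) : i = j :=
  h.2.symm.trans h'.2

lemma isLv_zero {u : V} : IsLv G v 0 u ↔ u = v := by
  constructor
  · rintro ⟨h, h0⟩
    exact ((h.dist_eq_zero_iff).1 h0).symm
  · rintro rfl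
    exact ⟨Reachable.refl _, by simp⟩

lemma IsLv.adj {j : ℕ} {u w : V} (h : IsLv G v j u) (hw : G.Adj u w) :
    ∃ i, IsLv G v i w ∧ i ≤ j + 1 ∧ j ≤ i + 1 := by
  have hr : G.Reachable v w := h.1.trans hw.reachable
  refine ⟨G.dist v w, ⟨hr, rfl⟩, ?_, ?_⟩
  · have := h.1.dist_triangle_left w
    rw [dist_eq_one_iff_adj.2 hw, h.2] at this
    exact this
  · have := hr.dist_triangle_left u
    rw [dist_eq_one_iff_adj.2 hw.symm, h.2] at this
    exact this

lemma IsLv.pred {j : ℕ} {u : V} (h : IsLv G v (j + 1) u) :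
    ∃ w, G.Adj u w ∧ IsLv G v j w := by
  obtain ⟨p, hp⟩ := h.1.symm.exists_walk_length_eq_dist
  rw [dist_comm, h.2] at hp
  cases p with
  | nil => simp at hp
  | cons hadj q =>
    rename_i w
    refine ⟨w, hadj, ?_⟩
    obtain ⟨i, hi, h1, h2⟩ := h.adj hadj
    have h3 := dist_le q
    rw [dist_comm, hi.2] at h3
    simp at hp
    have : i = j := by omega
    exact this ▸ hi

open Classical in
/-- a neighbour one level closer to `v` -/
noncomputable def par (G : SimpleGraph V) (v u : V) : V :=
  if h : ∃ w, G.Adj u w ∧ ∃ j, IsLv G v (j + 1) u ∧ IsLv G v j w then h.choose else u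

lemma par_spec {j : ℕ} {u : V} (h : IsLv G v (j + 1) u) :
    G.Adj u (par G v u) ∧ IsLv G v j (par G v u) := by
  have h' : ∃ w, G.Adj u w ∧ ∃ j, IsLv G v (j + 1) u ∧ IsLv G v j w := by
    obtain ⟨w, h1, h2⟩ := h.pred
    exact ⟨w, h1, j, h, h2⟩
  rw [par, dif_pos h']
  obtain ⟨h1, i, h2, h3⟩ := h'.choose_spec
  have : i = j := by have := h2.unique h; omega
  subst this
  exact ⟨h1, h3⟩

lemma par_iter {i : ℕ} : ∀ {j : ℕ} {u : V}, IsLv G v (i + j) u →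
    IsLv G v j ((par G v)^[i] u) := by
  induction i with
  | zero => intro j u h; simpa using h
  | succ i ih =>
    intro j u h
    rw [Function.iterate_succ_apply]
    apply ih
    exact (par_spec (by rw [show i + 1 + j = (i + j) + 1 by ring] at h; exact h)).2

/-- Two vertices on the same level whose ancestors first meet after `i + 1` steps, and a path
between them that does not use lower levels, give a cycle. -/
lemma cycle_of_path (i : ℕ) : ∀ {j m : ℕ} {x z : V} (p : G.Walk x z), p.IsPath → p.length = m →
    IsLv G v (i + 1 + j) x → IsLv G v (i + 1 + j) z →
    (∀ y ∈ p.support, ∀ t, IsLv G v t y → i + 1 + j ≤ t) →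
    (par G v)^[i] x ≠ (par G v)^[i] z → (par G v)^[i + 1] x = (par G v)^[i + 1] z →
    HasCycleLength G (2 * (i + 1) + m) := by
  induction i with
  | zero =>
    intro j m x z p hp hm hx hz hl hne heq
    rw [show 0 + 1 + j = j + 1 by ring] at hx hz
    simp at hne heq
    obtain ⟨ax, lx⟩ := par_spec hx
    obtain ⟨az, lz⟩ := par_spec hz
    have hnot : par G v x ∉ p.support := fun h => by
      have := hl _ h _ lx
      omega
    rw [← heq] at az
    refine ⟨par G v x, Walk.cons ax.symm (p.concat az), ?_, by simp; omega⟩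
    rw [Walk.cons_isCycle_iff]
    refine ⟨hp.concat hnot az, ?_⟩
    rw [Walk.edges_concat]
    simp only [List.concat_eq_append, List.mem_append, List.mem_singleton, not_or]
    constructor
    · intro h
      exact hnot (Walk.fst_mem_support_of_mem_edges _ h)
    · intro h
      rw [Sym2.eq_iff] at h
      rcases h with ⟨h1, h2⟩ | ⟨h1, h2⟩
      · exact ax.ne h2
      · exact hne h2
  | succ i ih =>
    intro j m x z p hp hm hx hz hl hne heq
    rw [show i + 1 + 1 + j = (i + 1 + j) + 1 by ring] at hx hz
    obtain ⟨ax, lx⟩ := par_spec hx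
    obtain ⟨az, lz⟩ := par_spec hz
    have hnx : par G v x ∉ p.support := fun h => by
      have := hl _ h _ lx
      omega
    have hnz : par G v z ∉ p.support := fun h => by
      have := hl _ h _ lz
      omega
    have hne' : par G v x ≠ par G v z := by
      intro h
      apply hne
      rw [Function.iterate_succ_apply, Function.iterate_succ_apply, h]
    have := ih (j := j) (m := m + 2) (Walk.cons ax.symm (p.concat az)) ?_ (by simp; omega) lx lz
      ?_ (by simpa using hne) (by simpa using heq)
    · convert this using 1
      ring
    · rw [Walk.cons_isPath_iff]
      refine ⟨hp.concat hnz az, ?_⟩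
      rw [Walk.support_concat]
      simp [hnx, hne']
    · intro y hy t ht
      rw [Walk.support_cons, Walk.support_concat] at hy
      simp at hy
      rcases hy with rfl | hy | rfl
      · exact (lx.unique ht).le
      · have := hl _ hy _ ht
        omega
      · exact (lz.unique ht).le

/-- Distinct vertices on the same level: the ancestors meet at some point. -/
lemma exists_meet {j : ℕ} {x z : V} (hx : IsLv G v j x) (hz : IsLv G v j z) (hne : x ≠ z) :
    ∃ i, i + 1 ≤ j ∧ (par G v)^[i] x ≠ (par G v)^[i] z ∧
      (par G v)^[i + 1] x = (par G v)^[i + 1] z := by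
  classical
  have hex : ∃ i, (par G v)^[i] x = (par G v)^[i] z := by
    refine ⟨j, ?_⟩
    rw [isLv_zero.1 (par_iter (j := 0) hx), isLv_zero.1 (par_iter (j := 0) hz)]
  have hj : Nat.find hex ≤ j := by
    apply Nat.find_min'
    rw [isLv_zero.1 (par_iter (j := 0) hx), isLv_zero.1 (par_iter (j := 0) hz)]
  have h0 : Nat.find hex ≠ 0 := by
    intro h
    have := Nat.find_spec hex
    rw [h] at this
    exact hne this
  obtain ⟨i, hi⟩ := Nat.exists_eq_succ_of_ne_zero h0
  refine ⟨i, by omega, Nat.find_min hex (by omega), ?_⟩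
  have := Nat.find_spec hex
  rwa [hi] at this

lemma common_nbr {ℓ j : ℕ} (hG : EvenCycleFree G ℓ) (hj : j + 1 ≤ ℓ) {x z y : V}
    (hx : IsLv G v j x) (hz : IsLv G v j z) (hxy : G.Adj x y) (hyz : G.Adj y z)
    (hy : ∀ t, IsLv G v t y → j ≤ t) : x = z := by
  by_contra hne
  obtain ⟨i, hi, h1, h2⟩ := exists_meet hx hz hne
  obtain ⟨r, rfl⟩ := Nat.exists_eq_add_of_le hi
  have := cycle_of_path (m := 2) i (j := r) (Walk.cons hxy (Walk.cons hyz Walk.nil)) ?_ rfl hx hz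
    ?_ h1 h2
  · exact hG (i + 2) (by omega) (by omega) (by convert this using 1; ring)
  · simp [Walk.cons_isPath_iff, hxy.ne, hyz.ne, hne]
  · intro w hw t ht
    simp at hw
    rcases hw with rfl | rfl | rfl
    · exact (hx.unique ht).le
    · exact hy t ht
    · exact (hz.unique ht).le

/-- predecessors are unique -/
lemma pred_unique {ℓ j : ℕ} (hG : EvenCycleFree G ℓ) (hj : j + 1 ≤ ℓ) {x z y : V}
    (hy : IsLv G v (j + 1) y)
    (hx : IsLv G v j x) (hz : IsLv G v j z) (hxy : G.Adj x y) (hyz : G.Adj y z) : x = z :=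
  common_nbr hG hj hx hz hxy hyz (fun t ht => by have := hy.unique ht; omega)

lemma card_bad {ℓ j : ℕ} [Fintype V] [DecidableEq V] (hG : EvenCycleFree G ℓ) (hj : j + 1 ≤ ℓ)
    {u : V} (hu : IsLv G v j u) (s : Finset V)
    (hs : ∀ w ∈ s, G.Adj u w ∧ ¬ IsLv G v (j + 1) w) : s.card ≤ 2 := by
  classical
  have h1 : (s.filter (fun w => IsLv G v j w)).card ≤ 1 := by
    rw [Finset.card_le_one]
    intro a ha b hb
    rw [Finset.mem_filter] at ha hb
    exact common_nbr hG hj ha.2 hb.2 (hs a ha.1).1.symm (hs b hb.1).1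
      (fun t ht => (hu.unique ht).le)
  have h2 : (s.filter (fun w => ¬ IsLv G v j w)).card ≤ 1 := by
    rw [Finset.card_le_one]
    intro a ha b hb
    rw [Finset.mem_filter] at ha hb
    obtain ⟨i, hi, hi1, hi2⟩ := hu.adj (hs a ha.1).1
    obtain ⟨i', hi', hi1', hi2'⟩ := hu.adj (hs b hb.1).1
    have e1 : i ≠ j := by rintro rfl; exact ha.2 hi
    have e2 : i' ≠ j := by rintro rfl; exact hb.2 hi'
    have e3 : i ≠ j + 1 := by rintro rfl; exact (hs a ha.1).2 hi
    have e4 : i' ≠ j + 1 := by rintro rfl; exact (hs b hb.1).2 hi'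
    obtain rfl : i' = i := by omega
    obtain rfl : j = i' + 1 := by omega
    exact pred_unique hG (by omega) hu hi hi' (hs a ha.1).1.symm (hs b hb.1).1
  have := Finset.card_filter_add_card_filter_not (s := s) (fun w => IsLv G v j w)
  omega

end levels

section paths
variable {V : Type*} [Fintype V] [DecidableEq V] {G : SimpleGraph V} [DecidableRel G.Adj]

/-- sets without a dense subset have few edges -/
lemma sparse_of_no_dense (D : ℕ) (U : Finset V)
    (h : ∀ W ⊆ U, W.Nonempty → ∃ x ∈ W, (W.filter (fun y => G.Adj x y)).card ≤ D) :
    ∑ x ∈ U, (U.filter (fun y => G.Adj x y)).card ≤ 2 * D * U.card := by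
  induction hn : U.card generalizing U with
  | zero =>
    rw [Finset.card_eq_zero] at hn
    simp [hn]
  | succ n ih =>
    have hne : U.Nonempty := by
      rw [← Finset.card_pos]; omega
    obtain ⟨x, hx, hd⟩ := h U subset_rfl hne
    have hc : (U.erase x).card = n := by rw [Finset.card_erase_of_mem hx]; omega
    have ih' := ih (U.erase x)
      (fun W hW => h W (hW.trans (Finset.erase_subset _ _))) hc
    rw [← Finset.add_sum_erase _ _ hx]
    have key : ∀ y ∈ U.erase x, (U.filter (fun z => G.Adj y z)).card =
        ((U.erase x).filter (fun z => G.Adj y z)).card + (if G.Adj y x then 1 else 0) := by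
      intro y hy
      rw [Finset.card_filter, Finset.card_filter, ← Finset.add_sum_erase _ _ hx, add_comm]
    rw [Finset.sum_congr rfl key, Finset.sum_add_distrib]
    have h2 : ∑ y ∈ U.erase x, (if G.Adj y x then 1 else 0)
        ≤ (U.filter (fun y => G.Adj x y)).card := by
      rw [← Finset.card_filter]
      apply Finset.card_le_card
      intro y hy
      rw [Finset.mem_filter] at hy ⊢
      exact ⟨Finset.mem_of_mem_erase hy.1, hy.2.symm⟩
    have : 2 * D * (n + 1) = 2 * D * n + 2 * D := by ring
    omega

lemma greedy_path {D : ℕ} {U : Finset V}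
    (hU : ∀ x ∈ U, D < (U.filter (fun y => G.Adj x y)).card) (r : ℕ) :
    ∀ (y : V) (B : Finset V), y ∈ U → y ∉ B → B.card + r ≤ D →
      ∃ (z : V) (p : G.Walk y z), p.IsPath ∧ p.length = r ∧
        (∀ a ∈ p.support, a ∈ U ∧ a ∉ B) := by
  induction r with
  | zero =>
    intro y B hy hB _
    exact ⟨y, Walk.nil, by simp, rfl, by simp [hy, hB]⟩
  | succ r ih =>
    intro y B hy hB hc
    have hlt : (insert y B).card < (U.filter (fun z => G.Adj y z)).card := by
      have := hU y hy
      have := Finset.card_insert_le y B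
      omega
    obtain ⟨y', h1, h2⟩ := Finset.exists_mem_notMem_of_card_lt_card hlt
    rw [Finset.mem_filter] at h1
    obtain ⟨z, p, hp, hl, hs⟩ := ih y' (insert y B) h1.1 h2 (by
      have := Finset.card_insert_le y B
      omega)
    refine ⟨z, Walk.cons h1.2 p, ?_, by simp [hl], ?_⟩
    · rw [Walk.cons_isPath_iff]
      refine ⟨hp, fun h => (hs y h).2 (Finset.mem_insert_self _ _)⟩
    · intro a ha
      rw [Walk.support_cons, List.mem_cons] at ha
      rcases ha with rfl | ha
      · exact ⟨hy, hB⟩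
      · exact ⟨(hs a ha).1, fun h => (hs a ha).2 (Finset.mem_insert_of_mem h)⟩

lemma color_walk {α : Type*} {U : Finset V} {c : V → α}
    (h2 : ∀ x ∈ U, ∀ y ∈ U, ∀ x' ∈ U, G.Adj x y → G.Adj y x' → c x = c x') {y z : V}
    (p : G.Walk y z) : (∀ a ∈ p.support, a ∈ U) →
      (Even p.length → c y = c z) ∧
        (Odd p.length → ∀ t ∈ U, G.Adj t y → c t = c z) := by
  induction p with
  | nil => intro _; simp
  | cons hadj q ih =>
    intro hs
    rename_i a b e
    have hq : ∀ a ∈ q.support, a ∈ U := fun x hx => hs x (by simp [hx])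
    have ha : a ∈ U := hs a (by simp)
    have hb : b ∈ U := hq b (by simp)
    obtain ⟨i1, i2⟩ := ih hq
    constructor
    · intro he
      rw [Walk.length_cons, Nat.even_add_one, Nat.not_even_iff_odd] at he
      exact i2 he a ha hadj
    · intro ho t ht hta
      rw [Walk.length_cons, Nat.odd_add_one, Nat.not_odd_iff_even] at ho
      rw [← i1 ho]
      exact h2 t ht a ha b hb hta hadj

lemma color_adj {α : Type*} {D m : ℕ} {U : Finset V} {c : V → α}
    (hU : ∀ x ∈ U, D < (U.filter (fun y => G.Adj x y)).card) (hm : Odd m) (hD : m + 1 ≤ D)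
    (hc : ∀ x z (p : G.Walk x z), p.IsPath → p.length = m → (∀ a ∈ p.support, a ∈ U) →
      c x = c z) : ∀ x ∈ U, ∀ y ∈ U, G.Adj x y → c x = c y := by
  obtain ⟨r, rfl⟩ := hm
  have step : ∀ x ∈ U, ∀ y ∈ U, ∀ x' ∈ U, G.Adj x y → G.Adj y x' → 
      ∃ (z : V) (p : G.Walk y z), p.length = 2 * r ∧ (∀ a ∈ p.support, a ∈ U) ∧
        c x = c z ∧ c x' = c z := by
    intro x hx y hy x' hx' hxy hyx'
    obtain ⟨z, p, hp, hl, hs⟩ := greedy_path hU (2 * r) y {x, x'} hy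
      (by simp [hxy.ne', hyx'.ne]) (by
        have := Finset.card_le_two (a := x) (b := x')
        omega)
    refine ⟨z, p, hl, fun a ha => (hs a ha).1, ?_, ?_⟩
    · refine hc x z (Walk.cons hxy p) ?_ (by simp [hl]) ?_
      · rw [Walk.cons_isPath_iff]
        exact ⟨hp, fun h => (hs x h).2 (by simp)⟩
      · intro a ha
        rw [Walk.support_cons, List.mem_cons] at ha
        rcases ha with rfl | ha
        · exact hx
        · exact (hs a ha).1
    · refine hc x' z (Walk.cons hyx'.symm p) ?_ (by simp [hl]) ?_
      · rw [Walk.cons_isPath_iff]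
        exact ⟨hp, fun h => (hs x' h).2 (by simp)⟩
      · intro a ha
        rw [Walk.support_cons, List.mem_cons] at ha
        rcases ha with rfl | ha
        · exact hx'
        · exact (hs a ha).1
  have h2 : ∀ x ∈ U, ∀ y ∈ U, ∀ x' ∈ U, G.Adj x y → G.Adj y x' → c x = c x' := by
    intro x hx y hy x' hx' h h'
    obtain ⟨z, p, _, _, e1, e2⟩ := step x hx y hy x' hx' h h'
    rw [e1, e2]
  intro x hx y hy hxy
  obtain ⟨z, p, hl, hs, e1, _⟩ := step x hx y hy x hx hxy hxy.symm
  rw [e1, (color_walk h2 p hs).1 (by rw [hl]; exact even_two_mul r)]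

lemma sphere_no_dense {v : V} {ℓ k : ℕ} (hk : Odd k) (hk2 : 2 * ℓ < k)
    (hG : ¬ HasCycleLength G k) (U : Finset V) (hUl : ∀ x ∈ U, IsLv G v ℓ x)
    (hU : ∀ x ∈ U, k + 1 < (U.filter (fun y => G.Adj x y)).card) : U = ∅ := by
  have main : ∀ j, j ≤ ℓ → ∀ x ∈ U, ∀ y ∈ U, G.Adj x y →
      (par G v)^[ℓ - j] x = (par G v)^[ℓ - j] y := by
    intro j
    induction j with
    | zero =>
      intro _ x hx y hy _
      rw [Nat.sub_zero, isLv_zero.1 (par_iter (j := 0) (hUl x hx)),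
        isLv_zero.1 (par_iter (j := 0) (hUl y hy))]
    | succ j ih =>
      intro hj
      have ih' := ih (by omega)
      obtain ⟨i, hi⟩ : ∃ i, ℓ = i + 1 + j := ⟨ℓ - (j + 1), by omega⟩
      rw [show ℓ - j = i + 1 by omega] at ih'
      rw [show ℓ - (j + 1) = i by omega]
      have hodd : Odd (k - 2 * (i + 1)) := by
        rw [Nat.odd_sub (by omega)]
        simp [hk]
      refine color_adj hU hodd (by omega) ?_
      intro x z p hp hl hs
      by_contra hne
      have hw : ∀ {a b : V} (q : G.Walk a b), (∀ e ∈ q.support, e ∈ U) →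
          (par G v)^[i + 1] a = (par G v)^[i + 1] b := by
        intro a b q
        induction q with
        | nil => intro _; rfl
        | cons hadj q ihq =>
          intro hq
          rw [← ihq (fun e he => hq e (by simp [he]))]
          exact ih' _ (hq _ (by simp)) _ (hq _ (by simp)) hadj
      have hcyc := cycle_of_path i (j := j) p hp hl (by rw [← hi]; exact hUl _ (hs _ (by simp)))
        (by rw [← hi]; exact hUl _ (hs _ (by simp)))
        (fun y hy t ht => by have := (hUl _ (hs y hy)).unique ht; omega) hne (hw p hs)
      apply hG
      convert hcyc using 1
      omega
  by_contra hne
  obtain ⟨x, hx⟩ := Finset.nonempty_iff_ne_empty.2 hne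
  have h1 := hU x hx
  obtain ⟨y, hy⟩ := Finset.card_pos.1 (lt_of_le_of_lt (Nat.zero_le _) h1)
  rw [Finset.mem_filter] at hy
  have := main ℓ le_rfl x hx y hy.1 hy.2
  simp at this
  exact hy.2.ne this

lemma sphere_sparse {v : V} {ℓ k : ℕ} (hk : Odd k) (hk2 : 2 * ℓ < k)
    (hG : ¬ HasCycleLength G k) (S : Finset V) (hS : ∀ x ∈ S, IsLv G v ℓ x) :
    ∑ x ∈ S, (S.filter (fun y => G.Adj x y)).card ≤ 2 * (k + 1) * S.card := by
  apply sparse_of_no_dense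
  intro W hW hne
  by_contra hcon
  push Not at hcon
  have := sphere_no_dense hk hk2 hG W (fun x hx => hS x (hW hx)) hcon
  exact hne.ne_empty this

/-- The cut between a sphere and its complement. -/
lemma cut_exists {v : V} {ℓ k : ℕ} (hk : Odd k) (hk2 : 2 * ℓ < k)
    (hG : ¬ HasCycleLength G k) (S : Finset V) (hS : ∀ x ∈ S, IsLv G v ℓ x) :
    ∃ H : SimpleGraph V, H ≤ G ∧ H.Colorable 2 ∧
      ∑ x ∈ S, G.degree x ≤ H.edgeSet.ncard + 2 * (k + 1) * Fintype.card V := by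
  classical
  let H : SimpleGraph V :=
    { Adj := fun x y => G.Adj x y ∧ ((x ∈ S ∧ y ∉ S) ∨ (x ∉ S ∧ y ∈ S))
      symm := ⟨fun x y h => ⟨h.1.symm, by tauto⟩⟩
      loopless := ⟨fun x h => G.loopless.irrefl x h.1⟩ }
  refine ⟨H, fun x y h => h.1, ?_, ?_⟩
  · refine ⟨Coloring.mk (fun x => if x ∈ S then 0 else 1) ?_⟩
    intro x y h
    rcases h.2 with ⟨h1, h2⟩ | ⟨h1, h2⟩ <;> simp [h1, h2]
  · have hb : H.IsBipartiteWith (S : Set V) ((Sᶜ : Finset V) : Set V) := by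
      constructor
      · rw [Finset.disjoint_coe]; exact disjoint_compl_right
      · intro x y h
        have := h.2
        simpa using this
    have hE := isBipartiteWith_sum_degrees_eq_card_edges hb
    have hcard : H.edgeSet.ncard = H.edgeFinset.card := by
      rw [← coe_edgeFinset, Set.ncard_coe_finset]
    rw [hcard, ← hE]
    have h1 := sphere_sparse hk hk2 hG S hS
    have h2 : ∀ x ∈ S, G.degree x = H.degree x + (S.filter (fun y => G.Adj x y)).card := by
      intro x hx
      rw [← card_neighborFinset_eq_degree, ← card_neighborFinset_eq_degree,
        ← Finset.card_filter_add_card_filter_not (s := G.neighborFinset x) (fun y => y ∉ S)]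
      congr 2
      · ext y
        simp [H, hx]
      · ext y
        simp [and_comm]
    rw [Finset.sum_congr rfl h2, Finset.sum_add_distrib]
    have h3 : 2 * (k + 1) * S.card ≤ 2 * (k + 1) * Fintype.card V :=
      Nat.mul_le_mul_left _ (Finset.card_le_univ S)
    omega

end paths

section weights
open Classical in
/-- probability weight of the geodesic walk from `v` to `u` -/
noncomputable def qq {V : Type*} [Fintype V] (G : SimpleGraph V) (E : ℝ) : ℕ → V → V → ℝ
  | 0, v, u => if u = v then (G.degree v : ℝ) / E else 0
  | j + 1, v, w => ∑ u, if IsLv G v j u ∧ G.Adj u w ∧ IsLv G v (j + 1) w then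
      qq G E j v u / (G.degree u : ℝ) else 0

open Classical in
/-- weight times logarithm of the normalized degree product -/
noncomputable def aa {V : Type*} [Fintype V] (G : SimpleGraph V) (E d : ℝ) : ℕ → V → V → ℝ
  | 0, _, _ => 0
  | j + 1, v, w => ∑ u, if IsLv G v j u ∧ G.Adj u w ∧ IsLv G v (j + 1) w then
      aa G E d j v u / (G.degree u : ℝ) +
        qq G E j v u / (G.degree u : ℝ) * Real.log ((G.degree w : ℝ) / d) else 0

open Classical

variable {V : Type*} [Fintype V] {G : SimpleGraph V} {E d : ℝ}

lemma qq_nonneg (hE : 0 < E) : ∀ j v u, 0 ≤ qq G E j v u := by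
  intro j
  induction j with
  | zero => intro v u; rw [qq]; split_ifs <;> positivity
  | succ j ih =>
    intro v u
    rw [qq]
    apply Finset.sum_nonneg
    intro w _
    split_ifs
    · exact div_nonneg (ih v w) (by positivity)
    · exact le_rfl

lemma qq_zero_of_not {j : ℕ} {v u : V} (h : ¬ IsLv G v j u) : qq G E j v u = 0 := by
  cases j with
  | zero => rw [isLv_zero] at h; simp [qq, h]
  | succ j => simp [qq, h]

lemma aa_zero_of_not {j : ℕ} {v u : V} (h : ¬ IsLv G v j u) : aa G E d j v u = 0 := by
  cases j with
  | zero => simp [aa]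
  | succ j => simp [aa, h]

lemma qq_marginal (hE : 0 < E) : ∀ j u, ∑ v, qq G E j v u ≤ (G.degree u : ℝ) / E := by
  intro j
  induction j with
  | zero => intro u; simp [qq]
  | succ j ih =>
    intro w
    simp only [qq]
    rw [Finset.sum_comm]
    have : (G.degree w : ℝ) / E = ∑ u, if G.Adj w u then 1 / E else 0 := by
      rw [← Finset.sum_filter, Finset.sum_const, ← card_neighborFinset_eq_degree,
        neighborFinset_eq_filter, nsmul_eq_mul]
      ring
    rw [this]
    apply Finset.sum_le_sum
    intro u _
    by_cases h : G.Adj w u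
    · rw [if_pos h]
      have hpos : (0 : ℝ) < G.degree u := by
        rw [Nat.cast_pos, degree_pos_iff_exists_adj]
        exact ⟨w, h.symm⟩
      calc _ ≤ ∑ v, qq G E j v u / (G.degree u : ℝ) := by
            apply Finset.sum_le_sum
            intro v _
            split_ifs
            · exact le_rfl
            · exact div_nonneg (qq_nonneg hE _ _ _) hpos.le
        _ = (∑ v, qq G E j v u) / (G.degree u : ℝ) := by rw [Finset.sum_div]
        _ ≤ ((G.degree u : ℝ) / E) / (G.degree u : ℝ) := by
            gcongr
            exact ih u
        _ = 1 / E := by field_simp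
    · rw [if_neg h]
      apply le_of_eq
      apply Finset.sum_eq_zero
      intro v _
      rw [if_neg]
      rintro ⟨_, h2, _⟩
      exact h h2.symm

lemma qq_le (hE : 0 < E) (j : ℕ) (v u : V) : qq G E j v u ≤ (G.degree u : ℝ) / E :=
  (Finset.single_le_sum (f := fun v => qq G E j v u) (fun v _ => qq_nonneg hE j v u)
    (Finset.mem_univ v)).trans (qq_marginal hE j u)

lemma structural {ℓ : ℕ} (hG : EvenCycleFree G ℓ) (hE : 0 < E) (hd : 1 ≤ d) (v : V) :
    ∀ j, j ≤ ℓ → ∀ s, IsLv G v j s → ∃ x : ℝ, 0 < x ∧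
      Real.log x ≤ j * Real.log (Fintype.card V) ∧
      qq G E j v s * (E * d ^ j * x) = G.degree s ∧
      aa G E d j v s = qq G E j v s * Real.log x := by
  intro j
  induction j with
  | zero =>
    intro _ s hs
    rw [isLv_zero] at hs
    refine ⟨1, one_pos, by simp, ?_, by simp [aa]⟩
    subst hs
    simp [qq]
    field_simp
  | succ j ih =>
    intro hj w hw
    obtain ⟨u, hu, hlu⟩ := hw.pred
    obtain ⟨x, hx, hlog, hq, ha⟩ := ih (by omega) u hlu
    have hDu : (0 : ℝ) < G.degree u := by
      rw [Nat.cast_pos, degree_pos_iff_exists_adj]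
      exact ⟨w, hu.symm⟩
    have hDw : (0 : ℝ) < G.degree w := by
      rw [Nat.cast_pos, degree_pos_iff_exists_adj]
      exact ⟨u, hu⟩
    have hd0 : 0 < d := by linarith
    have hcond : ∀ b, b ≠ u → ¬ (IsLv G v j b ∧ G.Adj b w ∧ IsLv G v (j + 1) w) := by
      rintro b hb ⟨h1, h2, h3⟩
      exact hb (pred_unique hG hj h3 h1 hlu h2 hu)
    have hq' : qq G E (j + 1) v w = qq G E j v u / (G.degree u : ℝ) := by
      rw [qq, Finset.sum_eq_single u]
      · rw [if_pos ⟨hlu, hu.symm, hw⟩]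
      · intro b _ hb
        rw [if_neg (hcond b hb)]
      · simp
    have ha' : aa G E d (j + 1) v w = aa G E d j v u / (G.degree u : ℝ) +
        qq G E j v u / (G.degree u : ℝ) * Real.log ((G.degree w : ℝ) / d) := by
      rw [aa, Finset.sum_eq_single u]
      · rw [if_pos ⟨hlu, hu.symm, hw⟩]
      · intro b _ hb
        rw [if_neg (hcond b hb)]
      · simp
    refine ⟨x * ((G.degree w : ℝ) / d), by positivity, ?_, ?_, ?_⟩
    · rw [Real.log_mul hx.ne' (by positivity)]
      have : Real.log ((G.degree w : ℝ) / d) ≤ Real.log (Fintype.card V) := by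
        apply Real.log_le_log (by positivity)
        calc (G.degree w : ℝ) / d ≤ G.degree w := div_le_self hDw.le hd
          _ ≤ _ := by exact_mod_cast (G.degree_lt_card_verts w).le
      push_cast
      linarith
    · rw [hq', pow_succ]
      rw [← hq] at hDu ⊢
      have hqne : qq G E j v u ≠ 0 := by
        intro h
        rw [h] at hDu
        simp at hDu
      field_simp
    · rw [ha', hq', ha, Real.log_mul hx.ne' (by positivity)]
      ring

lemma aa_le {ℓ : ℕ} (hG : EvenCycleFree G ℓ) (hE : 0 < E) (hd : 1 ≤ d) {j : ℕ} (hj : j ≤ ℓ)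
    (v s : V) : aa G E d j v s ≤ qq G E j v s * (j * Real.log (Fintype.card V)) := by
  by_cases h : IsLv G v j s
  · obtain ⟨x, hx, hlog, hq, ha⟩ := structural hG hE hd v j hj s h
    rw [ha]
    exact mul_le_mul_of_nonneg_left hlog (qq_nonneg hE _ _ _)
  · rw [qq_zero_of_not h, aa_zero_of_not h]
    simp

lemma aa_zero_of_qq {ℓ : ℕ} (hG : EvenCycleFree G ℓ) (hE : 0 < E) (hd : 1 ≤ d) {j : ℕ}
    (hj : j ≤ ℓ) {v s : V} (h0 : qq G E j v s = 0) : aa G E d j v s = 0 := by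
  by_cases h : IsLv G v j s
  · obtain ⟨x, hx, hlog, hq, ha⟩ := structural hG hE hd v j hj s h
    rw [ha, h0, zero_mul]
  · exact aa_zero_of_not h

/-- total loss in one step -/
lemma loss_le (hE : 0 < E) (hd : 1 ≤ d) (hEd : E = d * Fintype.card V) (j : ℕ) {c : ℝ}
    (hc : 0 ≤ c) :
    ∑ v, ∑ u, 2 / (G.degree u : ℝ) * (qq G E j v u * c) ≤ 2 * c / d := by
  rw [Finset.sum_comm]
  have hd0 : 0 < d := by linarith
  calc _ ≤ ∑ u : V, 2 * c / E := by
        apply Finset.sum_le_sum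
        intro u _
        rw [← Finset.mul_sum, ← Finset.sum_mul]
        have h1 := qq_marginal (G := G) hE j u
        rcases (Nat.cast_nonneg (α := ℝ) (G.degree u)).eq_or_lt with h | h
        · rw [← h]; simp; positivity
        · calc _ ≤ 2 / (G.degree u : ℝ) * ((G.degree u : ℝ) / E * c) := by gcongr
            _ = 2 * c / E := by field_simp
    _ = 2 * c / d := by
        rw [Finset.sum_const, Finset.card_univ, nsmul_eq_mul, hEd]
        have : (0 : ℝ) < Fintype.card V := by
          rw [hEd] at hE
          exact pos_of_mul_pos_right hE hd0.le
        field_simp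

/-- transport of a weight one step forward -/
lemma transport {ℓ j : ℕ} (hG : EvenCycleFree G ℓ) (hj : j + 1 ≤ ℓ) (hE : 0 < E) (v : V)
    (b : V → ℝ) {c : ℝ} (hc : 0 ≤ c) (hb : ∀ u, b u ≤ qq G E j v u * c)
    (hb0 : ∀ u, qq G E j v u = 0 → b u = 0) :
    ∑ u, (b u - 2 / (G.degree u : ℝ) * (qq G E j v u * c)) ≤
      ∑ w, ∑ u, if IsLv G v j u ∧ G.Adj u w ∧ IsLv G v (j + 1) w then
        b u / (G.degree u : ℝ) else 0 := by
  rw [Finset.sum_comm]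
  apply Finset.sum_le_sum
  intro u _
  by_cases hq : qq G E j v u = 0
  · rw [hb0 u hq, hq]; simp
  have hu : IsLv G v j u := by
    by_contra h
    exact hq (qq_zero_of_not h)
  have hq0 := qq_nonneg (G := G) hE j v u
  have hD : (0 : ℝ) < G.degree u := by
    rcases (Nat.cast_nonneg (α := ℝ) (G.degree u)).eq_or_lt with h | h
    · exfalso
      have := qq_le (G := G) hE j v u
      rw [← h, zero_div] at this
      exact hq (le_antisymm this hq0)
    · exact h
  rw [← Finset.sum_filter, Finset.sum_const, nsmul_eq_mul]
  set s := Finset.univ.filter (fun w => IsLv G v j u ∧ G.Adj u w ∧ IsLv G v (j + 1) w) with hs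
  set s' := Finset.univ.filter (fun w => G.Adj u w ∧ ¬ IsLv G v (j + 1) w) with hs'
  have hcard : s.card + s'.card = G.degree u := by
    rw [← card_neighborFinset_eq_degree,
      ← Finset.card_filter_add_card_filter_not (s := G.neighborFinset u)
        (fun w => IsLv G v (j + 1) w)]
    congr 2
    · ext w
      simp [hs, hu]
    · ext w
      simp [hs']
  have h2 : s'.card ≤ 2 := by
    apply card_bad hG hj hu
    intro w hw
    simpa [hs'] using hw
  have hcard' : (s.card : ℝ) = G.degree u - s'.card := by
    rw [← hcard]; push_cast; ring
  have h2' : (s'.card : ℝ) ≤ 2 := by exact_mod_cast h2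
  have h3 : (0 : ℝ) ≤ s'.card := by positivity
  rw [hcard']
  have e1 : ((G.degree u : ℝ) - s'.card) * (b u / (G.degree u : ℝ)) =
      b u - s'.card / (G.degree u : ℝ) * b u := by field_simp
  rw [e1]
  have h4 : s'.card / (G.degree u : ℝ) * b u ≤
      2 / (G.degree u : ℝ) * (qq G E j v u * c) := by
    calc _ ≤ s'.card / (G.degree u : ℝ) * (qq G E j v u * c) := by
          gcongr
          exact hb u
      _ ≤ _ := by gcongr
  linarith

lemma Q_lower {ℓ : ℕ} (hG : EvenCycleFree G ℓ) (hE : 0 < E) (hd : 1 ≤ d)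
    (hEd : E = d * Fintype.card V) (hEs : E = ∑ u, (G.degree u : ℝ)) :
    ∀ j, j ≤ ℓ → 1 - 2 * j / d ≤ ∑ v, ∑ u, qq G E j v u := by
  intro j
  induction j with
  | zero =>
    intro _
    simp only [qq]
    simp
    rw [← Finset.sum_div, ← hEs, div_self hE.ne']
  | succ j ih =>
    intro hj
    have h1 := ih (by omega)
    have h2 := loss_le (G := G) hE hd hEd j (zero_le_one' ℝ)
    have h3 := Finset.sum_le_sum (s := Finset.univ) (fun v _ => transport hG hj hE v
      (fun u => qq G E j v u) (zero_le_one' ℝ) (fun u => by simp) (fun u h => h))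
    simp only [Finset.sum_sub_distrib] at h3
    simp only [qq]
    have : 2 * ((j + 1 : ℕ) : ℝ) / d = 2 * j / d + 2 * 1 / d := by push_cast; ring
    linarith

lemma log_term (hE : 0 < E) (hd : 1 ≤ d) (hEd : E = d * Fintype.card V)
    (hEs : E = ∑ u, (G.degree u : ℝ)) (μ : V → ℝ) (h0 : ∀ w, 0 ≤ μ w)
    (h1 : ∀ w, μ w ≤ (G.degree w : ℝ) / E) {η : ℝ} (h2 : 1 - η ≤ ∑ w, μ w) :
    - (η * Real.log (Fintype.card V)) ≤ ∑ w, μ w * Real.log ((G.degree w : ℝ) / d) := by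
  have hd0 : 0 < d := by linarith
  have hlog0 : 0 ≤ Real.log (Fintype.card V) := Real.log_natCast_nonneg _
  have key : ∀ w, ((G.degree w : ℝ) - d) / E -
      ((G.degree w : ℝ) / E - μ w) * Real.log (Fintype.card V) ≤
        μ w * Real.log ((G.degree w : ℝ) / d) := by
    intro w
    rcases (Nat.cast_nonneg (α := ℝ) (G.degree w)).eq_or_lt with h | h
    · have := h1 w
      rw [← h, zero_div] at this
      have hμ : μ w = 0 := le_antisymm this (h0 w)
      rw [hμ, ← h]
      simp
      exact div_nonpos_of_nonpos_of_nonneg (by linarith) hE.le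
    · have hx : 0 < (G.degree w : ℝ) / d := by positivity
      have hl1 : Real.log ((G.degree w : ℝ) / d) ≤ Real.log (Fintype.card V) := by
        apply Real.log_le_log hx
        calc (G.degree w : ℝ) / d ≤ G.degree w := div_le_self h.le hd
          _ ≤ _ := by exact_mod_cast (G.degree_lt_card_verts w).le
      have hl2 : 1 - ((G.degree w : ℝ) / d)⁻¹ ≤ Real.log ((G.degree w : ℝ) / d) :=
        Real.one_sub_inv_le_log_of_pos hx
      have a1 : ((G.degree w : ℝ) / E - μ w) * Real.log ((G.degree w : ℝ) / d) ≤
          ((G.degree w : ℝ) / E - μ w) * Real.log (Fintype.card V) :=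
        mul_le_mul_of_nonneg_left hl1 (by linarith [h1 w])
      have a2 : (G.degree w : ℝ) / E * (1 - ((G.degree w : ℝ) / d)⁻¹) ≤
          (G.degree w : ℝ) / E * Real.log ((G.degree w : ℝ) / d) :=
        mul_le_mul_of_nonneg_left hl2 (by positivity)
      have a3 : (G.degree w : ℝ) / E * (1 - ((G.degree w : ℝ) / d)⁻¹) =
          ((G.degree w : ℝ) - d) / E := by
        field_simp
      nlinarith
  refine le_trans ?_ (Finset.sum_le_sum (fun w _ => key w))
  rw [Finset.sum_sub_distrib, ← Finset.sum_div, Finset.sum_sub_distrib, ← hEs, ← Finset.sum_mul,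
    Finset.sum_sub_distrib, ← Finset.sum_div, ← hEs, Finset.sum_const, Finset.card_univ,
    nsmul_eq_mul, div_self hE.ne', hEd]
  rw [show d * (Fintype.card V : ℝ) - Fintype.card V * d = 0 by ring]
  rw [zero_div]
  nlinarith

lemma A_lower {ℓ : ℕ} (hG : EvenCycleFree G ℓ) (hE : 0 < E) (hd : 1 ≤ d)
    (hEd : E = d * Fintype.card V) (hEs : E = ∑ u, (G.degree u : ℝ)) :
    ∀ j, j ≤ ℓ → - (2 * (j : ℝ) ^ 2 / d * Real.log (Fintype.card V)) ≤
      ∑ v, ∑ u, aa G E d j v u := by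
  intro j
  induction j with
  | zero => intro _; simp [aa]
  | succ j ih =>
    intro hj
    have hlog0 : 0 ≤ Real.log (Fintype.card V) := Real.log_natCast_nonneg _
    have hc : 0 ≤ (j : ℝ) * Real.log (Fintype.card V) := by positivity
    have h1 := ih (by omega)
    have h2 := loss_le (G := G) hE hd hEd j hc
    have h3 := Finset.sum_le_sum (s := Finset.univ) (fun v _ => transport hG hj hE v
      (fun u => aa G E d j v u) hc (fun u => aa_le hG hE hd (by omega) v u)
      (fun u h => aa_zero_of_qq hG hE hd (by omega) h))
    simp only [Finset.sum_sub_distrib] at h3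
    have hQ := Q_lower hG hE hd hEd hEs (j + 1) hj
    rw [Finset.sum_comm] at hQ
    have h4 := log_term hE hd hEd hEs (fun w => ∑ v, qq G E (j + 1) v w)
      (fun w => Finset.sum_nonneg (fun v _ => qq_nonneg hE _ _ _)) (fun w => qq_marginal hE _ w) hQ
    have h5 : ∑ v, ∑ w, aa G E d (j + 1) v w =
        (∑ v, ∑ w, ∑ u, if IsLv G v j u ∧ G.Adj u w ∧ IsLv G v (j + 1) w then
          aa G E d j v u / (G.degree u : ℝ) else 0) +
        ∑ w, (∑ v, qq G E (j + 1) v w) * Real.log ((G.degree w : ℝ) / d) := by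
      simp only [Finset.sum_mul]
      rw [Finset.sum_comm (f := fun w v => qq G E (j + 1) v w * Real.log ((G.degree w : ℝ) / d)),
        ← Finset.sum_add_distrib]
      apply Finset.sum_congr rfl
      intro v _
      rw [← Finset.sum_add_distrib]
      apply Finset.sum_congr rfl
      intro w _
      rw [aa, qq, Finset.sum_mul, ← Finset.sum_add_distrib]
      apply Finset.sum_congr rfl
      intro u _
      split_ifs <;> simp
    rw [h5]
    have e : 2 * (((j + 1 : ℕ) : ℝ)) ^ 2 / d * Real.log (Fintype.card V) =
      2 * (j : ℝ) ^ 2 / d * Real.log (Fintype.card V) +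
      2 * (j * Real.log (Fintype.card V)) / d +
      2 * ((j + 1 : ℕ) : ℝ) / d * Real.log (Fintype.card V) := by
      push_cast; ring
    linarith

/-- A vertex whose sphere of radius `ℓ` has large degree sum. -/
lemma exists_good_vertex {ℓ : ℕ} (hG : EvenCycleFree G ℓ) (hE : 0 < E) (hd : 1 ≤ d)
    (hEd : E = d * Fintype.card V) (hEs : E = ∑ u, (G.degree u : ℝ)) :
    ∃ v, d ^ (ℓ + 1) - d ^ ℓ * (2 * ℓ + 2 * (ℓ : ℝ) ^ 2 * Real.log (Fintype.card V)) ≤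
      ∑ s ∈ Finset.univ.filter (fun s => IsLv G v ℓ s), (G.degree s : ℝ) := by
  have hd0 : 0 < d := by linarith
  have hcard : (0 : ℝ) < Fintype.card V := by
    rw [hEd] at hE
    exact pos_of_mul_pos_right hE hd0.le
  have : Nonempty V := by
    rw [Nat.cast_pos, Fintype.card_pos_iff] at hcard
    exact hcard
  by_contra hcon
  push Not at hcon
  have hlt := Finset.sum_lt_sum_of_nonempty (s := Finset.univ) Finset.univ_nonempty
    (fun v (_ : v ∈ Finset.univ) => hcon v)
  rw [Finset.sum_const, Finset.card_univ, nsmul_eq_mul] at hlt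
  have hlow : ∀ v, E * d ^ ℓ * (∑ s, qq G E ℓ v s + ∑ s, aa G E d ℓ v s) ≤
      ∑ s ∈ Finset.univ.filter (fun s => IsLv G v ℓ s), (G.degree s : ℝ) := by
    intro v
    rw [← Finset.sum_add_distrib, Finset.mul_sum, Finset.sum_filter]
    apply Finset.sum_le_sum
    intro s _
    by_cases h : IsLv G v ℓ s
    · rw [if_pos h]
      obtain ⟨x, hx, _, hq, ha⟩ := structural hG hE hd v ℓ le_rfl s h
      rw [ha, ← hq]
      have h1 : 1 + Real.log x ≤ x := by linarith [Real.log_le_sub_one_of_pos hx]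
      have h2 : 0 ≤ E * d ^ ℓ * qq G E ℓ v s :=
        mul_nonneg (by positivity) (qq_nonneg hE _ _ _)
      nlinarith
    · rw [if_neg h, qq_zero_of_not h, aa_zero_of_not h]; simp
  have hsum := Finset.sum_le_sum (s := Finset.univ) (fun v _ => hlow v)
  rw [← Finset.mul_sum, Finset.sum_add_distrib] at hsum
  have hQ := Q_lower hG hE hd hEd hEs ℓ le_rfl
  have hA := A_lower hG hE hd hEd hEs ℓ le_rfl
  have hm : E * d ^ ℓ * ((1 - 2 * ℓ / d) +
      - (2 * (ℓ : ℝ) ^ 2 / d * Real.log (Fintype.card V))) ≤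
      E * d ^ ℓ * (∑ v, ∑ s, qq G E ℓ v s + ∑ v, ∑ s, aa G E d ℓ v s) :=
    mul_le_mul_of_nonneg_left (add_le_add hQ hA) (by positivity)
  have he : E * d ^ ℓ * ((1 - 2 * ℓ / d) +
      - (2 * (ℓ : ℝ) ^ 2 / d * Real.log (Fintype.card V))) =
      Fintype.card V * (d ^ (ℓ + 1) -
        d ^ ℓ * (2 * ℓ + 2 * (ℓ : ℝ) ^ 2 * Real.log (Fintype.card V))) := by
    rw [hEd, pow_succ]
    field_simp
    ring
  linarith

end weights

lemma stability_aux (ℓ k : ℕ) (hℓ0 : 0 < ℓ)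
    (hk : Odd k) (hk2 : 2 * ℓ < k) (c₁ c₂ ε : ℝ) (hc₁ : 0 < c₁) (hc₂ : 0 < c₂)
    (hε : 0 < ε) :
    ∃ N : ℕ, ∀ n : ℕ, N ≤ n → ∀ G : SimpleGraph (Fin n),
      EvenCycleFree G ℓ → ¬ HasCycleLength G k →
      c₁ * (n : ℝ) ^ ((1 : ℝ) / ℓ) ≤ 2 * (G.edgeSet.ncard : ℝ) / n →
      2 * (G.edgeSet.ncard : ℝ) / n ≤ c₂ * (n : ℝ) ^ ((1 : ℝ) / ℓ) →
      ∃ H : SimpleGraph (Fin n), H ≤ G ∧ H.Colorable 2 ∧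
        (H.edgeSet.ncard : ℝ) ≥
          (2 * (G.edgeSet.ncard : ℝ) / n) ^ (ℓ + 1) - ε * (n : ℝ) ^ (1 + (1 : ℝ) / ℓ) := by
  classical
  have hr : (0 : ℝ) < 1 / ℓ := by positivity
  have ht : Filter.Tendsto (fun n : ℕ => (n : ℝ) ^ ((1 : ℝ) / ℓ)) Filter.atTop Filter.atTop :=
    (tendsto_rpow_atTop hr).comp tendsto_natCast_atTop_atTop
  have e1 : ∀ᶠ n : ℕ in Filter.atTop, 1 / c₁ ≤ (n : ℝ) ^ ((1 : ℝ) / ℓ) :=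
    ht.eventually_ge_atTop _
  set K : ℝ := c₂ ^ ℓ * (2 * ℓ) + 2 * (k + 1) with hK
  set M : ℝ := c₂ ^ ℓ * (2 * (ℓ : ℝ) ^ 2) with hM
  have hM0 : 0 < M := by positivity
  have e2 : ∀ᶠ n : ℕ in Filter.atTop, K / (ε / 2) ≤ (n : ℝ) ^ ((1 : ℝ) / ℓ) :=
    ht.eventually_ge_atTop _
  have e3 : ∀ᶠ n : ℕ in Filter.atTop,
      ‖Real.log n‖ ≤ (ε / 2 / M) * ‖(n : ℝ) ^ ((1 : ℝ) / ℓ)‖ :=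
    tendsto_natCast_atTop_atTop.eventually
      ((isLittleO_log_rpow_atTop hr).def (by positivity : 0 < ε / 2 / M))
  obtain ⟨N, hN⟩ := Filter.eventually_atTop.1
    (e1.and (e2.and (e3.and (Filter.eventually_ge_atTop 1))))
  refine ⟨N, fun n hn G hG hGk hd1 hd2 => ?_⟩
  obtain ⟨h1, h2, h3, h4⟩ := hN n hn
  have hn0 : (0 : ℝ) < n := by exact_mod_cast h4
  set R : ℝ := (n : ℝ) ^ ((1 : ℝ) / ℓ) with hR
  have hR0 : 0 < R := by positivity
  set d : ℝ := 2 * (G.edgeSet.ncard : ℝ) / n with hd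
  have hd_one : 1 ≤ d := by
    rw [div_le_iff₀ hc₁] at h1
    linarith
  have hcard : G.edgeSet.ncard = G.edgeFinset.card := by
    rw [← coe_edgeFinset, Set.ncard_coe_finset]
  have hEd : (∑ u, (G.degree u : ℝ)) = d * Fintype.card (Fin n) := by
    have := G.sum_degrees_eq_twice_card_edges
    rw [← Nat.cast_sum, this, ← hcard, Fintype.card_fin, hd]
    push_cast
    field_simp
  have hE : 0 < ∑ u, (G.degree u : ℝ) := by
    rw [hEd, Fintype.card_fin]; positivity
  obtain ⟨v, hv⟩ := exists_good_vertex hG hE hd_one hEd rfl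
  obtain ⟨H, hH1, hH2, hH3⟩ := cut_exists (v := v) hk hk2 hGk
    (Finset.univ.filter (fun s => IsLv G v ℓ s)) (by simp)
  refine ⟨H, hH1, hH2, ?_⟩
  rw [Fintype.card_fin] at hv hH3
  have hH3' : ∑ x ∈ Finset.univ.filter (fun s => IsLv G v ℓ s), (G.degree x : ℝ) ≤
      H.edgeSet.ncard + 2 * (k + 1) * n := by exact_mod_cast hH3
  have hlog0 : 0 ≤ Real.log n := Real.log_natCast_nonneg _
  rw [Real.norm_of_nonneg hlog0, Real.norm_of_nonneg hR0.le] at h3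
  have hdl : d ^ ℓ ≤ c₂ ^ ℓ * n := by
    calc d ^ ℓ ≤ (c₂ * R) ^ ℓ := by gcongr
      _ = c₂ ^ ℓ * n := by
        rw [mul_pow, hR, ← Real.rpow_natCast (_ ^ _) ℓ, ← Real.rpow_mul hn0.le,
          one_div_mul_cancel (by positivity), Real.rpow_one]
  have hpow : (n : ℝ) ^ (1 + (1 : ℝ) / ℓ) = n * R := by
    rw [Real.rpow_add hn0, Real.rpow_one]
  have hb : d ^ ℓ * (2 * ℓ + 2 * (ℓ : ℝ) ^ 2 * Real.log n) ≤
      c₂ ^ ℓ * n * (2 * ℓ + 2 * (ℓ : ℝ) ^ 2 * Real.log n) := by gcongr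
  have h2' : K ≤ R * (ε / 2) := by rwa [div_le_iff₀ (by positivity)] at h2
  have h3' : M * Real.log n ≤ R * (ε / 2) := by
    calc M * Real.log n ≤ M * (ε / 2 / M * R) := by gcongr
      _ = R * (ε / 2) := by field_simp
  have hfin : n * (K + M * Real.log n) ≤ n * (R * (ε / 2) + R * (ε / 2)) := by gcongr
  have heq : c₂ ^ ℓ * n * (2 * ℓ + 2 * (ℓ : ℝ) ^ 2 * Real.log n) + 2 * (k + 1) * n =
      n * (K + M * Real.log n) := by rw [hK, hM]; ring
  rw [hpow]
  nlinarith

theorem stability_even_cycles (ℓ k : ℕ) (hℓ : ℓ = 2 ∨ ℓ = 3 ∨ ℓ = 5)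
    (hk : Odd k) (hk2 : 2 * ℓ < k) (c₁ c₂ ε : ℝ) (hc₁ : 0 < c₁) (hc₂ : 0 < c₂)
    (hε : 0 < ε) :
    ∃ N : ℕ, ∀ n : ℕ, N ≤ n → ∀ G : SimpleGraph (Fin n),
      EvenCycleFree G ℓ → ¬ HasCycleLength G k →
      c₁ * (n : ℝ) ^ ((1 : ℝ) / ℓ) ≤ 2 * (G.edgeSet.ncard : ℝ) / n →
      2 * (G.edgeSet.ncard : ℝ) / n ≤ c₂ * (n : ℝ) ^ ((1 : ℝ) / ℓ) →
      ∃ H : SimpleGraph (Fin n), H ≤ G ∧ H.Colorable 2 ∧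
        (H.edgeSet.ncard : ℝ) ≥
          (2 * (G.edgeSet.ncard : ℝ) / n) ^ (ℓ + 1) - ε * (n : ℝ) ^ (1 + (1 : ℝ) / ℓ) :=
  stability_aux ℓ k (by omega) hk hk2 c₁ c₂ ε hc₁ hc₂ hε
end
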